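/- Let N be a positive integer and let s ∈ ℂ satisfy s^N = 1 and s³ ≠ 1. Then the formal power series G(t,s,x,y) = ∑_{n≥0} t^n ∑_{(k,a,b)} p_{n,(k,a,b)} s^k x^a y^b ∈ ℂ[x,y][[t]] is algebraic over ℂ(t,x,y), and likewise the series G̃(t,s,x,y) = ∑_{n≥0} t^n ∑_{(k,a,b)} p̃_{n,(k,a,b)} s^k x^a y^b is algebraic over ℂ(t,x,y). -/

import Mathlib

open scoped BigOperators
noncomputable section

abbrev WSt : Type := ℤ × ℕ × ℕ

def cellStep (v w : WSt) : Prop :=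
  w = (v.1, v.2.1 + 1, v.2.2 + 1) ∨
  (1 ≤ v.2.2 ∧ w = (v.1, v.2.1, v.2.2 - 1)) ∨
  (1 ≤ v.2.1 ∧ w = (v.1, v.2.1 - 1, v.2.2)) ∨
  (v.2.1 = 0 ∧ w = (v.1 + 1, v.2.2, 0)) ∨
  (v.2.2 = 0 ∧ w = (v.1 - 1, 0, v.2.1 + 1))

def vertStep (v w : WSt) : Prop :=
  w = (v.1, v.2.1 + 1, v.2.2 + 1) ∨
  (1 ≤ v.2.2 ∧ w = (v.1, v.2.1, v.2.2 - 1)) ∨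
  (1 ≤ v.2.1 ∧ w = (v.1, v.2.1 - 1, v.2.2)) ∨
  (v.2.1 = 0 ∧ 1 ≤ v.2.2 ∧ w = (v.1 + 1, v.2.2 - 1, 0)) ∨
  (v.2.2 = 0 ∧ w = (v.1 - 1, 0, v.2.1 + 2))

def pathCount (step : WSt → WSt → Prop) (n : ℕ) (v : WSt) : ℕ :=
  Nat.card {p : Fin (n + 1) → WSt //
    p 0 = ((0 : ℤ), 0, 0) ∧ p (Fin.last n) = v ∧
    ∀ i : Fin n, step (p i.castSucc) (p i.succ)}

/-- number of cell-centred excursions of length `n` with winding angle `2πk/3` -/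
def eCell (n : ℕ) (k : ℤ) : ℕ := pathCount cellStep n (k, 0, 0)

/-- number of vertex-centred walks of length `n` with winding angle `2πk/3` -/
def eVert (n : ℕ) (k : ℤ) : ℕ := pathCount vertStep n (k, 0, 0)

/-- The series `T_k(u,q)`. -/
def Tk (k : ℕ) (u q : ℂ) : ℂ :=
  ∑' n : ℕ, (-1 : ℂ) ^ n * ((2 * n + 1 : ℕ) : ℂ) ^ k * q ^ (n * (n + 1) / 2) *
    (u ^ (n + 1) - (-1 : ℂ) ^ k * u ^ (-(n : ℤ)))

/-- Jacobi theta function θ₁₁. -/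
def jTheta (z τ : ℂ) : ℂ :=
  ∑' n : ℤ, (-1 : ℂ) ^ n *
    Complex.exp (((2 * (n : ℂ) + 1) / 2) ^ 2 * Complex.I * (Real.pi : ℂ) * τ +
      (2 * (n : ℂ) + 1) * Complex.I * z)

/-- derivative of θ with respect to z -/
def jTheta' (z τ : ℂ) : ℂ := deriv (fun w => jTheta w τ) z

/-- The series `G(t,s,x,y)` with `s` specialised to a complex number, viewed inside
`ℂ[[t,x,y]]` (variable `0` is `t`, variable `1` is `x`, variable `2` is `y`);
the sum over `k` has finitely many nonzero terms. -/
def cellGC (s : ℂ) : MvPowerSeries (Fin 3) ℂ := fun d =>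
  ∑' k : ℤ, (pathCount cellStep (d 0) (k, d 1, d 2) : ℂ) * s ^ k

/-- The series `G̃(t,s,x,y)` with `s` specialised to a complex number. -/
def vertGC (s : ℂ) : MvPowerSeries (Fin 3) ℂ := fun d =>
  ∑' k : ℤ, (pathCount vertStep (d 0) (k, d 1, d 2) : ℂ) * s ^ k

theorem Derivation.exists_apply_ne_zero_of_transcendental {F K : Type} [Field F] [Field K]
    [CharZero F] [Algebra F K] {α : K} (hα : Transcendental F α) :
    ∃ D : Derivation F K K, D α ≠ 0 := by
  classical
  obtain ⟨s, hs, hB⟩ := exists_isTranscendenceBasis_superset (R := F) (A := K) (s := {α})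
    ((algebraicIndependent_singleton_iff (x := fun i : ({α} : Set K) => (i : K)) ⟨α, rfl⟩).2 hα)
  set S := MvPolynomial s F
  let : Algebra S K := (MvPolynomial.aeval (R := F) (Subtype.val : s → K)).toAlgebra
  have : IsScalarTower F S K := IsScalarTower.of_algebraMap_eq fun r => by
    simp [S, RingHom.algebraMap_toAlgebra]
  have hinj : Function.Injective (algebraMap S K) := hB.1
  have : FaithfulSMul S K := (faithfulSMul_iff_algebraMap_injective S K).2 hinj
  let := FractionRing.liftAlgebra S K
  have := FractionRing.isScalarTower_liftAlgebra S K
  have : Algebra.IsAlgebraic S K := by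
    have h1 := hB.isAlgebraic
    constructor
    intro x
    have h2 := h1.isAlgebraic x
    refine IsAlgebraic.of_ringHom_of_comp_eq
      (f := (hB.1.aevalEquiv : S ≃ₐ[F] _).toRingEquiv.toRingHom) (g := RingHom.id K)
      (by simpa using h2) (hB.1.aevalEquiv).surjective (fun a b h => h) ?_
    ext x
    all_goals simp [RingHom.algebraMap_toAlgebra, AlgebraicIndependent.aevalEquiv]
  have : Algebra.IsAlgebraic (FractionRing S) K :=
    (IsFractionRing.comap_isAlgebraic_iff (A := S) (K := FractionRing S) (C := K)).1 inferInstance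
  have : CharZero (FractionRing S) := charZero_of_injective_algebraMap (R := F)
    (FaithfulSMul.algebraMap_injective F (FractionRing S))
  have : Algebra.FormallyEtale (FractionRing S) K := Algebra.FormallyEtale.of_isSeparable _ _
  have : Algebra.FormallyEtale S (FractionRing S) :=
    Algebra.FormallyEtale.of_isLocalization (nonZeroDivisors S)
  have : Algebra.FormallyEtale S K := Algebra.FormallyEtale.comp S (FractionRing S) K
  let d : Derivation F S K := MvPolynomial.mkDerivation F fun i : s => if i.1 = α then 1 else 0
  let l := (KaehlerDifferential.isBaseChange_of_formallyEtale F S K).lift d.liftKaehlerDifferential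
  refine ⟨l.compDer (KaehlerDifferential.D F K), ?_⟩
  have hX : α = algebraMap S K (MvPolynomial.X ⟨α, hs rfl⟩) := by
    simp [RingHom.algebraMap_toAlgebra, S]
  have : l (KaehlerDifferential.D F K α) = 1 := by
    rw [hX, ← KaehlerDifferential.map_D F F S K]
    rw [IsBaseChange.lift_eq]
    simp [d, S]
  simp [this]

theorem isAlgebraic_of_forall_derivation_eq_zero {F K : Type} [Field F] [Field K]
    [CharZero F] [Algebra F K] {α : K} (hα : ∀ D : Derivation F K K, D α = 0) :
    IsAlgebraic F α := by
  by_contra h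
  obtain ⟨D, hD⟩ := Derivation.exists_apply_ne_zero_of_transcendental h
  exact hD (hα D)

section

open Polynomial

/-- The derivation of `K[X]` acting on coefficients. -/
noncomputable def Derivation.coeffwise {F K : Type} [Field F] [Field K] [Algebra F K]
    (D : Derivation F K K) : Derivation F K[X] K[X] :=
  PolynomialModule.equivPolynomialSelf.compDer D.mapCoeffs

theorem Derivation.coeff_coeffwise {F K : Type} [Field F] [Field K] [Algebra F K]
    (D : Derivation F K K) (p : K[X]) (i : ℕ) : (D.coeffwise p).coeff i = D (p.coeff i) := rfl

theorem Derivation.degree_coeffwise_le {F K : Type} [Field F] [Field K] [Algebra F K]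
    (D : Derivation F K K) (p : K[X]) : (D.coeffwise p).degree ≤ p.degree := by
  refine (degree_le_iff_coeff_zero _ _).2 fun n hn => ?_
  rw [D.coeff_coeffwise, coeff_eq_zero_of_degree_lt hn, map_zero]

theorem Derivation.degree_coeffwise_lt {F K : Type} [Field F] [Field K] [Algebra F K]
    (D : Derivation F K K) {p : K[X]} (hp : p ≠ 0) (h : D p.leadingCoeff = 0) :
    (D.coeffwise p).degree < p.degree := by
  refine lt_of_le_of_ne (D.degree_coeffwise_le p) fun he => ?_
  have h1 : (D.coeffwise p).coeff p.natDegree = 0 := h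
  have h2 : (D.coeffwise p).natDegree = p.natDegree := natDegree_eq_natDegree he
  have h3 : (D.coeffwise p) = 0 := by
    rw [← leadingCoeff_eq_zero, leadingCoeff, h2, h1]
  rw [h3] at he
  exact hp (degree_eq_bot.1 (by simpa using he.symm))

/-- Rigidity of the polynomial Pell equation `P² - 4 mᴸ = Δ R²`. -/
theorem derivation_eq_zero_of_pell {F K : Type} [Field F] [Field K] [CharZero K] [Algebra F K]
    (D : Derivation F K[X] K[X]) (hdeg : ∀ p, (D p).degree ≤ p.degree) {Δ m : K[X]}
    (hΔ : D Δ = 0) (hsq : Squarefree Δ) (hm : Irreducible m) (hdm : (D m).degree < m.degree)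
    (L : ℕ) (P R : K[X]) (hR : R ≠ 0) (h : P ^ 2 - 4 * m ^ L = Δ * R ^ 2)
    (hP : 2 * P.natDegree ≤ m.natDegree * L)
    (hRd : 2 * R.natDegree + 2 * m.natDegree < m.natDegree * L) : D m = 0 ∧ D P = 0 := by
  induction L using Nat.strong_induction_on generalizing P R with
  | _ L ih =>
  have hm0 := hm.ne_zero
  have hmp := hm.prime
  have hL : 3 ≤ L := by
    by_contra hL
    have : m.natDegree * L ≤ m.natDegree * 2 := Nat.mul_le_mul_left _ (by omega)
    omega
  obtain ⟨k, rfl⟩ : ∃ k, L = k + 2 := ⟨L - 2, by omega⟩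
  by_cases hmP : m ∣ P
  · obtain ⟨P', rfl⟩ := hmP
    have h1 : m * m ∣ Δ * R ^ 2 := ⟨P' ^ 2 - 4 * m ^ k, by rw [← h]; ring⟩
    have hmR : m ∣ R := by
      by_contra hmR
      have hc : IsCoprime (m * m) (R ^ 2) := by
        have : IsCoprime m R := (hm.coprime_iff_not_dvd).2 hmR
        exact (this.mul_left this).pow_right
      exact hm.not_isUnit (hsq m (hc.dvd_of_dvd_mul_right h1))
    obtain ⟨R', rfl⟩ := hmR
    have hR' : R' ≠ 0 := right_ne_zero_of_mul hR
    have h2 : P' ^ 2 - 4 * m ^ k = Δ * R' ^ 2 := by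
      have : m ^ 2 * (P' ^ 2 - 4 * m ^ k) = m ^ 2 * (Δ * R' ^ 2) := by
        linear_combination h
      exact mul_left_cancel₀ (pow_ne_zero 2 hm0) this
    rw [natDegree_mul hm0 hR'] at hRd
    have h3 := ih k (by omega) P' R' hR' h2 ?_ ?_
    · refine ⟨h3.1, ?_⟩
      rw [D.leibniz, h3.1, h3.2]; simp
    · by_cases hP' : P' = 0
      · simp [hP']
      · rw [natDegree_mul hm0 hP'] at hP
        have := Nat.mul_add m.natDegree k 2; omega
    · have := Nat.mul_add m.natDegree k 2; omega
  · have e1 : 2 * P * D P - 4 * (k + 2 : ℕ) * m ^ (k + 1) * D m = Δ * (2 * R * D R) := by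
      have := congrArg D h
      rw [map_sub, show (4 : K[X]) * m ^ (k + 2) = (4 : ℕ) • m ^ (k + 2) by simp, map_nsmul,
        D.leibniz, hΔ, D.leibniz_pow, D.leibniz_pow, D.leibniz_pow] at this
      simp only [smul_eq_mul, nsmul_eq_mul] at this
      push_cast at this ⊢
      linear_combination this
    have e2 : 2 * P * (R * D P - P * D R) =
        m ^ (k + 1) * (4 * (k + 2 : ℕ) * R * D m - 8 * m * D R) := by
      linear_combination R * e1 - 2 * D R * h
    have hZ : R * D P - P * D R = 0 := by
      have hc : IsCoprime (m ^ (k + 1)) (2 * P) := by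
        refine IsCoprime.pow_left ((hm.coprime_iff_not_dvd).2 ?_)
        rw [show (2 : K[X]) = C 2 from rfl]
        rw [(show IsUnit (C (2 : K)) from isUnit_C.2 (by simp)).dvd_mul_left]
        exact hmP
      have hd : m ^ (k + 1) ∣ R * D P - P * D R := hc.dvd_of_dvd_mul_left ⟨_, e2⟩
      refine eq_zero_of_dvd_of_natDegree_lt hd ?_
      have b1 : (R * D P).natDegree ≤ R.natDegree + P.natDegree :=
        natDegree_mul_le.trans (by gcongr; exact natDegree_le_natDegree (hdeg P))
      have b2 : (P * D R).natDegree ≤ R.natDegree + P.natDegree :=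
        natDegree_mul_le.trans (by rw [add_comm]; gcongr; exact natDegree_le_natDegree (hdeg R))
      rw [natDegree_pow]
      have := (natDegree_sub_le_of_le b1 b2)
      simp only [max_self] at this
      have e5 := Nat.mul_add m.natDegree k 2
      have e6 := Nat.mul_add m.natDegree k 1
      rw [mul_comm (k + 1)]
      omega
    have e3 : m * (2 * D R) = (k + 2 : ℕ) * R * D m := by
      rw [hZ, mul_zero] at e2
      have e4 := (mul_eq_zero.1 e2.symm).resolve_left (pow_ne_zero _ hm0)
      have : (4 : K[X]) * (m * (2 * D R) - (k + 2 : ℕ) * R * D m) = 0 := by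
        linear_combination -e4
      exact sub_eq_zero.1 ((mul_eq_zero.1 this).resolve_left (by norm_num))
    have hDm : D m = 0 := by
      by_contra hne
      have h1 : m ∣ (k + 2 : ℕ) * R * D m := ⟨_, e3.symm⟩
      have h2 : ¬ m ∣ D m := fun hd => not_le_of_gt hdm (degree_le_of_dvd hd hne)
      have h3 := (hmp.dvd_or_dvd h1).resolve_right h2
      have hu : IsUnit ((k + 2 : ℕ) : K[X]) := by
        rw [← C_eq_natCast]
        exact isUnit_C.2 (isUnit_iff_ne_zero.2 (by exact_mod_cast (by omega : k + 2 ≠ 0)))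
      rw [hu.dvd_mul_left] at h3
      apply hmP
      refine hmp.dvd_of_dvd_pow (n := 2) ?_
      rw [sub_eq_iff_eq_add.1 h]
      refine dvd_add ((h3.trans (dvd_pow_self R two_ne_zero)).mul_left _) ?_
      exact (dvd_pow_self m (by omega)).mul_left _
    have hDR : D R = 0 := by
      rw [hDm, mul_zero] at e3
      simpa [hm0] using e3
    refine ⟨hDm, ?_⟩
    rw [hDR, mul_zero, sub_zero] at hZ
    exact (mul_eq_zero.1 hZ).resolve_left hR

end

namespace Kreweras

/-- Power series in `t`. -/
abbrev R : Type := PowerSeries ℂ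

/-- Power series in one variable over `R`. -/
abbrev S : Type := PowerSeries R

/-- The variable `t` in `S`. -/
def t : S := PowerSeries.C PowerSeries.X

/-- The main variable of `S`. -/
def ξ : S := PowerSeries.X

theorem t_ne_zero : t ≠ 0 := by
  rw [t, Ne, map_eq_zero_iff _ PowerSeries.C_injective]
  exact PowerSeries.X_ne_zero

theorem ξ_ne_zero : ξ ≠ 0 := PowerSeries.X_ne_zero

theorem constantCoeff_t : PowerSeries.constantCoeff t = PowerSeries.X := by simp [t]

theorem constantCoeff_ξ : PowerSeries.constantCoeff ξ = 0 := by simp [ξ]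

/-- Homomorphisms of power series rings are determined by coefficients and the variable. -/
theorem ringHom_ext {A B : Type} [CommRing A] [CommRing B] {f g : PowerSeries A →+* PowerSeries B}
    (hC : ∀ r, f (PowerSeries.C r) = g (PowerSeries.C r))
    (hX : f PowerSeries.X = g PowerSeries.X) (hd : PowerSeries.X ∣ f PowerSeries.X) : f = g := by
  have key : ∀ n, ∀ z, PowerSeries.X ^ n ∣ f z - g z := by
    intro n
    induction n with
    | zero => simp
    | succ n ih =>
      intro z
      rw [PowerSeries.eq_X_mul_shift_add_const z]
      rw [map_add, map_add, map_mul, map_mul, ← hX, hC, add_sub_add_right_eq_sub, ← mul_sub,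
        pow_succ']
      exact mul_dvd_mul hd (ih _)
  ext1 z
  rw [← sub_eq_zero]
  ext n
  exact (PowerSeries.X_pow_dvd_iff.1 (key (n + 1) z)) n (Nat.lt_succ_self n)

/-- A `ℂ`-algebra endomorphism of `S` fixing `t` fixes `R`. -/
theorem algHom_C {f : S →ₐ[ℂ] S} (ht : f t = t) (r : R) :
    f (PowerSeries.C r) = PowerSeries.C r := by
  have key : ∀ n, ∀ r, t ^ n ∣ f (PowerSeries.C r) - PowerSeries.C r := by
    intro n
    induction n with
    | zero => simp
    | succ n ih =>
      intro z
      rw [PowerSeries.eq_X_mul_shift_add_const z]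
      have h1 : f (PowerSeries.C (PowerSeries.C (PowerSeries.constantCoeff z))) =
        PowerSeries.C (PowerSeries.C (PowerSeries.constantCoeff z)) := by
        simpa [PowerSeries.algebraMap_apply] using f.commutes (PowerSeries.constantCoeff z)
      have h2 : f (PowerSeries.C PowerSeries.X) = PowerSeries.C PowerSeries.X := ht
      rw [map_add, map_add, map_mul, map_mul, h1, add_sub_add_right_eq_sub, h2, ← mul_sub,
        pow_succ']
      exact mul_dvd_mul dvd_rfl (ih _)
  rw [← sub_eq_zero]
  ext n k
  obtain ⟨w, hw⟩ := key (k + 1) r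
  rw [hw, t, ← map_pow, PowerSeries.coeff_C_mul, PowerSeries.coeff_X_pow_mul', if_neg (by omega)]
  simp

/-- The second coordinate of the kernel curve is `η = -ξ θ`. -/
theorem exists_theta : ∃ θ : S, PowerSeries.constantCoeff θ = 1 ∧
    θ * (1 - ξ) = 1 + t ^ 3 * ξ ^ 3 * θ ^ 2 := by
  set w₁ : S := PowerSeries.mk fun _ => 1
  have hw₁ : w₁ * (1 - ξ) = 1 := PowerSeries.mk_one_mul_one_sub_eq_one R
  set w : S := t ^ 3 * ξ ^ 3 * w₁ ^ 2
  have hw : PowerSeries.HasSubst w := PowerSeries.HasSubst.of_constantCoeff_zero' (by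
    simp [w, constantCoeff_ξ])
  set c₀ : S := PowerSeries.map (Nat.castRingHom R) PowerSeries.catalanSeries
  have hc₀ : c₀ = 1 + PowerSeries.X * c₀ ^ 2 := by
    have := congrArg (PowerSeries.map (Nat.castRingHom R))
      PowerSeries.catalanSeries_sq_mul_X_add_one
    simp only [map_add, map_mul, map_pow, map_one, PowerSeries.map_X] at this
    linear_combination -this
  set c : S := PowerSeries.substAlgHom (R := R) hw c₀
  have hc : c = 1 + w * c ^ 2 := by
    have := congrArg (PowerSeries.substAlgHom (R := R) hw) hc₀
    simpa only [map_add, map_mul, map_pow, map_one, PowerSeries.substAlgHom_X] using this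
  refine ⟨c * w₁, ?_, ?_⟩
  · have h1 := congrArg PowerSeries.constantCoeff hc
    have h2 := congrArg PowerSeries.constantCoeff hw₁
    simp only [map_add, map_mul, map_pow, map_one, w, constantCoeff_ξ, map_sub] at h1 h2 ⊢
    rw [h1]
    linear_combination h2
  · linear_combination c * hw₁ + hc

/-- A series with `θ (1 - ξ) = 1 + t³ ξ³ θ²`. -/
def θ : S := exists_theta.choose

theorem constantCoeff_θ : PowerSeries.constantCoeff θ = 1 := exists_theta.choose_spec.1

theorem θ_eq : θ * (1 - ξ) = 1 + t ^ 3 * ξ ^ 3 * θ ^ 2 := exists_theta.choose_spec.2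

/-- The second coordinate of the kernel curve. -/
def η : S := -(ξ * θ)

theorem η_eq : ξ + η + t ^ 3 * ξ ^ 2 * η ^ 2 = ξ * η := by
  rw [η]; linear_combination -ξ * θ_eq

theorem θ_ne_zero : θ ≠ 0 := by
  intro h
  have := constantCoeff_θ
  simp [h] at this

theorem η_ne_zero : η ≠ 0 := neg_ne_zero.2 (mul_ne_zero ξ_ne_zero θ_ne_zero)

theorem constantCoeff_η : PowerSeries.constantCoeff η = 0 := by simp [η, constantCoeff_ξ]

theorem hasSubst_t_mul_η : PowerSeries.HasSubst (t * η) :=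
  PowerSeries.HasSubst.of_constantCoeff_zero' (by simp [constantCoeff_η])

/-- Substitution of `tξ` for the variable. -/
def phiX : S →+* S := PowerSeries.rescale PowerSeries.X

/-- Substitution of `tη` for the variable. -/
def phiY : S →+* S :=
  RingHomClass.toRingHom (PowerSeries.substAlgHom (R := R) hasSubst_t_mul_η)

theorem phiX_C (r : R) : phiX (PowerSeries.C r) = PowerSeries.C r := by
  ext n : 1
  rw [phiX, PowerSeries.coeff_rescale, PowerSeries.coeff_C]
  split_ifs with h <;> simp [h]

theorem phiX_t : phiX t = t := phiX_C _

theorem phiX_X : phiX PowerSeries.X = t * ξ := by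
  ext n : 1
  rw [phiX, PowerSeries.coeff_rescale, t, PowerSeries.coeff_C_mul, ξ, PowerSeries.coeff_X]
  split_ifs with h <;> simp [h]

theorem coeff_phiX (f : S) (n : ℕ) :
    PowerSeries.coeff n (phiX f) = PowerSeries.X ^ n * PowerSeries.coeff n f := by
  rw [phiX, PowerSeries.coeff_rescale]

theorem phiX_injective : Function.Injective phiX := by
  intro f g h
  ext n : 1
  have := congrArg (PowerSeries.coeff n) h
  rw [coeff_phiX, coeff_phiX] at this
  exact mul_left_cancel₀ (pow_ne_zero _ PowerSeries.X_ne_zero) this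

theorem phiY_C (r : R) : phiY (PowerSeries.C r) = PowerSeries.C r :=
  (PowerSeries.coe_substAlgHom (R := R) hasSubst_t_mul_η ▸ PowerSeries.subst_C r :)

theorem phiY_t : phiY t = t := phiY_C _

theorem phiY_X : phiY PowerSeries.X = t * η :=
  (PowerSeries.substAlgHom_X (R := R) hasSubst_t_mul_η :)

theorem constantCoeff_phiX (f : S) :
    PowerSeries.constantCoeff (phiX f) = PowerSeries.constantCoeff f := by
  simpa using coeff_phiX f 0

theorem constantCoeff_phiY (f : S) :
    PowerSeries.constantCoeff (phiY f) = PowerSeries.constantCoeff f := by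
  conv_lhs => rw [PowerSeries.eq_X_mul_shift_add_const f]
  rw [map_add, map_mul, phiY_C, phiY_X]
  simp [constantCoeff_η]

/-- The polynomial identity argument behind `eq_zero_of_phiX_eq_phiY`. -/
theorem polynomial_eq_zero_of_invariant (h : Polynomial ℂ) (h0 : h.coeff 0 = 0) (e : PowerSeries ℂ)
    (he : e * (1 - PowerSeries.X) = -PowerSeries.X)
    (hh : Polynomial.eval₂ PowerSeries.C PowerSeries.X h = Polynomial.eval₂ PowerSeries.C e h) :
    h = 0 := by
  by_contra hne
  set d := h.natDegree
  have hd : d ≠ 0 := by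
    intro hd
    rw [Polynomial.eq_C_of_natDegree_eq_zero hd, h0] at hne
    simp at hne
  have hpoly : h * (1 - Polynomial.X) ^ d =
      ∑ n ∈ Finset.range (d + 1), Polynomial.C (h.coeff n) * (-Polynomial.X) ^ n *
        (1 - Polynomial.X) ^ (d - n) := by
    apply Polynomial.coe_injective
    have h1 : (h : PowerSeries ℂ) = Polynomial.eval₂ PowerSeries.C PowerSeries.X h :=
      Polynomial.eval₂_C_X_eq_coe.symm
    have h2 : ∀ p : Polynomial ℂ, (p : PowerSeries ℂ) = Polynomial.coeToPowerSeries.ringHom p :=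
      fun p => rfl
    rw [Polynomial.coe_mul, h1, hh, Polynomial.eval₂_eq_sum_range, Finset.sum_mul]
    rw [h2 (Finset.sum _ _), map_sum]
    refine Finset.sum_congr rfl fun n hn => ?_
    have hn' : n ≤ d := Nat.lt_succ_iff.1 (Finset.mem_range.1 hn)
    obtain ⟨k, hk⟩ := Nat.exists_eq_add_of_le hn'
    simp only [map_mul, map_pow, map_sub, map_neg, map_one,
      Polynomial.coeToPowerSeries.ringHom_apply, Polynomial.coe_pow, Polynomial.coe_sub,
      Polynomial.coe_one, Polynomial.coe_X, Polynomial.coe_C]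
    rw [← he, mul_pow, hk, Nat.add_sub_cancel_left, pow_add]
    ring
  have h1 := congrArg (Polynomial.eval 1) hpoly
  rw [Polynomial.eval_finsetSum, Finset.sum_range_succ, Finset.sum_eq_zero] at h1
  · simp only [Polynomial.eval_mul, Polynomial.eval_pow, Polynomial.eval_sub, Polynomial.eval_one,
      Polynomial.eval_X, sub_self, zero_pow hd, mul_zero, Nat.sub_self, pow_zero, mul_one,
      Polynomial.eval_C, Polynomial.eval_neg, zero_add] at h1
    have : h.coeff d ≠ 0 := by simpa [d] using hne
    rcases mul_eq_zero.1 h1.symm with h3 | h3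
    · exact this h3
    · exact pow_ne_zero _ (by norm_num) h3
  · intro n hn
    have : d - n ≠ 0 := by have := Finset.mem_range.1 hn; omega
    simp [zero_pow this]

theorem phi_expand (φ : S →+* S) (hφ : ∀ r, φ (PowerSeries.C r) = PowerSeries.C r) (e : S)
    (hX : φ PowerSeries.X = t * e) (f : S) (D : ℕ) :
    ∃ g : S, φ f = (∑ n ∈ Finset.range D, PowerSeries.C (PowerSeries.X ^ n * PowerSeries.coeff n f)
      * e ^ n) + t ^ D * g := by
  have h := PowerSeries.eq_X_pow_mul_shift_add_trunc D f
  refine ⟨e ^ D * φ (PowerSeries.mk fun i => PowerSeries.coeff (i + D) f), ?_⟩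
  conv_lhs => rw [h]
  rw [map_add, map_mul, map_pow, hX, add_comm, PowerSeries.trunc_apply]
  have h2 : ∀ p : Polynomial R, (p : S) = Polynomial.coeToPowerSeries.ringHom p := fun p => rfl
  rw [h2, map_sum, map_sum, Nat.Ico_zero_eq_range]
  congr 1
  · refine Finset.sum_congr rfl fun n _ => ?_
    rw [Polynomial.coeToPowerSeries.ringHom_apply, ← Polynomial.C_mul_X_pow_eq_monomial,
      Polynomial.coe_mul, Polynomial.coe_C, Polynomial.coe_pow, Polynomial.coe_X, map_mul, map_pow,
      hX, hφ, mul_pow, map_mul, map_pow, t]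
    ring
  · ring

theorem eq_zero_of_phiX_eq_phiY (f : S) (h0 : PowerSeries.constantCoeff f = 0)
    (h : phiX f = phiY f) : f = 0 := by
  have key : ∀ e n : ℕ, PowerSeries.X ^ e ∣ PowerSeries.X ^ n * PowerSeries.coeff n f := by
    intro e
    induction e with
    | zero => simp
    | succ e ih =>
      choose c hc using ih
      obtain ⟨g₁, hg₁⟩ := phi_expand phiX phiX_C ξ phiX_X f (e + 1)
      obtain ⟨g₂, hg₂⟩ := phi_expand phiY phiY_C η phiY_X f (e + 1)
      have h3 : ∀ y : S, (∑ n ∈ Finset.range (e + 1),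
          PowerSeries.C (PowerSeries.X ^ n * PowerSeries.coeff n f) * y ^ n) =
          t ^ e * ∑ n ∈ Finset.range (e + 1), PowerSeries.C (c n) * y ^ n := by
        intro y
        rw [Finset.mul_sum]
        refine Finset.sum_congr rfl fun n _ => ?_
        rw [hc, map_mul, map_pow, t]; ring
      rw [h3] at hg₁ hg₂
      have h4 : (∑ n ∈ Finset.range (e + 1), PowerSeries.C (c n) * ξ ^ n) + t * g₁ =
          (∑ n ∈ Finset.range (e + 1), PowerSeries.C (c n) * η ^ n) + t * g₂ := by
        refine mul_left_cancel₀ (pow_ne_zero e t_ne_zero) ?_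
        linear_combination h + hg₂ - hg₁
      set μ : S →+* PowerSeries ℂ := PowerSeries.map PowerSeries.constantCoeff
      have hμt : μ t = 0 := by simp [μ, t]
      set hp : Polynomial ℂ := ∑ n ∈ Finset.range (e + 1),
        Polynomial.C (PowerSeries.constantCoeff (c n)) * Polynomial.X ^ n
      have hcoeff : ∀ n < e + 1, hp.coeff n = PowerSeries.constantCoeff (c n) := by
        intro n hn
        simp only [hp, Polynomial.finsetSum_coeff, Polynomial.coeff_C_mul, Polynomial.coeff_X_pow]
        simp [Finset.sum_ite_eq, hn]
      have hev : ∀ y : S, μ (∑ n ∈ Finset.range (e + 1), PowerSeries.C (c n) * y ^ n) =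
          Polynomial.eval₂ PowerSeries.C (μ y) hp := by
        intro y
        simp only [hp, Polynomial.eval₂_finsetSum, map_sum, map_mul, map_pow, Polynomial.eval₂_mul,
          Polynomial.eval₂_pow, Polynomial.eval₂_C, Polynomial.eval₂_X]
        simp [μ]
      have h5 := congrArg μ h4
      simp only [map_add, map_mul, hμt, zero_mul, add_zero] at h5
      rw [hev, hev] at h5
      have hμξ : μ ξ = PowerSeries.X := by simp [μ, ξ]
      have h6 : hp = 0 := by
        refine polynomial_eq_zero_of_invariant hp ?_ (μ η) ?_ (by rw [← h5, hμξ])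
        · rw [hcoeff 0 (by omega)]
          have := hc 0
          rw [PowerSeries.coeff_zero_eq_constantCoeff, h0, mul_zero] at this
          rw [(mul_eq_zero.1 this.symm).resolve_left (pow_ne_zero _ PowerSeries.X_ne_zero),
            map_zero]
        · have := congrArg μ η_eq
          simp only [map_add, map_mul, map_pow, hμt, hμξ] at this
          linear_combination this
      intro n
      rcases Nat.lt_or_ge n (e + 1) with hn | hn
      · have h7 := hcoeff n hn
        rw [h6, Polynomial.coeff_zero] at h7
        rw [hc n, pow_succ]
        exact mul_dvd_mul dvd_rfl (PowerSeries.X_dvd_iff.2 h7.symm)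
      · exact (pow_dvd_pow _ hn).mul_right _
  ext n k
  have := PowerSeries.X_pow_dvd_iff.1 (key (n + k + 1) n) (k + n) (by omega)
  rw [PowerSeries.coeff_X_pow_mul] at this
  simpa using this

/-- An invariant of weight `b` vanishes if its coefficients `uⁿ`, `n ≤ b`, `n ≡ b mod 2` vanish. -/
theorem eq_zero_of_invariant (f : S) (b : ℕ) (h : phiX f * η ^ b = phiY f * ξ ^ b)
    (h0 : ∀ i, 2 * i ≤ b → PowerSeries.coeff (b - 2 * i) f = 0) : f = 0 := by
  by_contra hne
  obtain ⟨g, hg⟩ : ∃ g, f = PowerSeries.X ^ f.order.toNat * g :=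
    PowerSeries.X_pow_order_dvd
  set n := f.order.toNat
  have hcf : PowerSeries.coeff n f ≠ 0 := PowerSeries.coeff_order hne
  have hcg : PowerSeries.constantCoeff g ≠ 0 := by
    intro h1
    apply hcf
    have := PowerSeries.coeff_X_pow_mul g n 0
    rw [Nat.zero_add, ← hg] at this
    rw [this]
    simpa using h1
  have hx : phiX f = t ^ n * ξ ^ n * phiX g := by
    conv_lhs => rw [hg]
    rw [map_mul, map_pow, phiX_X]; ring
  have hy : phiY f = t ^ n * η ^ n * phiY g := by
    conv_lhs => rw [hg]
    rw [map_mul, map_pow, phiY_X]; ring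
  have h1 : phiX g * (-θ) ^ b = phiY g * (-θ) ^ n := by
    have hne : t ^ n * ξ ^ n * ξ ^ b ≠ 0 :=
      mul_ne_zero (mul_ne_zero (pow_ne_zero _ t_ne_zero) (pow_ne_zero _ ξ_ne_zero))
        (pow_ne_zero _ ξ_ne_zero)
    refine mul_left_cancel₀ hne ?_
    have e : η = ξ * -θ := by rw [η]; ring
    rw [hx, hy, e, mul_pow, mul_pow] at h
    linear_combination h
  have h2 := congrArg PowerSeries.constantCoeff h1
  simp only [map_mul, map_pow, map_neg, constantCoeff_θ, constantCoeff_phiX,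
    constantCoeff_phiY] at h2
  have h3 : ((-1 : R)) ^ b = (-1) ^ n := mul_left_cancel₀ hcg h2
  have hpar : Even b ↔ Even n := by
    have hne1 : (-1 : R) ≠ 1 := by
      intro hh
      have := congrArg PowerSeries.constantCoeff hh
      norm_num at this
    constructor
    · intro hb
      rw [hb.neg_one_pow] at h3
      by_contra hn
      rw [(Nat.not_even_iff_odd.1 hn).neg_one_pow] at h3
      exact hne1 h3.symm
    · intro hn
      rw [hn.neg_one_pow] at h3
      by_contra hb
      rw [(Nat.not_even_iff_odd.1 hb).neg_one_pow] at h3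
      exact hne1 h3
  have hbn : b < n := by
    by_contra hle
    apply hcf
    have : ∃ i, n = b - 2 * i ∧ 2 * i ≤ b := by
      refine ⟨(b - n) / 2, ?_⟩
      rw [Nat.even_iff, Nat.even_iff] at hpar
      omega
    obtain ⟨i, hi, hib⟩ := this
    rw [hi]; exact h0 i hib
  obtain ⟨k, hk⟩ := Nat.exists_eq_add_of_lt hbn
  set f' : S := PowerSeries.X ^ (k + 1) * g
  have hf' : f' = 0 := by
    refine eq_zero_of_phiX_eq_phiY f' (by simp [f']) ?_
    have hne : t ^ b * ξ ^ b * η ^ b ≠ 0 :=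
      mul_ne_zero (mul_ne_zero (pow_ne_zero _ t_ne_zero) (pow_ne_zero _ ξ_ne_zero))
        (pow_ne_zero _ η_ne_zero)
    refine mul_left_cancel₀ hne ?_
    simp only [f', map_mul, map_pow, phiX_X, phiY_X]
    rw [hx, hy, hk] at h
    linear_combination h
  have : g = 0 := (mul_eq_zero.1 hf').resolve_left (pow_ne_zero _ PowerSeries.X_ne_zero)
  exact hcg (by simp [this])

open Polynomial (natDegree)

/-- Laurent series in `t`, as the fraction field of `R`. -/
abbrev K : Type := FractionRing R

/-- The fraction field of `S`. -/
abbrev L : Type := FractionRing S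

/-- The inclusion of `S` in its fraction field. -/
abbrev ι : S →+* L := algebraMap S L

theorem ι_injective : Function.Injective ι := IsFractionRing.injective S L

/-- The inclusion of `K` in `L`. -/
def ψ : K →+* L := IsFractionRing.map (A := R) (B := S) (PowerSeries.C_injective (R := R))

theorem ψ_algebraMap (r : R) : ψ (algebraMap R K r) = ι (PowerSeries.C r) := by
  simp only [ψ, IsFractionRing.map, IsLocalization.map_eq]

/-- The invariant multiplied by `ξ²`. -/
def Jn : S := ξ - 1 + t ^ 3 * ξ ^ 3

theorem constantCoeff_Jn : PowerSeries.constantCoeff Jn = -1 := by simp [Jn, constantCoeff_ξ]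

/-- The invariant `t²(x + 1 / (t x) - 1 / x²)` with `x = tξ`. -/
def J : L := ι Jn / ι ξ ^ 2

theorem ι_ξ_ne_zero : ι ξ ≠ 0 := by
  rw [Ne, map_eq_zero_iff _ ι_injective]; exact ξ_ne_zero

theorem ι_η_ne_zero : ι η ≠ 0 := by
  rw [Ne, map_eq_zero_iff _ ι_injective]; exact η_ne_zero

theorem ι_t_ne_zero : ι t ≠ 0 := by
  rw [Ne, map_eq_zero_iff _ ι_injective]; exact t_ne_zero

theorem J_mul : ι ξ ^ 2 * J = ι Jn := by
  have := ι_ξ_ne_zero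
  rw [J]; field_simp

/-- Evaluation of polynomials over `K` at `J`. -/
def evJ : Polynomial K →+* L := Polynomial.eval₂RingHom ψ J

theorem evJ_C (c : K) : evJ (Polynomial.C c) = ψ c := Polynomial.eval₂_C ψ J

theorem evJ_X : evJ Polynomial.X = J := Polynomial.eval₂_X ψ J

theorem exists_clear_evJ (P : Polynomial R) (n : ℕ) (hn : P.natDegree ≤ n) :
    ∃ z : S, PowerSeries.constantCoeff z = (-1) ^ n * P.coeff n ∧
      ι z = ι ξ ^ (2 * n) * evJ (P.map (algebraMap R K)) := by
  refine ⟨∑ i ∈ Finset.range (n + 1), PowerSeries.C (P.coeff i) * ξ ^ (2 * (n - i)) * Jn ^ i,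
    ?_, ?_⟩
  · rw [map_sum, Finset.sum_range_succ, Finset.sum_eq_zero]
    · simp only [map_mul, map_pow, constantCoeff_Jn, Nat.sub_self]
      simp [mul_comm]
    · intro i hi
      have : 2 * (n - i) ≠ 0 := by have := Finset.mem_range.1 hi; omega
      simp [constantCoeff_ξ, zero_pow this]
  · rw [evJ, Polynomial.coe_eval₂RingHom, Polynomial.eval₂_map, Polynomial.eval₂_eq_sum_range' _
      (Nat.lt_succ_of_le hn), Finset.mul_sum, map_sum]
    refine Finset.sum_congr rfl fun i hi => ?_
    have hi' : i ≤ n := Nat.lt_succ_iff.1 (Finset.mem_range.1 hi)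
    obtain ⟨k, rfl⟩ := Nat.exists_eq_add_of_le hi'
    rw [RingHom.comp_apply, ψ_algebraMap, Nat.add_sub_cancel_left, map_mul, map_mul, map_pow,
      map_pow, ← J_mul]
    ring

theorem exists_integer_polynomial (P : Polynomial K) :
    ∃ a : R, a ≠ 0 ∧ ∃ P' : Polynomial R,
      Polynomial.C (algebraMap R K a) * P = P'.map (algebraMap R K) := by
  obtain ⟨b, hb, h⟩ := IsLocalization.integerNormalization_spec (nonZeroDivisors R) P
  refine ⟨b, nonZeroDivisors.ne_zero hb,
    IsLocalization.integerNormalization (nonZeroDivisors R) P, ?_⟩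
  rw [h, ← algebraMap_smul K b P, Polynomial.smul_eq_C_mul]

theorem two_mul_natDegree_le {P : Polynomial K} (hP : P ≠ 0) {b : ℕ} {z : S}
    (h : ι z = ι ξ ^ b * evJ P) : 2 * P.natDegree ≤ b := by
  by_contra! hlt
  obtain ⟨a, ha, P', hP'⟩ := exists_integer_polynomial P
  have haK : algebraMap R K a ≠ 0 := by
    rwa [Ne, map_eq_zero_iff _ (IsFractionRing.injective R K)]
  have hdeg : P'.natDegree = P.natDegree := by
    rw [← Polynomial.natDegree_map_eq_of_injective (IsFractionRing.injective R K), ← hP',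
      Polynomial.natDegree_C_mul haK]
  obtain ⟨w, hw, hw'⟩ := exists_clear_evJ P' P.natDegree hdeg.le
  rw [← hP', map_mul, evJ_C, ψ_algebraMap] at hw'
  obtain ⟨k, hk⟩ := Nat.exists_eq_add_of_lt hlt
  have h1 : w = ξ ^ (k + 1) * (PowerSeries.C a * z) := by
    apply ι_injective
    rw [hw', hk, map_mul, map_mul, h, map_pow]
    ring
  rw [h1] at hw
  simp only [map_mul, map_pow, constantCoeff_ξ] at hw
  rw [zero_pow (by omega), zero_mul, ← hdeg, Polynomial.coeff_natDegree] at hw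
  have h2 := (mul_eq_zero.1 hw.symm).resolve_left (pow_ne_zero _ (by norm_num))
  have h3 : P' = 0 := Polynomial.leadingCoeff_eq_zero.1 h2
  rw [h3, Polynomial.map_zero] at hP'
  rcases mul_eq_zero.1 hP' with h4 | h4
  · exact haK (Polynomial.C_eq_zero.1 h4)
  · exact hP h4

theorem evJ_injective : Function.Injective evJ := by
  rw [injective_iff_map_eq_zero]
  intro P hP
  by_contra hne
  obtain ⟨a, ha, P', hP'⟩ := exists_integer_polynomial P
  have haK : algebraMap R K a ≠ 0 := by
    rwa [Ne, map_eq_zero_iff _ (IsFractionRing.injective R K)]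
  obtain ⟨w, hw, hw'⟩ := exists_clear_evJ P' P'.natDegree le_rfl
  rw [← hP', map_mul, hP, mul_zero, mul_zero, map_eq_zero_iff _ ι_injective] at hw'
  rw [hw', map_zero] at hw
  have h2 := (mul_eq_zero.1 hw.symm).resolve_left (pow_ne_zero _ (by norm_num))
  have h3 : P' = 0 := Polynomial.leadingCoeff_eq_zero.1 h2
  rw [h3, Polynomial.map_zero] at hP'
  rcases mul_eq_zero.1 hP' with h4 | h4
  · exact haK (Polynomial.C_eq_zero.1 h4)
  · exact hne h4

/-- The basic invariants of weight `b`. -/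
def basicInvariant (b i : ℕ) : S :=
  PowerSeries.X ^ (b - 2 * i) * (t ^ 2 * PowerSeries.X ^ 3 + t * PowerSeries.X - t ^ 2) ^ i

theorem Jn_symm : Jn * η ^ 2 = (η - 1 + t ^ 3 * η ^ 3) * ξ ^ 2 := by
  rw [Jn]; linear_combination (ξ - η) * η_eq

theorem phiX_basicInvariant (b i : ℕ) :
    phiX (basicInvariant b i) = (t * ξ) ^ (b - 2 * i) * (t ^ 2 * Jn) ^ i := by
  simp only [basicInvariant, map_mul, map_pow, map_sub, map_add, phiX_X, phiX_t, Jn]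
  congr 2; ring

theorem basicInvariant_invariant {b i : ℕ} (hi : 2 * i ≤ b) :
    phiX (basicInvariant b i) * η ^ b = phiY (basicInvariant b i) * ξ ^ b := by
  have hy : phiY (basicInvariant b i) =
      (t * η) ^ (b - 2 * i) * (t ^ 2 * (η - 1 + t ^ 3 * η ^ 3)) ^ i := by
    simp only [basicInvariant, map_mul, map_pow, map_sub, map_add, phiY_X, phiY_t]
    congr 2; ring
  rw [phiX_basicInvariant, hy]
  obtain ⟨k, rfl⟩ := Nat.exists_eq_add_of_le hi
  rw [Nat.add_sub_cancel_left]
  have h := congrArg (· ^ i) Jn_symm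
  simp only [mul_pow] at h ⊢
  rw [pow_add, pow_mul, pow_add, pow_mul]
  linear_combination (t ^ k * ξ ^ k * (t ^ 2) ^ i * η ^ k) * h

theorem ι_phiX_basicInvariant {b i : ℕ} (hi : 2 * i ≤ b) :
    ι (phiX (basicInvariant b i)) = (ι t * ι ξ) ^ b * J ^ i := by
  obtain ⟨k, rfl⟩ := Nat.exists_eq_add_of_le hi
  rw [phiX_basicInvariant, Nat.add_sub_cancel_left]
  simp only [map_mul, map_pow]
  rw [← J_mul, pow_add, pow_mul]
  simp only [mul_pow]
  ring

/-- An invariant of weight `b` is `x ^ b` times a polynomial in `J` of degree at most `b / 2`. -/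
theorem exists_polynomial_of_invariant (f : S) (b : ℕ) (h : phiX f * η ^ b = phiY f * ξ ^ b) :
    ∃ P : Polynomial K, P.natDegree ≤ b / 2 ∧ ι (phiX f) = (ι t * ι ξ) ^ b * evJ P := by
  set q := b / 2
  set V : Option (Fin (q + 1)) → S := fun i => i.elim f fun i => basicInvariant b i
  have hV : ∀ i, phiX (V i) * η ^ b = phiY (V i) * ξ ^ b := by
    rintro (_ | i)
    · exact h
    · exact basicInvariant_invariant (by have := i.2; omega)
  set T : (Option (Fin (q + 1)) → R) →ₗ[R] (Fin (q + 1) → R) :=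
    { toFun := fun c j => PowerSeries.coeff (b - 2 * j) (∑ i, PowerSeries.C (c i) * V i)
      map_add' := by
        intro c d; ext1 j
        simp only [Pi.add_apply, map_add, add_mul, Finset.sum_add_distrib]
      map_smul' := by
        intro r c; ext1 j
        simp only [Pi.smul_apply, smul_eq_mul, RingHom.id_apply, map_mul, mul_assoc,
          ← Finset.mul_sum, PowerSeries.coeff_C_mul] } with hT
  have hnT : ¬ Function.Injective T := fun hi => by
    have := card_le_of_injective R T hi
    simp at this
  obtain ⟨c, hc, hc0⟩ : ∃ c, T c = 0 ∧ c ≠ 0 := by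
    by_contra! hh
    exact hnT ((injective_iff_map_eq_zero T).2 hh)
  have hsum : ∑ i, PowerSeries.C (c i) * V i = 0 := by
    refine eq_zero_of_invariant _ b ?_ fun i hi => ?_
    · simp only [map_sum, map_mul, phiX_C, phiY_C, Finset.sum_mul, mul_assoc, hV]
    · exact congrFun hc ⟨i, by omega⟩
  have hsum2 : ι (PowerSeries.C (c none)) * ι (phiX f) +
      (ι t * ι ξ) ^ b * ∑ i : Fin (q + 1), ι (PowerSeries.C (c (some i))) * J ^ (i : ℕ) = 0 := by
    have := congrArg ι (congrArg phiX hsum)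
    rw [Fintype.sum_option, map_add, map_add, map_sum, map_sum, map_zero, map_zero] at this
    simp only [map_mul, phiX_C] at this
    rw [← this, Finset.mul_sum]
    congr 1
    refine Finset.sum_congr rfl fun i _ => ?_
    simp only [V, Option.elim_some]
    rw [ι_phiX_basicInvariant (by have := i.2; omega)]
    ring
  set P : Polynomial K :=
    ∑ i : Fin (q + 1), Polynomial.C (algebraMap R K (c (some i))) * Polynomial.X ^ (i : ℕ)
  have hP : evJ P = ∑ i : Fin (q + 1), ι (PowerSeries.C (c (some i))) * J ^ (i : ℕ) := by
    simp only [P, map_sum, map_mul, map_pow, evJ_C, evJ_X, ψ_algebraMap]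
  rw [← hP] at hsum2
  have hxi : (ι t * ι ξ) ^ b ≠ 0 := pow_ne_zero _ (mul_ne_zero ι_t_ne_zero ι_ξ_ne_zero)
  have hcn : c none ≠ 0 := by
    intro hcn
    rw [hcn, map_zero, map_zero, zero_mul, zero_add] at hsum2
    have hP0 : P = 0 := by
      apply evJ_injective
      rw [map_zero]
      exact (mul_eq_zero.1 hsum2).resolve_left hxi
    apply hc0
    ext1 i
    rcases i with _ | i
    · exact hcn
    · have := congrArg (fun p => Polynomial.coeff p i) hP0
      simp only [P, Polynomial.finsetSum_coeff, Polynomial.coeff_C_mul, Polynomial.coeff_X_pow,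
        Fin.val_inj, mul_ite, mul_one, mul_zero, Finset.sum_ite_eq, Finset.mem_univ, if_true,
        Polynomial.coeff_zero] at this
      exact (map_eq_zero_iff _ (IsFractionRing.injective R K)).1 this
  have hck : algebraMap R K (c none) ≠ 0 := by
    rwa [Ne, map_eq_zero_iff _ (IsFractionRing.injective R K)]
  refine ⟨Polynomial.C (-(algebraMap R K (c none))⁻¹) * P, ?_, ?_⟩
  · refine (Polynomial.natDegree_C_mul_le _ _).trans ?_
    refine Polynomial.natDegree_sum_le_of_forall_le _ _ fun i _ => ?_
    refine (Polynomial.natDegree_C_mul_X_pow_le _ _).trans ?_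
    have := i.2; omega
  · rw [map_mul, evJ_C, map_neg, map_inv₀, ψ_algebraMap]
    have : ι (PowerSeries.C (c none)) ≠ 0 := by
      rw [← ψ_algebraMap]; simpa using hck
    field_simp
    linear_combination hsum2

/-- Power series in `t`, `x`, `y`. -/
abbrev M3 : Type := MvPowerSeries (Fin 3) ℂ

/-- `S` as a ring of power series in two variables. -/
def twoVar : MvPowerSeries (Option Unit) ℂ ≃ₐ[ℂ] S := MvPowerSeries.optionEquivLeft Unit ℂ

theorem twoVar_X_none : twoVar (MvPowerSeries.X none) = ξ :=
  MvPowerSeries.optionEquivLeft_X_none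

theorem twoVar_X_some : twoVar (MvPowerSeries.X (some ())) = t :=
  MvPowerSeries.optionEquivLeft_X_some ()

theorem coeff_twoVar_symm (f : S) (d : Option Unit →₀ ℕ) :
    MvPowerSeries.coeff d (twoVar.symm f) =
      PowerSeries.coeff (d (some ())) (PowerSeries.coeff (d none) f) := by
  have h := MvPowerSeries.coeff_coeff_optionEquivLeft (twoVar.symm f) (d none) d.some
  rw [Finsupp.optionElim_some] at h
  rw [← h, show MvPowerSeries.optionEquivLeft Unit ℂ (twoVar.symm f) = f from
    twoVar.apply_symm_apply f]
  rw [PowerSeries.coeff]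
  congr 2
  ext; simp

theorem constantCoeff_twoVar_symm (f : S) : MvPowerSeries.constantCoeff (twoVar.symm f) =
    PowerSeries.constantCoeff (PowerSeries.constantCoeff f) := by
  rw [← MvPowerSeries.coeff_zero_eq_constantCoeff_apply, coeff_twoVar_symm]
  simp

/-- The map of variables sending `t` to `t` and the other variable to the variable `j`. -/
def varEmb (j : Fin 3) (hj : 0 ≠ j) : Option Unit ↪ Fin 3 where
  toFun u := u.elim j fun _ => 0
  inj' := by
    rintro (_ | _) (_ | _) h
    · rfl
    · exact absurd h.symm hj
    · exact absurd h hj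
    · rfl

/-- The inclusion of `S` in `M3`, mapping the main variable to the variable `j`. -/
def inc (j : Fin 3) (hj : 0 ≠ j) : S →ₐ[ℂ] M3 :=
  (MvPowerSeries.rename (varEmb j hj)).comp (twoVar.symm : S →ₐ[ℂ] MvPowerSeries (Option Unit) ℂ)

theorem inc_apply (j : Fin 3) (hj : 0 ≠ j) (f : S) :
    inc j hj f = MvPowerSeries.rename (varEmb j hj) (twoVar.symm f) := rfl

theorem inc_t (j : Fin 3) (hj : 0 ≠ j) : inc j hj t = MvPowerSeries.X 0 := by
  rw [inc_apply, ← twoVar_X_some, AlgEquiv.symm_apply_apply, MvPowerSeries.rename_X]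
  rfl

theorem inc_X (j : Fin 3) (hj : 0 ≠ j) : inc j hj PowerSeries.X = MvPowerSeries.X j := by
  rw [inc_apply, show (PowerSeries.X : S) = ξ from rfl, ← twoVar_X_none,
    AlgEquiv.symm_apply_apply, MvPowerSeries.rename_X]
  rfl

theorem coeff_inc (j k : Fin 3) (hj : 0 ≠ j) (h0k : 0 ≠ k) (hjk : j ≠ k) (f : S)
    (d : Fin 3 →₀ ℕ) : MvPowerSeries.coeff d (inc j hj f) =
      if d k = 0 then PowerSeries.coeff (d 0) (PowerSeries.coeff (d j) f) else 0 := by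
  have hall : ∀ i : Fin 3, i = 0 ∨ i = j ∨ i = k := by
    revert j k; decide
  rw [inc_apply]
  split_ifs with h
  · have hd : d = Finsupp.embDomain (varEmb j hj) (Finsupp.optionElim (d j)
        (Finsupp.single () (d 0))) := by
      ext i
      rcases hall i with rfl | rfl | rfl
      · rw [show (0 : Fin 3) = varEmb j hj (some ()) from rfl, Finsupp.embDomain_apply_self]
        simp [varEmb]
      · refine Eq.symm ((Finsupp.embDomain_apply_self (varEmb i hj) _ none).trans ?_)
        simp
      · rw [h, Finsupp.embDomain_of_notMem_range]
        rintro ⟨_ | _, h⟩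
        · exact hjk h
        · exact h0k h
    conv_lhs => rw [hd]
    rw [MvPowerSeries.coeff_embDomain_rename, coeff_twoVar_symm]
    simp
  · refine MvPowerSeries.coeff_rename_eq_zero _ _ ?_
    rintro ⟨x, rfl⟩
    apply h
    rw [← Finsupp.embDomain_eq_mapDomain, Finsupp.embDomain_of_notMem_range]
    rintro ⟨_ | _, h⟩
    · exact hjk h
    · exact h0k h

/-- Substitution of `p`, `q` for `x`, `y`. -/
def subst3 (p q : S) (hp : PowerSeries.constantCoeff (PowerSeries.constantCoeff p) = 0)
    (hq : PowerSeries.constantCoeff (PowerSeries.constantCoeff q) = 0) : M3 →ₐ[ℂ] S :=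
  (twoVar : MvPowerSeries (Option Unit) ℂ →ₐ[ℂ] S).comp
    (MvPowerSeries.substAlgHom (R := ℂ) (a := fun i => twoVar.symm (![t, p, q] i))
      (MvPowerSeries.hasSubst_of_constantCoeff_zero fun i => by
        rw [constantCoeff_twoVar_symm]
        fin_cases i
        · simp [constantCoeff_t]
        · exact hp
        · exact hq))

theorem subst3_X (p q : S) (hp : PowerSeries.constantCoeff (PowerSeries.constantCoeff p) = 0)
    (hq : PowerSeries.constantCoeff (PowerSeries.constantCoeff q) = 0) (i : Fin 3) :
    subst3 p q hp hq (MvPowerSeries.X i) = ![t, p, q] i := by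
  rw [subst3, AlgHom.comp_apply, MvPowerSeries.substAlgHom_X]
  exact twoVar.apply_symm_apply _

theorem subst3_inc {p q : S} {hp : PowerSeries.constantCoeff (PowerSeries.constantCoeff p) = 0}
    {hq : PowerSeries.constantCoeff (PowerSeries.constantCoeff q) = 0} {j : Fin 3} {hj : 0 ≠ j}
    {phi : S →+* S} (hC : ∀ r, phi (PowerSeries.C r) = PowerSeries.C r)
    (hX : phi PowerSeries.X = ![t, p, q] j) (hd : PowerSeries.X ∣ phi PowerSeries.X) (f : S) :
    subst3 p q hp hq (inc j hj f) = phi f := by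
  have ht : ((subst3 p q hp hq).comp (inc j hj)) t = t := by
    rw [AlgHom.comp_apply, inc_t, subst3_X]; rfl
  have : phi = RingHomClass.toRingHom ((subst3 p q hp hq).comp (inc j hj)) := by
    refine ringHom_ext (fun r => ?_) ?_ hd
    · rw [hC]
      exact (algHom_C ht r).symm
    · rw [hX]
      change _ = subst3 p q hp hq (inc j hj PowerSeries.X)
      rw [inc_X, subst3_X]
  rw [this]; rfl

theorem X_dvd_t_mul_η : PowerSeries.X ∣ t * η :=
  ⟨-(t * θ), by rw [η, ξ]; ring⟩

/-- The specialisation `(x, y) = (tξ, tη)`. -/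
def specXY : M3 →ₐ[ℂ] S := subst3 (t * ξ) (t * η) (by simp [constantCoeff_ξ])
  (by simp [constantCoeff_η])

/-- The specialisation `(x, y) = (tη, tξ)`. -/
def specYX : M3 →ₐ[ℂ] S := subst3 (t * η) (t * ξ) (by simp [constantCoeff_η])
  (by simp [constantCoeff_ξ])

theorem specXY_X0 : specXY (MvPowerSeries.X 0) = t := subst3_X _ _ _ _ 0
theorem specXY_X1 : specXY (MvPowerSeries.X 1) = t * ξ := subst3_X _ _ _ _ 1
theorem specXY_X2 : specXY (MvPowerSeries.X 2) = t * η := subst3_X _ _ _ _ 2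
theorem specYX_X0 : specYX (MvPowerSeries.X 0) = t := subst3_X _ _ _ _ 0
theorem specYX_X1 : specYX (MvPowerSeries.X 1) = t * η := subst3_X _ _ _ _ 1
theorem specYX_X2 : specYX (MvPowerSeries.X 2) = t * ξ := subst3_X _ _ _ _ 2

theorem zero_ne_one_fin : (0 : Fin 3) ≠ 1 := by decide
theorem zero_ne_two_fin : (0 : Fin 3) ≠ 2 := by decide

/-- Inclusion of `S` with main variable `x`. -/
abbrev incX : S →ₐ[ℂ] M3 := inc 1 zero_ne_one_fin
/-- Inclusion of `S` with main variable `y`. -/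
abbrev incY : S →ₐ[ℂ] M3 := inc 2 zero_ne_two_fin

theorem specXY_incX (f : S) : specXY (incX f) = phiX f :=
  subst3_inc phiX_C (by exact phiX_X) (by rw [phiX_X]; exact dvd_mul_left _ _) f
theorem specXY_incY (f : S) : specXY (incY f) = phiY f :=
  subst3_inc phiY_C (by exact phiY_X) (by rw [phiY_X]; exact X_dvd_t_mul_η) f
theorem specYX_incX (f : S) : specYX (incX f) = phiY f :=
  subst3_inc phiY_C (by exact phiY_X) (by rw [phiY_X]; exact X_dvd_t_mul_η) f
theorem specYX_incY (f : S) : specYX (incY f) = phiX f :=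
  subst3_inc phiX_C (by exact phiX_X) (by rw [phiX_X]; exact dvd_mul_left _ _) f

section Paths

theorem pathCount_zero (step : WSt → WSt → Prop) (v : WSt) :
    pathCount step 0 v = if v = (0, 0, 0) then 1 else 0 := by
  rw [pathCount]
  split_ifs with h
  · subst h
    rw [Nat.card_eq_one_iff_unique]
    refine ⟨⟨fun p q => ?_⟩, ⟨fun _ => (0, 0, 0), rfl, rfl, fun i => i.elim0⟩⟩
    obtain ⟨p, hp, -⟩ := p
    obtain ⟨q, hq, -⟩ := q
    ext1
    funext i
    rw [Fin.fin_one_eq_zero i]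
    exact hp.trans hq.symm
  · rw [Nat.card_eq_zero]
    left
    refine ⟨fun p => h ?_⟩
    exact p.2.2.1.symm.trans p.2.1

/-- Splitting off the last step of a path. -/
def pathSuccEquiv {step : WSt → WSt → Prop} {pred : WSt → Finset WSt}
    (hpred : ∀ u v, step u v ↔ u ∈ pred v) (n : ℕ) (v : WSt) :
    {p : Fin (n + 1 + 1) → WSt // p 0 = ((0 : ℤ), 0, 0) ∧ p (Fin.last (n + 1)) = v ∧
      ∀ i : Fin (n + 1), step (p i.castSucc) (p i.succ)} ≃
    Σ u : pred v, {p : Fin (n + 1) → WSt // p 0 = ((0 : ℤ), 0, 0) ∧ p (Fin.last n) = u ∧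
      ∀ i : Fin n, step (p i.castSucc) (p i.succ)} where
  toFun p := ⟨⟨p.1 (Fin.last n).castSucc, by
      have h := p.2.2.2 (Fin.last n)
      rw [Fin.succ_last] at h
      exact (hpred _ _).1 (cast (congrArg _ p.2.2.1) h)⟩,
    ⟨fun i => p.1 i.castSucc, p.2.1, rfl, fun i => p.2.2.2 i.castSucc⟩⟩
  invFun q := ⟨Fin.snoc (α := fun _ => WSt) q.2.1 v, by
      exact (Fin.snoc_castSucc (α := fun _ => WSt) (i := 0) ..).trans q.2.2.1, Fin.snoc_last _ _, by
      intro i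
      refine Fin.lastCases ?_ (fun i => ?_) i
      · rw [Fin.snoc_castSucc, Fin.succ_last, Fin.snoc_last, q.2.2.2.1, hpred]
        exact q.1.2
      · rw [Fin.snoc_castSucc, Fin.succ_castSucc, Fin.snoc_castSucc]
        exact q.2.2.2.2 i⟩
  left_inv p := by
    ext1
    funext i
    refine Fin.lastCases ?_ (fun i => ?_) i
    · simp only [Fin.snoc_last]; exact p.2.2.1.symm
    · simp only [Fin.snoc_castSucc]
  right_inv q := by
    have key : ∀ x y : Σ u : pred v, {p : Fin (n + 1) → WSt //
        p 0 = ((0 : ℤ), 0, 0) ∧ p (Fin.last n) = u ∧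
        ∀ i : Fin n, step (p i.castSucc) (p i.succ)}, x.2.1 = y.2.1 → x = y := by
      rintro ⟨⟨u, hu⟩, p, hp0, hp1, hp⟩ ⟨⟨u', hu'⟩, p', hp0', hp1', hp'⟩ (rfl : p = p')
      obtain rfl : u = u' := hp1.symm.trans hp1'
      rfl
    refine key _ _ ?_
    funext i
    simp only [Fin.snoc_castSucc]

theorem finite_paths {step : WSt → WSt → Prop} {pred : WSt → Finset WSt}
    (hpred : ∀ u v, step u v ↔ u ∈ pred v) (n : ℕ) (v : WSt) :
    Finite {p : Fin (n + 1) → WSt // p 0 = ((0 : ℤ), 0, 0) ∧ p (Fin.last n) = v ∧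
      ∀ i : Fin n, step (p i.castSucc) (p i.succ)} := by
  induction n generalizing v with
  | zero =>
    have : Subsingleton {p : Fin (0 + 1) → WSt // p 0 = ((0 : ℤ), 0, 0) ∧ p (Fin.last 0) = v ∧
        ∀ i : Fin 0, step (p i.castSucc) (p i.succ)} := by
      refine ⟨fun p q => ?_⟩
      obtain ⟨p, hp, -⟩ := p
      obtain ⟨q, hq, -⟩ := q
      ext1
      funext i
      rw [Fin.fin_one_eq_zero i]
      exact hp.trans hq.symm
    infer_instance
  | succ n ih =>
    have := fun u => ih u
    exact Finite.of_equiv _ (pathSuccEquiv hpred n v).symm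

theorem pathCount_succ {step : WSt → WSt → Prop} {pred : WSt → Finset WSt}
    (hpred : ∀ u v, step u v ↔ u ∈ pred v) (n : ℕ) (v : WSt) :
    pathCount step (n + 1) v = ∑ u ∈ pred v, pathCount step n u := by
  have := fun u => finite_paths hpred n u
  rw [pathCount, Nat.card_congr (pathSuccEquiv hpred n v), Nat.card_sigma,
    ← Finset.sum_coe_sort (pred v)]
  rfl

theorem mem_ite_singleton {α : Type} {p : Prop} [Decidable p] {x y : α} :
    (x ∈ if p then ({y} : Finset α) else ∅) ↔ p ∧ x = y := by
  split_ifs with h <;> simp [h]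

theorem sum_ite_singleton {α : Type} {p : Prop} [Decidable p] {y : α} (f : α → ℕ) :
    ∑ x ∈ (if p then ({y} : Finset α) else ∅), f x = if p then f y else 0 := by
  split_ifs <;> simp

/-- Predecessors of a state under `cellStep`. -/
def cellPred (v : WSt) : Finset WSt :=
  (({(v.1, v.2.1, v.2.2 + 1)} ∪ {(v.1, v.2.1 + 1, v.2.2)}) ∪
    (if 1 ≤ v.2.1 ∧ 1 ≤ v.2.2 then {(v.1, v.2.1 - 1, v.2.2 - 1)} else ∅) ∪
    (if v.2.2 = 0 then {(v.1 - 1, 0, v.2.1)} else ∅)) ∪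
    (if v.2.1 = 0 ∧ 1 ≤ v.2.2 then {(v.1 + 1, v.2.2 - 1, 0)} else ∅)

/-- Predecessors of a state under `vertStep`. -/
def vertPred (v : WSt) : Finset WSt :=
  (({(v.1, v.2.1, v.2.2 + 1)} ∪ {(v.1, v.2.1 + 1, v.2.2)}) ∪
    (if 1 ≤ v.2.1 ∧ 1 ≤ v.2.2 then {(v.1, v.2.1 - 1, v.2.2 - 1)} else ∅) ∪
    (if v.2.2 = 0 then {(v.1 - 1, 0, v.2.1 + 1)} else ∅)) ∪
    (if v.2.1 = 0 ∧ 2 ≤ v.2.2 then {(v.1 + 1, v.2.2 - 2, 0)} else ∅)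

theorem or_rearrange {A B C D E : Prop} :
    (A ∨ B ∨ C ∨ D ∨ E) ↔ (((B ∨ C) ∨ A) ∨ D) ∨ E := by tauto

theorem cellStep_iff (u v : WSt) : cellStep u v ↔ u ∈ cellPred v := by
  obtain ⟨k, a, b⟩ := u
  obtain ⟨k', a', b'⟩ := v
  simp only [cellStep, cellPred, Finset.mem_union, Finset.mem_singleton, mem_ite_singleton,
    Prod.mk.injEq]
  have h1 : (k' = k ∧ a' = a + 1 ∧ b' = b + 1) ↔
      (1 ≤ a' ∧ 1 ≤ b') ∧ k = k' ∧ a = a' - 1 ∧ b = b' - 1 := by omega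
  have h2 : (1 ≤ b ∧ k' = k ∧ a' = a ∧ b' = b - 1) ↔ (k = k' ∧ a = a' ∧ b = b' + 1) := by omega
  have h3 : (1 ≤ a ∧ k' = k ∧ a' = a - 1 ∧ b' = b) ↔ (k = k' ∧ a = a' + 1 ∧ b = b') := by omega
  have h4 : (a = 0 ∧ k' = k + 1 ∧ a' = b ∧ b' = 0) ↔
      b' = 0 ∧ k = k' - 1 ∧ a = 0 ∧ b = a' := by omega
  have h5 : (b = 0 ∧ k' = k - 1 ∧ a' = 0 ∧ b' = a + 1) ↔
      (a' = 0 ∧ 1 ≤ b') ∧ k = k' + 1 ∧ a = b' - 1 ∧ b = 0 := by omega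
  rw [h1, h2, h3, h4, h5]
  exact or_rearrange

theorem vertStep_iff (u v : WSt) : vertStep u v ↔ u ∈ vertPred v := by
  obtain ⟨k, a, b⟩ := u
  obtain ⟨k', a', b'⟩ := v
  simp only [vertStep, vertPred, Finset.mem_union, Finset.mem_singleton, mem_ite_singleton,
    Prod.mk.injEq]
  have h1 : (k' = k ∧ a' = a + 1 ∧ b' = b + 1) ↔
      (1 ≤ a' ∧ 1 ≤ b') ∧ k = k' ∧ a = a' - 1 ∧ b = b' - 1 := by omega
  have h2 : (1 ≤ b ∧ k' = k ∧ a' = a ∧ b' = b - 1) ↔ (k = k' ∧ a = a' ∧ b = b' + 1) := by omega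
  have h3 : (1 ≤ a ∧ k' = k ∧ a' = a - 1 ∧ b' = b) ↔ (k = k' ∧ a = a' + 1 ∧ b = b') := by omega
  have h4 : (a = 0 ∧ 1 ≤ b ∧ k' = k + 1 ∧ a' = b - 1 ∧ b' = 0) ↔
      b' = 0 ∧ k = k' - 1 ∧ a = 0 ∧ b = a' + 1 := by omega
  have h5 : (b = 0 ∧ k' = k - 1 ∧ a' = 0 ∧ b' = a + 2) ↔
      (a' = 0 ∧ 2 ≤ b') ∧ k = k' + 1 ∧ a = b' - 2 ∧ b = 0 := by omega
  rw [h1, h2, h3, h4, h5]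
  exact or_rearrange

theorem pathCount_cell_succ (n : ℕ) (k : ℤ) (a b : ℕ) :
    pathCount cellStep (n + 1) (k, a, b) =
      pathCount cellStep n (k, a, b + 1) + pathCount cellStep n (k, a + 1, b) +
      (if 1 ≤ a ∧ 1 ≤ b then pathCount cellStep n (k, a - 1, b - 1) else 0) +
      (if b = 0 then pathCount cellStep n (k - 1, 0, a) else 0) +
      (if a = 0 ∧ 1 ≤ b then pathCount cellStep n (k + 1, b - 1, 0) else 0) := by
  rw [pathCount_succ cellStep_iff, cellPred, Finset.sum_union, Finset.sum_union, Finset.sum_union,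
    Finset.sum_union]
  · simp only [Finset.sum_singleton, sum_ite_singleton]
  all_goals
    rw [Finset.disjoint_left]
    rintro ⟨k', a', b'⟩
    simp only [Finset.mem_union, Finset.mem_singleton, mem_ite_singleton, Prod.mk.injEq]
    omega

theorem pathCount_vert_succ (n : ℕ) (k : ℤ) (a b : ℕ) :
    pathCount vertStep (n + 1) (k, a, b) =
      pathCount vertStep n (k, a, b + 1) + pathCount vertStep n (k, a + 1, b) +
      (if 1 ≤ a ∧ 1 ≤ b then pathCount vertStep n (k, a - 1, b - 1) else 0) +
      (if b = 0 then pathCount vertStep n (k - 1, 0, a + 1) else 0) +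
      (if a = 0 ∧ 2 ≤ b then pathCount vertStep n (k + 1, b - 2, 0) else 0) := by
  rw [pathCount_succ vertStep_iff, vertPred, Finset.sum_union, Finset.sum_union, Finset.sum_union,
    Finset.sum_union]
  · simp only [Finset.sum_singleton, sum_ite_singleton]
  all_goals
    rw [Finset.disjoint_left]
    rintro ⟨k', a', b'⟩
    simp only [Finset.mem_union, Finset.mem_singleton, mem_ite_singleton, Prod.mk.injEq]
    omega

theorem pathCount_eq_zero_of_lt {step : WSt → WSt → Prop} {pred : WSt → Finset WSt}
    (hpred : ∀ u v, step u v ↔ u ∈ pred v) (hk : ∀ u v, u ∈ pred v → |v.1| ≤ |u.1| + 1)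
    (n : ℕ) (v : WSt) (h : (n : ℤ) < |v.1|) : pathCount step n v = 0 := by
  induction n generalizing v with
  | zero =>
    rw [pathCount_zero, if_neg]
    rintro rfl
    simp at h
  | succ n ih =>
    rw [pathCount_succ hpred]
    refine Finset.sum_eq_zero fun u hu => ih u ?_
    have := hk u v hu
    push_cast at h
    omega

theorem cellPred_abs (u v : WSt) (h : u ∈ cellPred v) : |v.1| ≤ |u.1| + 1 := by
  obtain ⟨k, a, b⟩ := u
  obtain ⟨k', a', b'⟩ := v
  simp only [cellPred, Finset.mem_union, Finset.mem_singleton, mem_ite_singleton,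
    Prod.mk.injEq] at h
  dsimp only
  have h1 := abs_cases k
  have h2 := abs_cases k'
  omega

theorem vertPred_abs (u v : WSt) (h : u ∈ vertPred v) : |v.1| ≤ |u.1| + 1 := by
  obtain ⟨k, a, b⟩ := u
  obtain ⟨k', a', b'⟩ := v
  simp only [vertPred, Finset.mem_union, Finset.mem_singleton, mem_ite_singleton,
    Prod.mk.injEq] at h
  dsimp only
  have h1 := abs_cases k
  have h2 := abs_cases k'
  omega

/-- Weighted path counts. -/
def wt (step : WSt → WSt → Prop) (s : ℂ) (n a b : ℕ) : ℂ :=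
  ∑' k : ℤ, (pathCount step n (k, a, b) : ℂ) * s ^ k

theorem wt_zero (step : WSt → WSt → Prop) (s : ℂ) (a b : ℕ) :
    wt step s 0 a b = if a = 0 ∧ b = 0 then 1 else 0 := by
  rw [wt, tsum_eq_single 0]
  · rw [pathCount_zero]
    simp
  · intro k hk
    rw [pathCount_zero, if_neg]
    · simp
    · intro h; exact hk (congrArg Prod.fst h)

theorem hasSum_wt {step : WSt → WSt → Prop} (s : ℂ) {n : ℕ}
    (h : ∀ v : WSt, (n : ℤ) < |v.1| → pathCount step n v = 0) (a b : ℕ) :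
    HasSum (fun k : ℤ => (pathCount step n (k, a, b) : ℂ) * s ^ k) (wt step s n a b) := by
  refine (summable_of_hasFiniteSupport ((Set.finite_Icc (-(n : ℤ)) n).subset fun k hk => ?_)).hasSum
  rw [Set.mem_Icc, ← abs_le]
  by_contra! hlt
  exact hk (by simp [h (k, a, b) hlt])

theorem hasSum_wt_shift {step : WSt → WSt → Prop} {s : ℂ} (hs : s ≠ 0) {n : ℕ}
    (h : ∀ v : WSt, (n : ℤ) < |v.1| → pathCount step n v = 0) (a b : ℕ) (m : ℤ) :
    HasSum (fun k : ℤ => (pathCount step n (k + m, a, b) : ℂ) * s ^ k)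
      (s ^ (-m) * wt step s n a b) := by
  have h1 := ((Equiv.addRight m).hasSum_iff.2 (hasSum_wt s h a b)).mul_left (s ^ (-m))
  refine h1.congr_fun ?_
  intro k
  simp only [Function.comp, Equiv.coe_addRight]
  rw [zpow_add₀ hs, zpow_neg]
  field_simp

theorem HasSum.ite_zero {f : ℤ → ℂ} {z : ℂ} (hf : HasSum f z) (p : Prop) [Decidable p] :
    HasSum (fun k => if p then f k else 0) (if p then z else 0) := by
  split_ifs
  · exact hf
  · exact hasSum_zero

theorem wt_cell_succ {s : ℂ} (hs : s ≠ 0) (n a b : ℕ) :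
    wt cellStep s (n + 1) a b = wt cellStep s n a (b + 1) + wt cellStep s n (a + 1) b +
      (if 1 ≤ a ∧ 1 ≤ b then wt cellStep s n (a - 1) (b - 1) else 0) +
      (if b = 0 then s * wt cellStep s n 0 a else 0) +
      (if a = 0 ∧ 1 ≤ b then s⁻¹ * wt cellStep s n (b - 1) 0 else 0) := by
  have h := pathCount_eq_zero_of_lt cellStep_iff cellPred_abs
  have h1 := ((((hasSum_wt s (h n) a (b + 1)).add (hasSum_wt s (h n) (a + 1) b)).add
    (HasSum.ite_zero (hasSum_wt s (h n) (a - 1) (b - 1)) (1 ≤ a ∧ 1 ≤ b))).add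
    (HasSum.ite_zero (hasSum_wt_shift hs (h n) 0 a (-1)) (b = 0))).add
    (HasSum.ite_zero (hasSum_wt_shift hs (h n) (b - 1) 0 1) (a = 0 ∧ 1 ≤ b))
  have h2 := hasSum_wt s (h (n + 1)) a b
  rw [neg_neg, zpow_one, zpow_neg_one] at h1
  refine h2.unique ?_
  convert h1 using 2 with k
  rw [pathCount_cell_succ]
  push_cast
  simp only [add_mul, ite_mul, zero_mul, sub_eq_add_neg]

theorem wt_vert_succ {s : ℂ} (hs : s ≠ 0) (n a b : ℕ) :
    wt vertStep s (n + 1) a b = wt vertStep s n a (b + 1) + wt vertStep s n (a + 1) b +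
      (if 1 ≤ a ∧ 1 ≤ b then wt vertStep s n (a - 1) (b - 1) else 0) +
      (if b = 0 then s * wt vertStep s n 0 (a + 1) else 0) +
      (if a = 0 ∧ 2 ≤ b then s⁻¹ * wt vertStep s n (b - 2) 0 else 0) := by
  have h := pathCount_eq_zero_of_lt vertStep_iff vertPred_abs
  have h1 := ((((hasSum_wt s (h n) a (b + 1)).add (hasSum_wt s (h n) (a + 1) b)).add
    (HasSum.ite_zero (hasSum_wt s (h n) (a - 1) (b - 1)) (1 ≤ a ∧ 1 ≤ b))).add
    (HasSum.ite_zero (hasSum_wt_shift hs (h n) 0 (a + 1) (-1)) (b = 0))).add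
    (HasSum.ite_zero (hasSum_wt_shift hs (h n) (b - 2) 0 1) (a = 0 ∧ 2 ≤ b))
  have h2 := hasSum_wt s (h (n + 1)) a b
  rw [neg_neg, zpow_one, zpow_neg_one] at h1
  refine h2.unique ?_
  convert h1 using 2 with k
  rw [pathCount_vert_succ]
  push_cast
  simp only [add_mul, ite_mul, zero_mul, sub_eq_add_neg]

end Paths

section FunctionalEquations

/-- The exponent vector `(n, a, b)`. -/
def expo (n a b : ℕ) : Fin 3 →₀ ℕ := Finsupp.equivFunOnFinite.symm ![n, a, b]

theorem expo_0 (n a b : ℕ) : expo n a b 0 = n := rfl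
theorem expo_1 (n a b : ℕ) : expo n a b 1 = a := rfl
theorem expo_2 (n a b : ℕ) : expo n a b 2 = b := rfl

theorem M3_ext {F G : M3}
    (h : ∀ n a b, MvPowerSeries.coeff (expo n a b) F = MvPowerSeries.coeff (expo n a b) G) :
    F = G := by
  ext d
  have : d = expo (d 0) (d 1) (d 2) := by
    ext i; fin_cases i <;> rfl
  rw [this]; exact h _ _ _

theorem coeff_X_mul' (d : Fin 3 →₀ ℕ) (i : Fin 3) (F : M3) :
    MvPowerSeries.coeff d (MvPowerSeries.X i * F) =
      if d i = 0 then 0 else MvPowerSeries.coeff (d - Finsupp.single i 1) F := by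
  rw [MvPowerSeries.X, MvPowerSeries.coeff_monomial_mul, one_mul]
  simp only [Finsupp.single_le_iff]
  split_ifs <;> first | rfl | omega

theorem expo_sub_0 (n a b : ℕ) : expo (n + 1) a b - Finsupp.single 0 1 = expo n a b := by
  ext i; fin_cases i <;> simp [expo]
theorem expo_sub_1 (n a b : ℕ) : expo n (a + 1) b - Finsupp.single 1 1 = expo n a b := by
  ext i; fin_cases i <;> simp [expo]
theorem expo_sub_2 (n a b : ℕ) : expo n a (b + 1) - Finsupp.single 2 1 = expo n a b := by
  ext i; fin_cases i <;> simp [expo]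

theorem coeff_X0_mul_zero (a b : ℕ) (F : M3) :
    MvPowerSeries.coeff (expo 0 a b) (MvPowerSeries.X 0 * F) = 0 := by
  rw [coeff_X_mul', if_pos (expo_0 _ _ _)]
theorem coeff_X1_mul_zero (n b : ℕ) (F : M3) :
    MvPowerSeries.coeff (expo n 0 b) (MvPowerSeries.X 1 * F) = 0 := by
  rw [coeff_X_mul', if_pos (expo_1 _ _ _)]
theorem coeff_X2_mul_zero (n a : ℕ) (F : M3) :
    MvPowerSeries.coeff (expo n a 0) (MvPowerSeries.X 2 * F) = 0 := by
  rw [coeff_X_mul', if_pos (expo_2 _ _ _)]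
theorem coeff_X0_mul_succ (n a b : ℕ) (F : M3) :
    MvPowerSeries.coeff (expo (n + 1) a b) (MvPowerSeries.X 0 * F) =
      MvPowerSeries.coeff (expo n a b) F := by
  rw [coeff_X_mul', if_neg (by rw [expo_0]; omega), expo_sub_0]
theorem coeff_X1_mul_succ (n a b : ℕ) (F : M3) :
    MvPowerSeries.coeff (expo n (a + 1) b) (MvPowerSeries.X 1 * F) =
      MvPowerSeries.coeff (expo n a b) F := by
  rw [coeff_X_mul', if_neg (by rw [expo_1]; omega), expo_sub_1]
theorem coeff_X2_mul_succ (n a b : ℕ) (F : M3) :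
    MvPowerSeries.coeff (expo n a (b + 1)) (MvPowerSeries.X 2 * F) =
      MvPowerSeries.coeff (expo n a b) F := by
  rw [coeff_X_mul', if_neg (by rw [expo_2]; omega), expo_sub_2]

theorem coeff_incX (n a b : ℕ) (f : S) : MvPowerSeries.coeff (expo n a b) (incX f) =
    if b = 0 then PowerSeries.coeff n (PowerSeries.coeff a f) else 0 :=
  coeff_inc 1 2 zero_ne_one_fin zero_ne_two_fin (by decide) f _

theorem coeff_incY (n a b : ℕ) (f : S) : MvPowerSeries.coeff (expo n a b) (incY f) =
    if a = 0 then PowerSeries.coeff n (PowerSeries.coeff b f) else 0 :=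
  coeff_inc 2 1 zero_ne_two_fin zero_ne_one_fin (by decide) f _

/-- The power series in `t`, `x`, `y` with coefficients `g n a b`. -/
def gen3 (g : ℕ → ℕ → ℕ → ℂ) : M3 := fun d => g (d 0) (d 1) (d 2)

theorem coeff_gen3 (g : ℕ → ℕ → ℕ → ℂ) (n a b : ℕ) :
    MvPowerSeries.coeff (expo n a b) (gen3 g) = g n a b := rfl

/-- The power series in `t` and one further variable with coefficients `g n a`. -/
def gen2 (g : ℕ → ℕ → ℂ) : S := PowerSeries.mk fun a => PowerSeries.mk fun n => g n a

theorem coeff_gen2 (g : ℕ → ℕ → ℂ) (n a : ℕ) :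
    PowerSeries.coeff n (PowerSeries.coeff a (gen2 g)) = g n a := by
  rw [gen2, PowerSeries.coeff_mk, PowerSeries.coeff_mk]

theorem coeff_C_mul' (c : ℂ) (d : Fin 3 →₀ ℕ) (F : M3) :
    MvPowerSeries.coeff d (MvPowerSeries.C c * F) = c * MvPowerSeries.coeff d F :=
  MvPowerSeries.coeff_C_mul ..

theorem coeff_one_expo (n a b : ℕ) : MvPowerSeries.coeff (expo n a b) (1 : M3) =
    if n = 0 ∧ a = 0 ∧ b = 0 then 1 else 0 := by
  classical
  rw [MvPowerSeries.coeff_one]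
  refine if_congr ?_ rfl rfl
  constructor
  · intro h
    exact ⟨DFunLike.congr_fun h 0, DFunLike.congr_fun h 1, DFunLike.congr_fun h 2⟩
  · rintro ⟨rfl, rfl, rfl⟩
    ext i; fin_cases i <;> rfl

variable {g : ℕ → ℕ → ℕ → ℂ} {s : ℂ}

theorem X2_mul_shift : MvPowerSeries.X 2 * gen3 (fun n a b => g n a (b + 1)) =
    gen3 g - incX (gen2 fun n a => g n a 0) := by
  refine M3_ext fun n a b => ?_
  rw [map_sub, coeff_incX, coeff_gen3, coeff_gen2]
  cases b
  · rw [coeff_X2_mul_zero]; simp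
  · rw [coeff_X2_mul_succ, coeff_gen3]; simp

theorem X1_mul_shift : MvPowerSeries.X 1 * gen3 (fun n a b => g n (a + 1) b) =
    gen3 g - incY (gen2 fun n b => g n 0 b) := by
  refine M3_ext fun n a b => ?_
  rw [map_sub, coeff_incY, coeff_gen3, coeff_gen2]
  cases a
  · rw [coeff_X1_mul_zero]; simp
  · rw [coeff_X1_mul_succ, coeff_gen3]; simp

theorem cell_functional_aux (h0 : ∀ a b, g 0 a b = if a = 0 ∧ b = 0 then 1 else 0)
    (h : ∀ n a b, g (n + 1) a b = g n a (b + 1) + g n (a + 1) b +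
      (if 1 ≤ a ∧ 1 ≤ b then g n (a - 1) (b - 1) else 0) + (if b = 0 then s * g n 0 a else 0) +
      (if a = 0 ∧ 1 ≤ b then s⁻¹ * g n (b - 1) 0 else 0)) :
    gen3 g = 1 + MvPowerSeries.X 0 * (gen3 (fun n a b => g n a (b + 1)) +
      gen3 (fun n a b => g n (a + 1) b) + MvPowerSeries.X 1 * (MvPowerSeries.X 2 * gen3 g) +
      MvPowerSeries.C s * incX (gen2 fun n b => g n 0 b) +
      MvPowerSeries.C s⁻¹ * (MvPowerSeries.X 2 * incY (gen2 fun n a => g n a 0))) := by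
  refine M3_ext fun n a b => ?_
  rw [map_add, coeff_one_expo]
  cases n with
  | zero => rw [coeff_X0_mul_zero, coeff_gen3, h0]; simp
  | succ n =>
    rw [coeff_X0_mul_succ]
    simp only [map_add, coeff_C_mul', coeff_gen3, h, coeff_incX, coeff_gen2]
    rcases a with _ | a <;> rcases b with _ | b <;>
    simp [coeff_X1_mul_zero, coeff_X1_mul_succ, coeff_X2_mul_zero, coeff_X2_mul_succ, coeff_gen3,
      coeff_incY, coeff_gen2]

theorem cell_functional (h0 : ∀ a b, g 0 a b = if a = 0 ∧ b = 0 then 1 else 0)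
    (h : ∀ n a b, g (n + 1) a b = g n a (b + 1) + g n (a + 1) b +
      (if 1 ≤ a ∧ 1 ≤ b then g n (a - 1) (b - 1) else 0) + (if b = 0 then s * g n 0 a else 0) +
      (if a = 0 ∧ 1 ≤ b then s⁻¹ * g n (b - 1) 0 else 0)) (T X Y : M3)
    (hT : T = MvPowerSeries.X 0) (hX : X = MvPowerSeries.X 1) (hY : Y = MvPowerSeries.X 2) :
    (X * Y - T * (X ^ 2 * Y ^ 2 + X + Y)) * gen3 g =
      X * Y - T * X * incX (gen2 fun n a => g n a 0) - T * Y * incY (gen2 fun n b => g n 0 b) +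
      MvPowerSeries.C s * T * X * Y * incX (gen2 fun n b => g n 0 b) +
      MvPowerSeries.C s⁻¹ * T * X * Y ^ 2 * incY (gen2 fun n a => g n a 0) := by
  subst hT hX hY
  have h1 := cell_functional_aux h0 h
  linear_combination MvPowerSeries.X 1 * MvPowerSeries.X 2 * h1 +
    MvPowerSeries.X 0 * MvPowerSeries.X 1 * X2_mul_shift (g := g) +
    MvPowerSeries.X 0 * MvPowerSeries.X 2 * X1_mul_shift (g := g)

theorem vert_functional_aux (h0 : ∀ a b, g 0 a b = if a = 0 ∧ b = 0 then 1 else 0)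
    (h : ∀ n a b, g (n + 1) a b = g n a (b + 1) + g n (a + 1) b +
      (if 1 ≤ a ∧ 1 ≤ b then g n (a - 1) (b - 1) else 0) +
      (if b = 0 then s * g n 0 (a + 1) else 0) +
      (if a = 0 ∧ 2 ≤ b then s⁻¹ * g n (b - 2) 0 else 0)) :
    gen3 g = 1 + MvPowerSeries.X 0 * (gen3 (fun n a b => g n a (b + 1)) +
      gen3 (fun n a b => g n (a + 1) b) + MvPowerSeries.X 1 * (MvPowerSeries.X 2 * gen3 g) +
      MvPowerSeries.C s * incX (gen2 fun n b => g n 0 (b + 1)) +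
      MvPowerSeries.C s⁻¹ * (MvPowerSeries.X 2 *
        (MvPowerSeries.X 2 * incY (gen2 fun n a => g n a 0)))) := by
  refine M3_ext fun n a b => ?_
  rw [map_add, coeff_one_expo]
  cases n with
  | zero => rw [coeff_X0_mul_zero, coeff_gen3, h0]; simp
  | succ n =>
    rw [coeff_X0_mul_succ]
    simp only [map_add, coeff_C_mul', coeff_gen3, h, coeff_incX, coeff_gen2]
    rcases a with _ | a <;> rcases b with _ | _ | b <;>
    simp [coeff_X1_mul_zero, coeff_X1_mul_succ, coeff_X2_mul_zero, coeff_X2_mul_succ, coeff_gen3,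
      coeff_incY, coeff_gen2]

theorem gen2_shift (g : ℕ → ℕ → ℂ) : gen2 g = PowerSeries.X * gen2 (fun n b => g n (b + 1)) +
    PowerSeries.C (PowerSeries.mk fun n => g n 0) := by
  ext a n
  rcases a with _ | a <;> simp [gen2]

theorem vert_functional (h0 : ∀ a b, g 0 a b = if a = 0 ∧ b = 0 then 1 else 0)
    (h : ∀ n a b, g (n + 1) a b = g n a (b + 1) + g n (a + 1) b +
      (if 1 ≤ a ∧ 1 ≤ b then g n (a - 1) (b - 1) else 0) +
      (if b = 0 then s * g n 0 (a + 1) else 0) +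
      (if a = 0 ∧ 2 ≤ b then s⁻¹ * g n (b - 2) 0 else 0)) (T X Y : M3)
    (hT : T = MvPowerSeries.X 0) (hX : X = MvPowerSeries.X 1) (hY : Y = MvPowerSeries.X 2) :
    (X * Y - T * (X ^ 2 * Y ^ 2 + X + Y)) * gen3 g =
      X * Y - T * X * incX (gen2 fun n a => g n a 0) - T * Y * incY (gen2 fun n b => g n 0 b) +
      MvPowerSeries.C s * T * Y * (incX (gen2 fun n b => g n 0 b) -
        incX (PowerSeries.C (PowerSeries.mk fun n => g n 0 0))) +
      MvPowerSeries.C s⁻¹ * T * X * Y ^ 3 * incY (gen2 fun n a => g n a 0) := by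
  subst hT hX hY
  have h1 := vert_functional_aux h0 h
  have h2 := congrArg incX (gen2_shift fun n b => g n 0 b)
  rw [map_add, map_mul, inc_X] at h2
  linear_combination MvPowerSeries.X 1 * MvPowerSeries.X 2 * h1 +
    MvPowerSeries.X 0 * MvPowerSeries.X 1 * X2_mul_shift (g := g) +
    MvPowerSeries.X 0 * MvPowerSeries.X 2 * X1_mul_shift (g := g) -
    MvPowerSeries.C s * MvPowerSeries.X 0 * MvPowerSeries.X 2 * h2

end FunctionalEquations

section Lucas

variable {A : Type*} [CommRing A]

/-- The Lucas sequence `V_n(p, q)`. -/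
def lucasV (p q : A) : ℕ → A
  | 0 => 2
  | 1 => p
  | n + 2 => p * lucasV p q (n + 1) - q * lucasV p q n

/-- The Lucas sequence `U_n(p, q)`. -/
def lucasU (p q : A) : ℕ → A
  | 0 => 0
  | 1 => 1
  | n + 2 => p * lucasU p q (n + 1) - q * lucasU p q n

theorem lucasV_eq {p q : A} {r r' : A} (hp : r + r' = p) (hq : r * r' = q) (n : ℕ) :
    lucasV p q n = r ^ n + r' ^ n := by
  induction n using Nat.twoStepInduction with
  | zero => simp only [lucasV, pow_zero]; norm_num
  | one => simp only [lucasV, pow_one, hp]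
  | more n h1 h2 => rw [lucasV, h1, h2, ← hp, ← hq]; ring

theorem lucasU_eq {p q : A} {r r' : A} (hp : r + r' = p) (hq : r * r' = q) (n : ℕ) :
    (r - r') * lucasU p q n = r ^ n - r' ^ n := by
  induction n using Nat.twoStepInduction with
  | zero => simp [lucasU]
  | one => simp [lucasU]
  | more n h1 h2 =>
    rw [lucasU, ← hp, ← hq]
    rw [← hp, ← hq] at h1 h2
    linear_combination (r + r') * h2 - r * r' * h1

theorem map_lucasV {B : Type*} [CommRing B] (f : A →+* B) (p q : A) (n : ℕ) :
    f (lucasV p q n) = lucasV (f p) (f q) n := by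
  induction n using Nat.twoStepInduction with
  | zero => exact map_ofNat f 2
  | one => simp [lucasV]
  | more n h1 h2 => simp [lucasV, h1, h2]

theorem map_lucasU {B : Type*} [CommRing B] (f : A →+* B) (p q : A) (n : ℕ) :
    f (lucasU p q n) = lucasU (f p) (f q) n := by
  induction n using Nat.twoStepInduction with
  | zero => simp [lucasU]
  | one => simp [lucasU]
  | more n h1 h2 => simp [lucasU, h1, h2]

theorem lucas_scale (c p q : A) (n : ℕ) :
    lucasV (c * p) (c ^ 2 * q) n = c ^ n * lucasV p q n := by
  induction n using Nat.twoStepInduction with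
  | zero => simp [lucasV]
  | one => simp [lucasV]
  | more n h1 h2 => rw [lucasV, lucasV, h1, h2]; ring

theorem lucasV_zero_right (p : A) (n : ℕ) (hn : n ≠ 0) : lucasV p 0 n = p ^ n := by
  rw [lucasV_eq (add_zero p) (mul_zero p), zero_pow hn, add_zero]

end Lucas

/-- The discriminant factor relating the two kernel parameters. -/
def wS : S := (PowerSeries.X - t) ^ 2 - 4 * t ^ 2 * PowerSeries.X ^ 3

/-- The second discriminant factor. -/
def gS : S := t * PowerSeries.X ^ 3 + 2 * t - PowerSeries.X

/-- The parameter `x = tξ`. -/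
def x : L := ι t * ι ξ

/-- The parameter `y = tη`. -/
def y : L := ι t * ι η

theorem x_ne_zero : x ≠ 0 := mul_ne_zero ι_t_ne_zero ι_ξ_ne_zero
theorem y_ne_zero : y ≠ 0 := mul_ne_zero ι_t_ne_zero ι_η_ne_zero

theorem kernel_xy : ι t * (x ^ 2 * y ^ 2 + x + y) = x * y := by
  have h := congrArg ι η_eq
  simp only [map_add, map_mul, map_pow] at h
  rw [x, y]
  linear_combination ι t ^ 2 * h

theorem kernel_yx : ι t * (y ^ 2 * x ^ 2 + y + x) = y * x := by
  linear_combination kernel_xy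

section Field

variable {k : Type*} [Field k] {τ u v : k}

theorem root_w (hv : v ≠ 0) (hk : τ * (u ^ 2 * v ^ 2 + u + v) = u * v) :
    (u - τ) ^ 2 - 4 * τ ^ 2 * u ^ 3 = (τ * u / v * (1 - u * v ^ 2)) ^ 2 := by
  field_simp
  linear_combination (-2 * u * v + 2 * v * τ - (u * v + τ * (u ^ 2 * v ^ 2 + u - v)) +
    2 * (u * v - τ * v)) * hk

theorem root_g (hu : u ≠ 0) (hv : v ≠ 0) (hk : τ * (u ^ 2 * v ^ 2 + u + v) = u * v) :
    τ * u ^ 3 + 2 * τ - u = τ * u * ((u - v) * (u - 1 / (u * v))) := by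
  field_simp
  linear_combination hk

end Field

theorem ι_phiX_X : ι (phiX PowerSeries.X) = x := by rw [phiX_X, map_mul, x]
theorem ι_phiY_X : ι (phiY PowerSeries.X) = y := by rw [phiY_X, map_mul, y]

theorem ι_phiX_wS : ι (phiX wS) = (ι t * x / y * (1 - x * y ^ 2)) ^ 2 := by
  rw [← root_w y_ne_zero kernel_xy]
  simp only [wS, map_sub, map_mul, map_pow, map_ofNat, ι_phiX_X, phiX_t]

theorem ι_phiX_gS : ι (phiX gS) = ι t * x * ((x - y) * (x - 1 / (x * y))) := by
  rw [← root_g x_ne_zero y_ne_zero kernel_xy]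
  simp only [gS, map_sub, map_add, map_mul, map_pow, map_ofNat, ι_phiX_X, phiX_t]

theorem ι_phiY_wS : ι (phiY wS) = (ι t * y / x * (1 - y * x ^ 2)) ^ 2 := by
  rw [← root_w x_ne_zero kernel_yx]
  simp only [wS, map_sub, map_mul, map_pow, map_ofNat, ι_phiY_X, phiY_t]

theorem ι_phiY_gS : ι (phiY gS) = ι t * y * ((y - x) * (y - 1 / (y * x))) := by
  rw [← root_g y_ne_zero x_ne_zero kernel_yx]
  simp only [gS, map_sub, map_add, map_mul, map_pow, map_ofNat, ι_phiY_X, phiY_t]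

theorem invariant_of_field {f : S} {b : ℕ} (h : ι (phiX f) * y ^ b = ι (phiY f) * x ^ b) :
    phiX f * η ^ b = phiY f * ξ ^ b := by
  apply ι_injective
  rw [x, y, mul_pow, mul_pow] at h
  rw [map_mul, map_mul, map_pow, map_pow]
  apply mul_left_cancel₀ (pow_ne_zero b ι_t_ne_zero)
  linear_combination h

/-- Roots of the quadratic polynomials attached to the two kernel parameters, which are
exchanged by the symmetry up to a power of the parameters. -/
structure RootSystem (F c Q : S) (e N : ℕ) where
  (r r' q q' : L)
  r_add : r + r' = ι (phiX F)
  r_mul : r * r' = ι (phiX Q)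
  r_sub : r - r' = ι t * x / y * (1 - x * y ^ 2) * ι (phiX c)
  q_add : q + q' = ι (phiY F)
  q_mul : q * q' = ι (phiY Q)
  q_sub : q - q' = ι t * y / x * (1 - y * x ^ 2) * ι (phiY c)
  r_pow : r ^ N * y ^ (e * N) = q' ^ N * x ^ (e * N)
  r'_pow : r' ^ N * y ^ (e * N) = q ^ N * x ^ (e * N)

namespace RootSystem

variable {F c Q : S} {e N : ℕ}

theorem discr (h : RootSystem F c Q e N) : F ^ 2 - 4 * Q = wS * c ^ 2 := by
  apply phiX_injective
  apply ι_injective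
  simp only [map_sub, map_mul, map_pow, map_ofNat, ι_phiX_wS, ← h.r_add, ← h.r_mul]
  linear_combination (h.r - h.r' + ι t * x / y * (1 - x * y ^ 2) * ι (phiX c)) * h.r_sub

theorem discr_lucas (h : RootSystem F c Q e N) :
    lucasV F Q N ^ 2 - 4 * Q ^ N = wS * (c * lucasU F Q N) ^ 2 := by
  have h0 := h.discr
  apply phiX_injective
  apply ι_injective
  have h1 := congrArg (fun f => ι (phiX f)) h0
  have h2 := lucasU_eq h.r_add h.r_mul N
  simp only [map_sub, map_mul, map_pow, map_ofNat, map_lucasV, map_lucasU] at h1 ⊢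
  rw [lucasV_eq h.r_add h.r_mul, ← h.r_mul]
  rw [← h.r_mul] at h2
  generalize lucasU (ι (phiX F)) (h.r * h.r') N = U at *
  rw [← h.r_add, ← h.r_mul] at h1
  rw [mul_pow h.r h.r' N]
  linear_combination U ^ 2 * h1 - (h.r ^ N - h.r' ^ N + (h.r - h.r') * U) * h2

theorem invariant_lucasV (h : RootSystem F c Q e N) :
    phiX (lucasV F Q N) * η ^ (e * N) = phiY (lucasV F Q N) * ξ ^ (e * N) := by
  apply invariant_of_field
  simp only [map_lucasV]
  rw [lucasV_eq h.r_add h.r_mul, lucasV_eq h.q_add h.q_mul]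
  linear_combination h.r_pow + h.r'_pow

theorem phiX_T (h : RootSystem F c Q e N) :
    ι (phiX (wS * gS * (c * lucasU F Q N))) =
    ι t * x / y * (1 - x * y ^ 2) * (ι t * x * ((x - y) * (x - 1 / (x * y)))) *
      (h.r ^ N - h.r' ^ N) := by
  have h2 := lucasU_eq h.r_add h.r_mul N
  rw [h.r_sub] at h2
  simp only [map_mul, map_lucasU, ι_phiX_wS, ι_phiX_gS]
  rw [← h2]; ring

theorem phiY_T (h : RootSystem F c Q e N) :
    ι (phiY (wS * gS * (c * lucasU F Q N))) =
    ι t * y / x * (1 - y * x ^ 2) * (ι t * y * ((y - x) * (y - 1 / (y * x)))) *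
      (h.q ^ N - h.q' ^ N) := by
  have h2 := lucasU_eq h.q_add h.q_mul N
  rw [h.q_sub] at h2
  simp only [map_mul, map_lucasU, ι_phiY_wS, ι_phiY_gS]
  rw [← h2]; ring

theorem invariant_T (h : RootSystem F c Q e N) :
    phiX (wS * gS * (c * lucasU F Q N)) * η ^ (e * N + 3) =
    phiY (wS * gS * (c * lucasU F Q N)) * ξ ^ (e * N + 3) := by
  apply invariant_of_field
  rw [h.phiX_T, h.phiY_T]
  have hx := x_ne_zero
  have hy := y_ne_zero
  have h3 : (h.r ^ N - h.r' ^ N) * y ^ (e * N) = -((h.q ^ N - h.q' ^ N) * x ^ (e * N)) := by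
    linear_combination h.r_pow - h.r'_pow
  rw [pow_add, pow_add]
  field_simp
  linear_combination (x - y) * (x ^ 2 * y - 1) * (1 - x * y ^ 2) * ι t ^ 2 * h3

end RootSystem

open Polynomial

/-- The variable `t` in `K`. -/
def τ : K := algebraMap R K PowerSeries.X

theorem ψ_τ : ψ τ = ι t := by rw [τ, ψ_algebraMap, t]

theorem τ_ne_zero : τ ≠ 0 := by
  rw [τ, Ne, map_eq_zero_iff _ (IsFractionRing.injective R K)]
  exact PowerSeries.X_ne_zero

instance : CharZero R := charZero_of_injective_algebraMap (PowerSeries.C_injective (R := ℂ))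

instance : CharZero K := charZero_of_injective_algebraMap (IsFractionRing.injective R K)

theorem one_sub_τ_ne_zero : 1 - 27 * τ ^ 3 ≠ 0 := by
  have h : (1 - 27 * τ ^ 3 : K) = algebraMap R K (1 - 27 * PowerSeries.X ^ 3) := by
    simp only [τ, map_sub, map_mul, map_pow, map_one, map_ofNat]
  rw [h, Ne, map_eq_zero_iff _ (IsFractionRing.injective R K)]
  intro h
  simpa using congrArg PowerSeries.constantCoeff h

/-- The cubic polynomial whose roots are the ramification values of the basic invariant. -/
def Δ : K[X] := -4 * X ^ 3 + X ^ 2 + 18 * C τ ^ 3 * X - (4 * C τ ^ 3 + 27 * C τ ^ 6)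

theorem Δ_eq : Δ =
    C (-4) * X ^ 3 + C 1 * X ^ 2 + C (18 * τ ^ 3) * X + C (-(4 * τ ^ 3 + 27 * τ ^ 6)) := by
  simp only [Δ, map_neg, map_add, map_mul, map_pow, map_one, map_ofNat]
  ring

theorem natDegree_Δ : Δ.natDegree = 3 := by
  rw [Δ_eq]
  exact natDegree_cubic (neg_ne_zero.2 (OfNat.ofNat_ne_zero 4))

theorem Δ_ne_zero : Δ ≠ 0 := by
  intro h
  have := natDegree_Δ
  rw [h, natDegree_zero] at this
  omega

theorem derivative_Δ : derivative Δ = -12 * X ^ 2 + 2 * X + 18 * C τ ^ 3 := by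
  rw [Δ_eq]
  simp only [derivative_add, derivative_C_mul, derivative_X_pow, derivative_X, derivative_C]
  simp only [map_neg, map_mul, map_pow, map_one, map_ofNat, Nat.cast_ofNat]
  ring

theorem squarefree_Δ : Squarefree Δ := by
  apply Separable.squarefree
  have hr : (72 * τ ^ 3 * (1 - 27 * τ ^ 3) ^ 3 : K) ≠ 0 :=
    mul_ne_zero (mul_ne_zero (OfNat.ofNat_ne_zero 72) (pow_ne_zero 3 τ_ne_zero))
      (pow_ne_zero 3 one_sub_τ_ne_zero)
  obtain ⟨r, hr'⟩ : ∃ r : K, r = 72 * τ ^ 3 * (1 - 27 * τ ^ 3) ^ 3 := ⟨_, rfl⟩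
  rw [← hr'] at hr
  have hh : C r⁻¹ * C r = 1 := by rw [← C_mul, inv_mul_cancel₀ hr, C_1]
  have h2 : (C 2⁻¹ : K[X]) * 2 = 1 := by
    rw [← map_ofNat (C : K →+* K[X]) 2, ← C_mul, inv_mul_cancel₀ two_ne_zero, C_1]
  have h3 : C r = 72 * C τ ^ 3 * (1 - 27 * C τ ^ 3) ^ 3 := by
    rw [hr']; simp only [map_sub, map_mul, map_pow, map_one, map_ofNat]
  obtain ⟨q, hq⟩ : ∃ q : K[X], q = (1 + 216 * C τ ^ 3) - 6 * (1 + 216 * C τ ^ 3) * X -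
    6 * (63 * C τ ^ 3 + 486 * C τ ^ 6) := ⟨_, rfl⟩
  refine ⟨C r⁻¹ * (-18 * q), C r⁻¹ * (C 2⁻¹ * ((1 + 216 * C τ ^ 3) ^ 2 + q * (12 * X - 1))), ?_⟩
  rw [derivative_Δ, Δ]
  have h4 : -18 * q * (-4 * X ^ 3 + X ^ 2 + 18 * C τ ^ 3 * X - (4 * C τ ^ 3 + 27 * C τ ^ 6)) +
      ((1 + 216 * C τ ^ 3) ^ 2 + q * (12 * X - 1)) * (-6 * X ^ 2 + X + 9 * C τ ^ 3) =
      72 * C τ ^ 3 * (1 - 27 * C τ ^ 3) ^ 3 := by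
    rw [hq]; ring
  linear_combination C r⁻¹ * ((1 + 216 * C τ ^ 3) ^ 2 + q * (12 * X - 1)) *
    (-6 * X ^ 2 + X + 9 * C τ ^ 3) * h2 + C r⁻¹ * h4 - C r⁻¹ * h3 + hh

theorem x_sq_mul_J : x ^ 2 * J = ι t * x - ι t ^ 2 + ι t ^ 2 * x ^ 3 := by
  have h := J_mul
  simp only [Jn, map_add, map_sub, map_mul, map_pow, map_one] at h
  rw [x]
  linear_combination ι t ^ 2 * h

theorem x_pow_mul_evJ_Δ : x ^ 6 * evJ Δ = ι t ^ 2 * ι (phiX (wS * gS ^ 2)) := by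
  have h := x_sq_mul_J
  simp only [Δ, wS, gS, map_add, map_sub, map_mul, map_pow, map_neg, map_ofNat, evJ_X, evJ_C, ψ_τ,
    ι_phiX_X, phiX_t]
  set c := ι t * x - ι t ^ 2 + ι t ^ 2 * x ^ 3 with hc
  have h1 : x ^ 6 * (-4 * J ^ 3 + J ^ 2 + 18 * ι t ^ 3 * J - (4 * ι t ^ 3 + 27 * ι t ^ 6)) =
    -4 * (x ^ 2 * J) ^ 3 + x ^ 2 * (x ^ 2 * J) ^ 2 + 18 * ι t ^ 3 * x ^ 4 * (x ^ 2 * J) -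
      x ^ 6 * (4 * ι t ^ 3 + 27 * ι t ^ 6) := by ring
  rw [h1, h, hc]
  ring

theorem RootSystem.exists_polynomials {F c f : S} {e N l b : ℕ} (h : RootSystem F c (f ^ l) e N)
    (hf : phiX f * η ^ b = phiY f * ξ ^ b) (hb : l * b = 2 * e) :
    ∃ m P T : K[X], m.natDegree ≤ b / 2 ∧ P.natDegree ≤ e * N / 2 ∧
      T.natDegree ≤ (e * N + 3) / 2 ∧ ι (phiX f) = x ^ b * evJ m ∧
      ι (phiX (lucasV F (f ^ l) N)) = x ^ (e * N) * evJ P ∧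
      ι (phiX (wS * gS * (c * lucasU F (f ^ l) N))) = x ^ (e * N + 3) * evJ T ∧
      C τ ^ 2 * T ^ 2 = Δ * (P ^ 2 - 4 * m ^ (l * N)) := by
  obtain ⟨m, hm, hm'⟩ := exists_polynomial_of_invariant _ _ hf
  obtain ⟨P, hP, hP'⟩ := exists_polynomial_of_invariant _ _ h.invariant_lucasV
  obtain ⟨T, hT, hT'⟩ := exists_polynomial_of_invariant _ _ h.invariant_T
  rw [← x] at hm' hP' hT'
  refine ⟨m, P, T, hm, hP, hT, hm', hP', hT', ?_⟩
  apply evJ_injective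
  have hd := congrArg (fun z => ι (phiX z)) h.discr_lucas
  have hΔ := x_pow_mul_evJ_Δ
  simp only [map_mul, map_sub, map_pow, map_ofNat, evJ_C, ψ_τ] at hd hΔ hP' hT' ⊢
  rw [hm', hP'] at hd
  have h4 : (((x ^ b * evJ m) ^ l) ^ N) = (x ^ (e * N)) ^ 2 * evJ m ^ (l * N) := by
    rw [← pow_mul, mul_pow, ← pow_mul, ← pow_mul]
    congr 2
    linear_combination N * hb
  rw [h4] at hd
  have hx := x_ne_zero
  apply mul_left_cancel₀ (pow_ne_zero (2 * (e * N + 3)) hx)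
  generalize ι (phiX (lucasU F (f ^ l) N)) = U at *
  linear_combination (-ι t ^ 2) * (ι (phiX wS) * ι (phiX gS) * (ι (phiX c) * U) +
      x ^ (e * N + 3) * evJ T) * hT' + ι t ^ 2 * ι (phiX wS) * ι (phiX gS) ^ 2 * (-hd) -
    (x ^ (e * N)) ^ 2 * (evJ P ^ 2 - 4 * evJ m ^ (l * N)) * hΔ

/-- The subfield `ℂ(t)` of `K`. -/
abbrev F₀ : IntermediateField ℂ K := IntermediateField.adjoin ℂ {τ}

/-- The variable `t` in `F₀`. -/
def τ₀ : F₀ := ⟨τ, IntermediateField.mem_adjoin_simple_self ℂ τ⟩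

theorem algebraMap_τ₀ : algebraMap F₀ K τ₀ = τ := rfl

theorem coeffwise_map (D : Derivation F₀ K K) (p : F₀[X]) :
    D.coeffwise (p.map (algebraMap F₀ K)) = 0 := by
  ext i
  rw [D.coeff_coeffwise, coeff_map, D.map_algebraMap, coeff_zero]

theorem coeffwise_Δ (D : Derivation F₀ K K) : D.coeffwise (C τ ^ 2 * Δ) = 0 := by
  have : C τ ^ 2 * Δ = Polynomial.map (algebraMap F₀ K) (C τ₀ ^ 2 * (-4 * X ^ 3 + X ^ 2 +
      18 * C τ₀ ^ 3 * X - (4 * C τ₀ ^ 3 + 27 * C τ₀ ^ 6))) := by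
    simp only [Δ, Polynomial.map_sub, Polynomial.map_add, Polynomial.map_mul, Polynomial.map_pow,
      Polynomial.map_neg, Polynomial.map_ofNat, map_X, map_C, algebraMap_τ₀]
  rw [this, coeffwise_map]

theorem isUnit_C_τ_sq : IsUnit (C τ ^ 2) :=
  (isUnit_C.2 (isUnit_iff_ne_zero.2 τ_ne_zero)).pow 2

theorem squarefree_C_mul_Δ : Squarefree (C τ ^ 2 * Δ) :=
  squarefree_Δ.squarefree_of_dvd ((isUnit_C_τ_sq.dvd_mul_left).1 dvd_rfl)

theorem coeffwise_eq_zero_of_pell (D : Derivation F₀ K K) {m P T : K[X]} {l : ℕ}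
    (h : C τ ^ 2 * T ^ 2 = Δ * (P ^ 2 - 4 * m ^ l)) (hm : Irreducible m)
    (hlead : m.leadingCoeff ∈ F₀) (hT : T ≠ 0) (hP : 2 * P.natDegree ≤ m.natDegree * l)
    (hTd : 2 * T.natDegree + 2 * m.natDegree < m.natDegree * l + 6) :
    D.coeffwise m = 0 ∧ D.coeffwise P = 0 := by
  have h1 : Δ ∣ T := by
    rw [← squarefree_Δ.dvd_pow_iff_dvd two_ne_zero, ← isUnit_C_τ_sq.dvd_mul_left, h]
    exact dvd_mul_right _ _
  obtain ⟨r, rfl⟩ := h1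
  have hr : r ≠ 0 := right_ne_zero_of_mul hT
  rw [natDegree_mul Δ_ne_zero hr, natDegree_Δ] at hTd
  refine derivation_eq_zero_of_pell D.coeffwise D.degree_coeffwise_le (coeffwise_Δ D)
    squarefree_C_mul_Δ hm (D.degree_coeffwise_lt hm.ne_zero (D.map_algebraMap ⟨_, hlead⟩)) l P r hr
    ?_ hP (by omega)
  apply mul_left_cancel₀ Δ_ne_zero
  linear_combination -h

theorem isAlgebraic_coeff {p : K[X]} (h : ∀ D : Derivation F₀ K K, D.coeffwise p = 0) (i : ℕ) :
    IsAlgebraic F₀ (p.coeff i) := by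
  refine isAlgebraic_of_forall_derivation_eq_zero fun D => ?_
  rw [← D.coeff_coeffwise, h D, coeff_zero]

/-- The subfield `ℂ(t, x)` of `L`. -/
abbrev E : IntermediateField ℂ L := IntermediateField.adjoin ℂ {ι t, x}

/-- Elements of `L` algebraic over `ℂ(t, x)`. -/
abbrev Ealg : IntermediateField E L := algebraicClosure E L

theorem mem_Ealg {z : L} : z ∈ Ealg ↔ IsAlgebraic E z := mem_algebraicClosure_iff

theorem ι_t_mem : ι t ∈ Ealg :=
  Ealg.algebraMap_mem ⟨ι t, IntermediateField.subset_adjoin ℂ _ (by simp)⟩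

theorem x_mem : x ∈ Ealg :=
  Ealg.algebraMap_mem ⟨x, IntermediateField.subset_adjoin ℂ _ (by simp)⟩

theorem ψ_algebraMap_complex (c : ℂ) : ψ (algebraMap ℂ K c) = algebraMap ℂ L c := by
  rw [IsScalarTower.algebraMap_apply ℂ R K, ψ_algebraMap, IsScalarTower.algebraMap_apply ℂ S L]
  exact congrArg ι (PowerSeries.algebraMap_apply (A := R) (r := c)).symm

theorem algebraMap_complex_mem (c : ℂ) : algebraMap ℂ L c ∈ Ealg := by
  rw [IsScalarTower.algebraMap_apply ℂ E L]
  exact Ealg.algebraMap_mem _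

theorem ψ_mem_E {c : K} (hc : c ∈ F₀) : ψ c ∈ E := by
  let f : K →ₐ[ℂ] L := { ψ with commutes' := ψ_algebraMap_complex }
  have h : F₀ ≤ E.comap f := by
    rw [IntermediateField.adjoin_le_iff, Set.singleton_subset_iff]
    change ψ τ ∈ E
    rw [ψ_τ]
    exact IntermediateField.subset_adjoin ℂ _ (by simp)
  exact h hc

theorem ψ_mem_Ealg {c : K} (hc : IsAlgebraic F₀ c) : ψ c ∈ Ealg := by
  rw [mem_Ealg]
  refine hc.ringHom_of_comp_eq ((ψ.comp (algebraMap F₀ K)).codRestrict E fun c => ψ_mem_E c.2)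
    ψ (RingHom.injective _) rfl

theorem J_mem : J ∈ Ealg := by
  have h := x_sq_mul_J
  have : J = (ι t * x - ι t ^ 2 + ι t ^ 2 * x ^ 3) / x ^ 2 := by
    rw [eq_div_iff (pow_ne_zero 2 x_ne_zero), ← h]; ring
  rw [this]
  have h1 := ι_t_mem
  have h2 := x_mem
  exact div_mem (add_mem (sub_mem (mul_mem h1 h2) (pow_mem h1 2))
    (mul_mem (pow_mem h1 2) (pow_mem h2 3))) (pow_mem h2 2)

theorem evJ_mem {p : K[X]} (h : ∀ D : Derivation F₀ K K, D.coeffwise p = 0) : evJ p ∈ Ealg := by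
  rw [evJ, coe_eval₂RingHom, eval₂_eq_sum_range]
  exact sum_mem fun i _ => mul_mem (ψ_mem_Ealg (isAlgebraic_coeff h i)) (pow_mem J_mem i)

theorem mem_Ealg_of_pow {z : L} {n : ℕ} (hn : n ≠ 0) (h : z ^ n ∈ Ealg) : z ∈ Ealg := by
  rw [mem_Ealg] at h ⊢
  exact h.of_pow (Nat.pos_of_ne_zero hn)

instance : CharZero S :=
  RingHom.charZero (PowerSeries.constantCoeff (R := R))

instance : CharZero L := charZero_of_injective_algebraMap ι_injective

theorem mem_Ealg_of_sq {z b c : L} (hb : b ∈ Ealg) (hc : c ∈ Ealg) (h : z ^ 2 = b * z + c) :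
    z ∈ Ealg := by
  have h1 : z - b / 2 ∈ Ealg := by
    refine mem_Ealg_of_pow two_ne_zero ?_
    have : (z - b / 2) ^ 2 = c + (b / 2) ^ 2 := by
      field_simp
      linear_combination 4 * h
    rw [this]
    exact add_mem hc (pow_mem (div_mem hb (ofNat_mem Ealg 2)) 2)
  simpa using add_mem h1 (div_mem hb (ofNat_mem Ealg 2))

theorem y_mem : y ∈ Ealg := by
  refine mem_Ealg_of_sq (b := (x - ι t) / (ι t * x ^ 2)) (c := -1 / x)
    (div_mem (sub_mem x_mem ι_t_mem) (mul_mem ι_t_mem (pow_mem x_mem 2)))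
    (div_mem (neg_mem (one_mem _)) x_mem) ?_
  have := x_ne_zero
  have := ι_t_ne_zero
  field_simp
  linear_combination kernel_xy

theorem RootSystem.mem_Ealg {F c Q : S} {e N : ℕ} (h : RootSystem F c Q e N) (hN : N ≠ 0)
    (hV : ι (phiX (lucasV F Q N)) ∈ Ealg) (hQ : ι (phiX Q) ∈ Ealg) :
    h.r ∈ Ealg ∧ h.r' ∈ Ealg := by
  rw [map_lucasV, map_lucasV, lucasV_eq h.r_add h.r_mul] at hV
  rw [← h.r_mul] at hQ
  have hQ' := neg_mem (pow_mem hQ N)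
  constructor
  · exact mem_Ealg_of_pow hN (mem_Ealg_of_sq hV hQ' (by ring))
  · exact mem_Ealg_of_pow hN (mem_Ealg_of_sq hV hQ' (by ring))

theorem constantCoeff_eq_of_evJ {f : S} {q : ℕ} {m : K[X]} (hm : m.natDegree ≤ q)
    (h : ι (phiX f) = x ^ (2 * q) * evJ m) :
    algebraMap R K (PowerSeries.constantCoeff f) = (-τ ^ 2) ^ q * m.coeff q := by
  obtain ⟨a, ha, m', hm'⟩ := exists_integer_polynomial m
  have ha' : algebraMap R K a ≠ 0 := by
    rwa [Ne, map_eq_zero_iff _ (IsFractionRing.injective R K)]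
  have hd : m'.natDegree ≤ q := by
    rw [← natDegree_map_eq_of_injective (IsFractionRing.injective R K), ← hm',
      natDegree_C_mul ha']
    exact hm
  obtain ⟨z, hz, hz'⟩ := exists_clear_evJ m' q hd
  have h1 : phiX (PowerSeries.C a * f) = t ^ (2 * q) * z := by
    apply ι_injective
    rw [map_mul, map_mul, map_mul, map_pow, h, phiX_C, hz', ← hm', map_mul, evJ_C, ψ_algebraMap, x]
    ring
  have h2 := congrArg PowerSeries.constantCoeff h1
  rw [constantCoeff_phiX, map_mul, map_mul, map_pow, hz, constantCoeff_t,
    PowerSeries.constantCoeff_C] at h2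
  have h3 : (m'.map (algebraMap R K)).coeff q = algebraMap R K a * m.coeff q := by
    rw [← hm', coeff_C_mul]
  rw [coeff_map] at h3
  apply mul_left_cancel₀ ha'
  rw [← map_mul, h2, map_mul, map_mul, map_pow, map_pow, h3, ← τ, map_neg, map_one]
  rw [neg_pow (τ ^ 2)]
  ring

theorem exists_algebraMap_eq (c : ℂ) : algebraMap ℂ L c = ι (PowerSeries.C (PowerSeries.C c)) := by
  rw [← ψ_algebraMap_complex, IsScalarTower.algebraMap_apply ℂ R K, ψ_algebraMap]
  rfl

theorem xy_sq_ne_one : 1 / (x * y) - y ≠ 0 := by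
  intro h
  have hx := x_ne_zero
  have hy := y_ne_zero
  field_simp at h
  have h1 : (1 : S) = (t * ξ) * (t * η) ^ 2 := by
    apply ι_injective
    simp only [map_mul, map_pow, map_one]
    rw [← x, ← y]
    linear_combination h
  have h2 := congrArg PowerSeries.constantCoeff h1
  simp [constantCoeff_ξ, constantCoeff_η] at h2

section CellIdentities

variable {k : Type*} [Field k] {τ u v α β α' β' s : k}

theorem cell_r_add (hu : u ≠ 0) (hv : v ≠ 0) (hk : τ * (u ^ 2 * v ^ 2 + u + v) = u * v) :
    τ ^ 3 * u ^ 3 * (u ^ 2 * v * (α / (u * v) + β / u) ^ 3) +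
      τ ^ 3 * u ^ 3 * (u / v * (α * v + β / u) ^ 3) =
    τ * (α ^ 3 * ((u - τ) ^ 2 - 2 * τ ^ 2 * u ^ 3) + 3 * α ^ 2 * β * τ * u * (u - τ) +
      6 * α * β ^ 2 * τ ^ 2 * u ^ 2 + β ^ 3 * τ * (u - τ)) := by
  field_simp
  linear_combination (τ * α ^ 3 * (τ * (u + u ^ 2 * v ^ 2) + v * (u - τ)) +
    3 * τ ^ 2 * u * v * α ^ 2 * β + τ ^ 2 * v * β ^ 3) * hk

theorem cell_f (hu : u ≠ 0) (hv : v ≠ 0) (hk : τ * (u ^ 2 * v ^ 2 + u + v) = u * v) :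
    τ * (τ * u ^ 2 * α ^ 2 + α * β * (u - τ) + τ * u * β ^ 2) =
      τ ^ 2 * u ^ 3 * ((α * v + β / u) * (α / (u * v) + β / u)) := by
  field_simp
  linear_combination -(τ * α * β) * hk

theorem cell_r_mul (hu : u ≠ 0) (hv : v ≠ 0) (hk : τ * (u ^ 2 * v ^ 2 + u + v) = u * v) :
    (τ ^ 3 * u ^ 3 * (u ^ 2 * v * (α / (u * v) + β / u) ^ 3)) *
      (τ ^ 3 * u ^ 3 * (u / v * (α * v + β / u) ^ 3)) =
    (τ * (τ * u ^ 2 * α ^ 2 + α * β * (u - τ) + τ * u * β ^ 2)) ^ 3 := by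
  rw [cell_f hu hv hk]
  generalize α / (u * v) + β / u = d
  generalize α * v + β / u = d'
  field_simp

theorem cell_r_sub (hu : u ≠ 0) (hv : v ≠ 0) (hk : τ * (u ^ 2 * v ^ 2 + u + v) = u * v) :
    τ ^ 3 * u ^ 3 * (u ^ 2 * v * (α / (u * v) + β / u) ^ 3) -
      τ ^ 3 * u ^ 3 * (u / v * (α * v + β / u) ^ 3) =
    τ * u / v * (1 - u * v ^ 2) *
      (τ * (α ^ 3 * (u - τ) + 3 * τ * u * α ^ 2 * β - τ * β ^ 3)) := by
  field_simp
  linear_combination τ ^ 2 * α ^ 3 * (1 - u * v ^ 2) * hk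

theorem cell_r_pow {N : ℕ} (hs : s ^ N = 1) (hu : u ≠ 0) (hv : v ≠ 0)
    (h : α' * u * v + β' = s * (α + β * v)) :
    (τ ^ 3 * u ^ 3 * (u ^ 2 * v * (α / (u * v) + β / u) ^ 3)) ^ N * v ^ (3 * N) =
      (τ ^ 3 * v ^ 3 * (v / u * (α' * u + β' / v) ^ 3)) ^ N * u ^ (3 * N) := by
  have h1 : α' * u + β' / v = s * (α + β * v) / v := by
    rw [← h]; field_simp
  have h2 : α / (u * v) + β / u = (α + β * v) / (u * v) := by field_simp
  rw [h1, h2]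
  have h3 : (τ ^ 3 * v ^ 3 * (v / u * (s * (α + β * v) / v) ^ 3)) * u ^ 3 =
     s ^ 3 * ((τ ^ 3 * u ^ 3 * (u ^ 2 * v * ((α + β * v) / (u * v)) ^ 3)) * v ^ 3) := by
    field_simp
  rw [pow_mul v, pow_mul u, ← mul_pow _ (v ^ 3), ← mul_pow _ (u ^ 3), h3, mul_pow (s ^ 3),
    ← pow_mul s, mul_comm 3 N, pow_mul s, hs, one_pow, one_mul]

end CellIdentities

/-- The linear coefficient of the decoupled function. -/
def cellA (s : ℂ) (A : S) : S :=
  (1 - PowerSeries.C (PowerSeries.C s) ^ 3) * t * PowerSeries.X * A +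
    PowerSeries.C (PowerSeries.C s)

/-- The constant coefficient of the decoupled function. -/
def cellB (s : ℂ) (B : S) : S :=
  -((1 - PowerSeries.C (PowerSeries.C s) ^ 3) * PowerSeries.C (PowerSeries.C s) * t *
    PowerSeries.X * B) + PowerSeries.C (PowerSeries.C s) ^ 3 * PowerSeries.X +
    PowerSeries.C (PowerSeries.C s) ^ 2

/-- The product of the two conjugates of `a y + b`, up to a power of the variables. -/
def cellf (a b : S) : S :=
  t * (t * PowerSeries.X ^ 2 * a ^ 2 + a * b * (PowerSeries.X - t) + t * PowerSeries.X * b ^ 2)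

/-- The sum of the cubes of the two conjugates of `a y + b`, suitably weighted. -/
def cellF (a b : S) : S :=
  t * (a ^ 3 * ((PowerSeries.X - t) ^ 2 - 2 * t ^ 2 * PowerSeries.X ^ 3) +
    3 * a ^ 2 * b * t * PowerSeries.X * (PowerSeries.X - t) +
      6 * a * b ^ 2 * t ^ 2 * PowerSeries.X ^ 2 + b ^ 3 * t * (PowerSeries.X - t))

/-- The cofactor in the difference of the weighted cubes of the two conjugates of `a y + b`. -/
def cellc (a b : S) : S :=
  t * (a ^ 3 * (PowerSeries.X - t) + 3 * t * PowerSeries.X * a ^ 2 * b - t * b ^ 3)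

/-- The root system attached to a function satisfying the cell-centred relations. -/
def cellRoots {s : ℂ} {N : ℕ} (hs : s ^ N = 1) {a b : S}
    (h : ι (phiY a) * x * y + ι (phiY b) = algebraMap ℂ L s * (ι (phiX a) + ι (phiX b) * y))
    (h' : ι (phiX a) * y * x + ι (phiX b) = algebraMap ℂ L s * (ι (phiY a) + ι (phiY b) * x)) :
    RootSystem (cellF a b) (cellc a b) (cellf a b ^ 3) 3 N where
  r := ι t ^ 3 * x ^ 3 * (x ^ 2 * y * (ι (phiX a) / (x * y) + ι (phiX b) / x) ^ 3)
  r' := ι t ^ 3 * x ^ 3 * (x / y * (ι (phiX a) * y + ι (phiX b) / x) ^ 3)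
  q := ι t ^ 3 * y ^ 3 * (y ^ 2 * x * (ι (phiY a) / (y * x) + ι (phiY b) / y) ^ 3)
  q' := ι t ^ 3 * y ^ 3 * (y / x * (ι (phiY a) * x + ι (phiY b) / y) ^ 3)
  r_add := by
    rw [cell_r_add x_ne_zero y_ne_zero kernel_xy]
    simp only [cellF, map_add, map_sub, map_mul, map_pow, map_ofNat, phiX_t, ι_phiX_X]
  r_mul := by
    rw [cell_r_mul x_ne_zero y_ne_zero kernel_xy]
    simp only [cellf, map_add, map_sub, map_mul, map_pow, phiX_t, ι_phiX_X]
  r_sub := by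
    rw [cell_r_sub x_ne_zero y_ne_zero kernel_xy]
    simp only [cellc, map_add, map_sub, map_mul, map_pow, map_ofNat, phiX_t, ι_phiX_X]
  q_add := by
    rw [cell_r_add y_ne_zero x_ne_zero kernel_yx]
    simp only [cellF, map_add, map_sub, map_mul, map_pow, map_ofNat, phiY_t, ι_phiY_X]
  q_mul := by
    rw [cell_r_mul y_ne_zero x_ne_zero kernel_yx]
    simp only [cellf, map_add, map_sub, map_mul, map_pow, phiY_t, ι_phiY_X]
  q_sub := by
    rw [cell_r_sub y_ne_zero x_ne_zero kernel_yx]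
    simp only [cellc, map_add, map_sub, map_mul, map_pow, map_ofNat, phiY_t, ι_phiY_X]
  r_pow := cell_r_pow (by rw [← map_pow, hs, map_one]) x_ne_zero y_ne_zero h
  r'_pow := (cell_r_pow (by rw [← map_pow, hs, map_one]) y_ne_zero x_ne_zero h').symm

theorem cellf_invariant {s : ℂ} {a b : S}
    (h : ι (phiY a) * x * y + ι (phiY b) = algebraMap ℂ L s * (ι (phiX a) + ι (phiX b) * y))
    (h' : ι (phiX a) * y * x + ι (phiX b) = algebraMap ℂ L s * (ι (phiY a) + ι (phiY b) * x)) :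
    phiX (cellf a b) * η ^ 2 = phiY (cellf a b) * ξ ^ 2 := by
  apply invariant_of_field
  have h1 := cell_f (α := ι (phiX a)) (β := ι (phiX b)) x_ne_zero y_ne_zero kernel_xy
  have h2 := cell_f (α := ι (phiY a)) (β := ι (phiY b)) y_ne_zero x_ne_zero kernel_yx
  simp only [cellf, map_add, map_sub, map_mul, map_pow, phiX_t, ι_phiX_X, phiY_t,
    ι_phiY_X]
  rw [h1, h2]
  have hx := x_ne_zero
  have hy := y_ne_zero
  field_simp
  linear_combination ι t ^ 2 * ((ι (phiX a) + y * ι (phiX b)) * h' -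
    (ι (phiY a) + x * ι (phiY b)) * h)

/-- Setting `t = 0`. -/
def red : S →+* R := PowerSeries.map PowerSeries.constantCoeff

theorem red_t : red t = 0 := by simp [red, t]
theorem red_X : red PowerSeries.X = PowerSeries.X := PowerSeries.map_X _
theorem red_C (c : ℂ) : red (PowerSeries.C (PowerSeries.C c)) = PowerSeries.C c := by simp [red]

theorem cell_lucas_ne {s : ℂ} {N : ℕ} (hN : N ≠ 0) (hs0 : s ≠ 0) (A B : S) :
    lucasV (cellF (cellA s A) (cellB s B)) (cellf (cellA s A) (cellB s B) ^ 3) N ^ 2 ≠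
      4 * (cellf (cellA s A) (cellB s B) ^ 3) ^ N := by
  intro h
  have hF : ∀ a b, cellF a b =
      t * (a ^ 3 * ((PowerSeries.X - t) ^ 2 - 2 * t ^ 2 * PowerSeries.X ^ 3) +
    3 * a ^ 2 * b * t * PowerSeries.X * (PowerSeries.X - t) +
      6 * a * b ^ 2 * t ^ 2 * PowerSeries.X ^ 2 + b ^ 3 * t * (PowerSeries.X - t)) := fun a b => rfl
  have hf : ∀ a b, cellf a b ^ 3 = t ^ 2 * (t * (t * PowerSeries.X ^ 2 * a ^ 2 +
      a * b * (PowerSeries.X - t) + t * PowerSeries.X * b ^ 2) ^ 3) := fun a b => by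
    rw [cellf]; ring
  rw [hF, hf, lucas_scale, mul_pow, mul_pow (t ^ 2), ← pow_mul, ← pow_mul, mul_comm N 2,
    mul_left_comm] at h
  have h1 := mul_left_cancel₀ (pow_ne_zero (2 * N) t_ne_zero) h
  have h2 := congrArg red h1
  simp only [map_lucasV, map_mul, map_pow, map_add, map_sub, red_t, red_X, cellA, red_C, zero_mul,
    mul_zero, add_zero, zero_pow hN, sub_zero, zero_pow two_ne_zero, zero_add, map_one,
    lucasV_zero_right _ N hN] at h2
  have h3 := eq_zero_of_pow_eq_zero h2
  have h4 := eq_zero_of_pow_eq_zero h3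
  have h5 : (PowerSeries.C s : R) ≠ 0 := by
    rwa [Ne, map_eq_zero_iff _ PowerSeries.C_injective]
  exact mul_ne_zero (pow_ne_zero 3 h5) (pow_ne_zero 2 PowerSeries.X_ne_zero) h4

theorem cell_mem {s : ℂ} {N : ℕ} (hN : N ≠ 0) (hs : s ^ N = 1) (hs3 : s ^ 3 ≠ 1) {A B : S}
    (h : ι (phiY (cellA s A)) * x * y + ι (phiY (cellB s B)) =
      algebraMap ℂ L s * (ι (phiX (cellA s A)) + ι (phiX (cellB s B)) * y))
    (h' : ι (phiX (cellA s A)) * y * x + ι (phiX (cellB s B)) =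
      algebraMap ℂ L s * (ι (phiY (cellA s A)) + ι (phiY (cellB s B)) * x)) :
    ι (phiX A) ∈ Ealg ∧ ι (phiX B) ∈ Ealg := by
  have hs0 : s ≠ 0 := by
    rintro rfl
    rw [zero_pow hN] at hs
    exact zero_ne_one hs
  have hx := x_ne_zero
  have hy := y_ne_zero
  have hinv := cellf_invariant h h'
  set rs := cellRoots hs h h' with hrs
  have hne := cell_lucas_ne hN hs0 A B
  obtain ⟨m, P, T, hm, hP, hT, hm', hP', hT', hpell⟩ := rs.exists_polynomials hinv rfl
  have hm1 : m.coeff 1 = algebraMap ℂ K (s ^ 3) := by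
    have h1 := constantCoeff_eq_of_evJ (q := 1) hm hm'
    apply mul_left_cancel₀ (neg_ne_zero.2 (pow_ne_zero 2 τ_ne_zero))
    rw [pow_one] at h1
    rw [← h1, IsScalarTower.algebraMap_apply ℂ R K, τ, ← map_pow, ← map_neg, ← map_mul]
    congr 1
    simp [cellf, cellA, cellB, constantCoeff_t]
    ring
  have hm1' : m.coeff 1 ≠ 0 := by
    rw [hm1, Ne, map_eq_zero_iff _ (algebraMap ℂ K).injective]
    exact pow_ne_zero 3 hs0
  have hd : m.natDegree = 1 := le_antisymm hm (le_natDegree_of_ne_zero hm1')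
  have hirr : Irreducible m := irreducible_of_degree_eq_one
    ((degree_eq_iff_natDegree_eq_of_pos one_pos).2 hd)
  have hlead : m.leadingCoeff ∈ F₀ := by
    rw [leadingCoeff, hd, hm1]
    exact F₀.algebraMap_mem _
  have hT0 : T ≠ 0 := by
    rintro rfl
    apply hne
    apply phiX_injective
    apply ι_injective
    have h0 : P ^ 2 - 4 * m ^ (3 * N) = 0 := by
      have : Δ * (P ^ 2 - 4 * m ^ (3 * N)) = 0 := by rw [← hpell]; ring
      exact (mul_eq_zero.1 this).resolve_left Δ_ne_zero
    have h0' := congrArg evJ h0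
    simp only [map_sub, map_mul, map_pow, map_ofNat, map_zero] at h0' hm' hP' ⊢
    rw [hP', hm', ← pow_mul]
    linear_combination (x ^ (3 * N)) ^ 2 * h0'
  have hmP : ∀ D : Derivation F₀ K K, D.coeffwise m = 0 ∧ D.coeffwise P = 0 := fun D => by
    refine coeffwise_eq_zero_of_pell D hpell hirr hlead hT0 ?_ ?_
    · rw [hd]; omega
    · rw [hd]; omega
  have hfm : ι (phiX (cellf (cellA s A) (cellB s B) ^ 3)) ∈ Ealg := by
    rw [map_pow, map_pow, hm']
    exact pow_mem (mul_mem (pow_mem x_mem _) (evJ_mem fun D => (hmP D).1)) 3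
  have hVm := mul_mem (pow_mem x_mem (3 * N)) (evJ_mem fun D => (hmP D).2)
  rw [← hP'] at hVm
  obtain ⟨hr, hr'⟩ := rs.mem_Ealg hN hVm hfm
  have ht0 := ι_t_ne_zero
  set α := ι (phiX (cellA s A)) with hα
  set β := ι (phiX (cellB s B)) with hβ
  have hz : α / (x * y) + β / x ∈ Ealg := by
    refine mem_Ealg_of_pow three_ne_zero ?_
    have h1 : (α / (x * y) + β / x) ^ 3 = rs.r / (ι t ^ 3 * x ^ 3 * (x ^ 2 * y)) := by
      simp only [hrs, cellRoots]
      field_simp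
      rw [hα, hβ]
    rw [h1]
    exact div_mem hr (mul_mem (mul_mem (pow_mem ι_t_mem 3) (pow_mem x_mem 3))
      (mul_mem (pow_mem x_mem 2) y_mem))
  have hy' : α * y + β / x ∈ Ealg := by
    refine mem_Ealg_of_pow three_ne_zero ?_
    have h1 : (α * y + β / x) ^ 3 = rs.r' / (ι t ^ 3 * x ^ 3 * (x / y)) := by
      simp only [hrs, cellRoots]
      field_simp
      rw [hα, hβ]
      ring
    rw [h1]
    exact div_mem hr' (mul_mem (mul_mem (pow_mem ι_t_mem 3) (pow_mem x_mem 3))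
      (div_mem x_mem y_mem))
  have hαm : α ∈ Ealg := by
    have h1 : α = ((α / (x * y) + β / x) - (α * y + β / x)) / (1 / (x * y) - y) := by
      rw [eq_div_iff xy_sq_ne_one]; ring
    rw [h1]
    exact div_mem (sub_mem hz hy') (sub_mem (div_mem (one_mem _) (mul_mem x_mem y_mem)) y_mem)
  have hβm : β ∈ Ealg := by
    have h1 : β = ((α * y + β / x) - α * y) * x := by field_simp; ring
    rw [h1]
    exact mul_mem (sub_mem hy' (mul_mem hαm y_mem)) x_mem
  have hσ : 1 - algebraMap ℂ L s ^ 3 ≠ 0 := by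
    rw [sub_ne_zero, ← map_pow, ← map_one (algebraMap ℂ L), Ne, (algebraMap ℂ L).injective.eq_iff]
    exact hs3.symm
  have hσ0 : algebraMap ℂ L s ≠ 0 := by
    rwa [Ne, map_eq_zero_iff _ (algebraMap ℂ L).injective]
  have hσm := algebraMap_complex_mem s
  have hσm' := sub_mem (one_mem Ealg) (pow_mem hσm 3)
  have hσC : ι (phiX (PowerSeries.C (PowerSeries.C s))) = algebraMap ℂ L s := by
    rw [phiX_C, exists_algebraMap_eq]
  simp only [cellA, cellB, map_add, map_sub, map_mul, map_pow, map_neg, map_one, hσC, phiX_t,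
    ι_phiX_X] at hα hβ
  set σ := algebraMap ℂ L s
  constructor
  · have h1 : ι (phiX A) = (α - σ) / ((1 - σ ^ 3) * ι t * x) := by
      rw [hα]; field_simp; ring
    rw [h1]
    exact div_mem (sub_mem hαm hσm) (mul_mem (mul_mem hσm' ι_t_mem) x_mem)
  · have h1 : ι (phiX B) = (σ ^ 3 * x + σ ^ 2 - β) / ((1 - σ ^ 3) * σ * ι t * x) := by
      rw [hβ]; field_simp; ring
    rw [h1]
    exact div_mem (sub_mem (add_mem (mul_mem (pow_mem hσm 3) x_mem) (pow_mem hσm 2)) hβm)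
      (mul_mem (mul_mem (mul_mem hσm' hσm) ι_t_mem) x_mem)

/-- The linear coefficient of the decoupled function, vertex-centred case. -/
def vertA (s : ℂ) (A : S) : S :=
  (1 - PowerSeries.C (PowerSeries.C s) ^ 3) * t * PowerSeries.X ^ 2 * A +
    (PowerSeries.C (PowerSeries.C s) - PowerSeries.C (PowerSeries.C s) ^ 2)

/-- The constant coefficient of the decoupled function, vertex-centred case. -/
def vertB (s : ℂ) (κ : R) (B : S) : S :=
  -((1 - PowerSeries.C (PowerSeries.C s) ^ 3) * t ^ 2 * PowerSeries.X ^ 2 *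
    (PowerSeries.C (PowerSeries.C s) * B + PowerSeries.C κ)) +
    PowerSeries.C (PowerSeries.C s) ^ 3 * t * PowerSeries.X ^ 3 +
    PowerSeries.C (PowerSeries.C s) ^ 2 * (PowerSeries.X - t)

/-- The product of the two conjugates of `a y + b`, vertex-centred normalisation. -/
def vertf (a b : S) : S :=
  t ^ 2 * PowerSeries.X ^ 3 * a ^ 2 + a * b * (PowerSeries.X - t) + b ^ 2

/-- The sum of the two conjugates of `a y + b`, vertex-centred normalisation. -/
def vertF (a b : S) : S := a * (PowerSeries.X - t) + 2 * b

section VertIdentities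

variable {k : Type*} [Field k] {τ u v α β α' β' s : k}

theorem vert_r_add (hv : v ≠ 0) (hk : τ * (u ^ 2 * v ^ 2 + u + v) = u * v) :
    (τ * u / v * α + β) + (τ * u ^ 2 * v * α + β) = α * (u - τ) + 2 * β := by
  field_simp
  linear_combination α * hk

theorem vert_r_mul (hv : v ≠ 0) (hk : τ * (u ^ 2 * v ^ 2 + u + v) = u * v) :
    (τ * u / v * α + β) * (τ * u ^ 2 * v * α + β) =
      τ ^ 2 * u ^ 3 * α ^ 2 + α * β * (u - τ) + β ^ 2 := by
  field_simp
  linear_combination α * β * hk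

theorem vert_r_sub (hv : v ≠ 0) :
    (τ * u / v * α + β) - (τ * u ^ 2 * v * α + β) = τ * u / v * (1 - u * v ^ 2) * α := by
  field_simp
  ring

theorem vert_r_pow {N : ℕ} (hs : s ^ N = 1) (hv : v ≠ 0)
    (h : α' * τ * u ^ 3 * v ^ 2 + β' * u ^ 2 = s * (τ * u * v * α + v ^ 2 * β)) :
    (τ * u / v * α + β) ^ N * v ^ (2 * N) = (τ * v ^ 2 * u * α' + β') ^ N * u ^ (2 * N) := by
  have h1 : (τ * v ^ 2 * u * α' + β') * u ^ 2 = s * ((τ * u / v * α + β) * v ^ 2) := by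
    field_simp
    linear_combination h
  rw [pow_mul u, pow_mul v, ← mul_pow, ← mul_pow, h1, mul_pow s, hs, one_mul]

end VertIdentities

/-- The root system attached to a function satisfying the vertex-centred relations. -/
def vertRoots {s : ℂ} {N : ℕ} (hs : s ^ N = 1) {a b : S}
    (h : ι (phiY a) * ι t * x ^ 3 * y ^ 2 + ι (phiY b) * x ^ 2 =
      algebraMap ℂ L s * (ι t * x * y * ι (phiX a) + y ^ 2 * ι (phiX b)))
    (h' : ι (phiX a) * ι t * y ^ 3 * x ^ 2 + ι (phiX b) * y ^ 2 =
      algebraMap ℂ L s * (ι t * y * x * ι (phiY a) + x ^ 2 * ι (phiY b))) :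
    RootSystem (vertF a b) a (vertf a b ^ 1) 2 N where
  r := ι t * x / y * ι (phiX a) + ι (phiX b)
  r' := ι t * x ^ 2 * y * ι (phiX a) + ι (phiX b)
  q := ι t * y / x * ι (phiY a) + ι (phiY b)
  q' := ι t * y ^ 2 * x * ι (phiY a) + ι (phiY b)
  r_add := by
    rw [vert_r_add y_ne_zero kernel_xy]
    simp only [vertF, map_add, map_sub, map_mul, map_ofNat, phiX_t, ι_phiX_X]
  r_mul := by
    rw [vert_r_mul y_ne_zero kernel_xy]
    simp only [vertf, map_add, map_sub, map_mul, map_pow, phiX_t, ι_phiX_X, pow_one]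
  r_sub := vert_r_sub y_ne_zero
  q_add := by
    rw [vert_r_add x_ne_zero kernel_yx]
    simp only [vertF, map_add, map_sub, map_mul, map_ofNat, phiY_t, ι_phiY_X]
  q_mul := by
    rw [vert_r_mul x_ne_zero kernel_yx]
    simp only [vertf, map_add, map_sub, map_mul, map_pow, phiY_t, ι_phiY_X, pow_one]
  q_sub := vert_r_sub x_ne_zero
  r_pow := vert_r_pow (by rw [← map_pow, hs, map_one]) y_ne_zero h
  r'_pow := (vert_r_pow (by rw [← map_pow, hs, map_one]) x_ne_zero h').symm

theorem vertf_invariant {s : ℂ} {a b : S}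
    (h : ι (phiY a) * ι t * x ^ 3 * y ^ 2 + ι (phiY b) * x ^ 2 =
      algebraMap ℂ L s * (ι t * x * y * ι (phiX a) + y ^ 2 * ι (phiX b)))
    (h' : ι (phiX a) * ι t * y ^ 3 * x ^ 2 + ι (phiX b) * y ^ 2 =
      algebraMap ℂ L s * (ι t * y * x * ι (phiY a) + x ^ 2 * ι (phiY b))) :
    phiX (vertf a b) * η ^ 4 = phiY (vertf a b) * ξ ^ 4 := by
  apply invariant_of_field
  have h1 := vert_r_mul (α := ι (phiX a)) (β := ι (phiX b)) y_ne_zero kernel_xy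
  have h2 := vert_r_mul (α := ι (phiY a)) (β := ι (phiY b)) x_ne_zero kernel_yx
  simp only [vertf, map_add, map_sub, map_mul, map_pow, phiX_t, ι_phiX_X, phiY_t,
    ι_phiY_X]
  rw [← h1, ← h2]
  have hx := x_ne_zero
  have hy := y_ne_zero
  have e1 : (ι t * y ^ 2 * x * ι (phiY a) + ι (phiY b)) * x ^ 2 =
      algebraMap ℂ L s * ((ι t * x / y * ι (phiX a) + ι (phiX b)) * y ^ 2) := by
    field_simp
    linear_combination h
  have e2 : (ι t * x ^ 2 * y * ι (phiX a) + ι (phiX b)) * y ^ 2 =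
      algebraMap ℂ L s * ((ι t * y / x * ι (phiY a) + ι (phiY b)) * x ^ 2) := by
    field_simp
    linear_combination h'
  linear_combination (ι t * x / y * ι (phiX a) + ι (phiX b)) * y ^ 2 * e2 -
    (ι t * y / x * ι (phiY a) + ι (phiY b)) * x ^ 2 * e1

/-- Low order coefficients determine the coefficients of a quadratic polynomial in the
basic invariant. -/
theorem coeff_eq_of_evJ {f g : S} {p₀ p₁ p₂ p₃ p₄ : R} {m : K[X]} (hm : m.natDegree ≤ 2)
    (h : ι (phiX f) = x ^ 4 * evJ m)
    (hf : f = PowerSeries.C p₀ + PowerSeries.C p₁ * PowerSeries.X +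
      PowerSeries.C p₂ * PowerSeries.X ^ 2 + PowerSeries.C p₃ * PowerSeries.X ^ 3 +
      PowerSeries.C p₄ * PowerSeries.X ^ 4 + PowerSeries.X ^ 5 * g) :
    algebraMap R K p₀ = τ ^ 4 * m.coeff 2 ∧
      algebraMap R K p₂ = τ ^ 2 * (m.coeff 2 - m.coeff 1) ∧
      algebraMap R K p₄ = 2 * τ ^ 3 * m.coeff 2 + m.coeff 0 := by
  obtain ⟨r, hr, m', hm'⟩ := exists_integer_polynomial m
  have hr' : algebraMap R K r ≠ 0 := by
    rwa [Ne, map_eq_zero_iff _ (IsFractionRing.injective R K)]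
  have hc : ∀ i, algebraMap R K (m'.coeff i) = algebraMap R K r * m.coeff i := fun i => by
    rw [← coeff_map, ← hm', coeff_C_mul]
  have hJ := x_sq_mul_J
  have hev : evJ m = ψ (m.coeff 0) + ψ (m.coeff 1) * J + ψ (m.coeff 2) * J ^ 2 := by
    rw [evJ, coe_eval₂RingHom, eval₂_eq_sum_range' _ (Nat.lt_succ_of_le hm)]
    simp [Finset.sum_range_succ]
  have hψ : ∀ i, ι (PowerSeries.C (m'.coeff i)) = ι (PowerSeries.C r) * ψ (m.coeff i) := fun i => by
    rw [← ψ_algebraMap, hc, map_mul, ψ_algebraMap]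
  have key : PowerSeries.C r * f = PowerSeries.C (m'.coeff 2) *
      (t * PowerSeries.X - t ^ 2 + t ^ 2 * PowerSeries.X ^ 3) ^ 2 +
      PowerSeries.C (m'.coeff 1) * PowerSeries.X ^ 2 *
      (t * PowerSeries.X - t ^ 2 + t ^ 2 * PowerSeries.X ^ 3) +
      PowerSeries.C (m'.coeff 0) * PowerSeries.X ^ 4 := by
    apply phiX_injective
    apply ι_injective
    simp only [map_add, map_sub, map_mul, map_pow, phiX_C, phiX_t, ι_phiX_X, hψ, h, hev]
    rw [← hJ]
    ring
  have hX : ∀ (c : R) (i j : ℕ), PowerSeries.coeff i (PowerSeries.C c * PowerSeries.X ^ j : S) =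
      if i = j then c else 0 := fun c i j => by
    rw [PowerSeries.coeff_C_mul, PowerSeries.coeff_X_pow]; simp
  have hg : ∀ i, i < 5 → PowerSeries.coeff i (PowerSeries.X ^ 5 * (PowerSeries.C r * g)) = 0 :=
    fun i hi => by rw [PowerSeries.coeff_X_pow_mul', if_neg (by omega)]
  have key2 : PowerSeries.C (r * p₀) * PowerSeries.X ^ 0 +
      PowerSeries.C (r * p₁) * PowerSeries.X ^ 1 +
      PowerSeries.C (r * p₂) * PowerSeries.X ^ 2 + PowerSeries.C (r * p₃) * PowerSeries.X ^ 3 +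
      PowerSeries.C (r * p₄) * PowerSeries.X ^ 4 + PowerSeries.X ^ 5 * (PowerSeries.C r * g) =
      PowerSeries.C (m'.coeff 2 * PowerSeries.X ^ 4) * PowerSeries.X ^ 0 +
      PowerSeries.C (-2 * PowerSeries.X ^ 3 * m'.coeff 2) * PowerSeries.X ^ 1 +
      PowerSeries.C (PowerSeries.X ^ 2 * (m'.coeff 2 - m'.coeff 1)) * PowerSeries.X ^ 2 +
      PowerSeries.C (-2 * PowerSeries.X ^ 4 * m'.coeff 2 + PowerSeries.X * m'.coeff 1) *
        PowerSeries.X ^ 3 +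
      PowerSeries.C (2 * PowerSeries.X ^ 3 * m'.coeff 2 + m'.coeff 0) * PowerSeries.X ^ 4 +
      PowerSeries.C (PowerSeries.X ^ 2 * m'.coeff 1) * PowerSeries.X ^ 5 +
      PowerSeries.C (PowerSeries.X ^ 4 * m'.coeff 2) * PowerSeries.X ^ 6 := by
    rw [hf, t] at key
    simp only [map_add, map_sub, map_mul, map_pow, map_neg, map_ofNat] at key ⊢
    linear_combination key
  have e0 := congrArg (PowerSeries.coeff 0) key2
  have e2 := congrArg (PowerSeries.coeff 2) key2
  have e4 := congrArg (PowerSeries.coeff 4) key2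
  simp only [map_add (PowerSeries.coeff _), hX, hg 0 (by norm_num), hg 2 (by norm_num),
    hg 4 (by norm_num)] at e0 e2 e4
  norm_num at e0 e2 e4
  have hτ : algebraMap R K PowerSeries.X = τ := rfl
  replace e0 := congrArg (algebraMap R K) e0
  replace e2 := congrArg (algebraMap R K) e2
  replace e4 := congrArg (algebraMap R K) e4
  simp only [map_add, map_sub, map_mul, map_pow, map_ofNat, hc, hτ] at e0 e2 e4
  refine ⟨mul_left_cancel₀ hr' ?_, mul_left_cancel₀ hr' ?_, mul_left_cancel₀ hr' ?_⟩
  · linear_combination e0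
  · linear_combination e2
  · linear_combination e4

theorem t_dvd_of_red_eq_zero {f : S} (h : red f = 0) : t ∣ f := by
  have h1 : ∀ n, ∃ c : R, PowerSeries.coeff n f = PowerSeries.X * c := fun n => by
    have h2 := congrArg (PowerSeries.coeff n) h
    rw [red, PowerSeries.coeff_map, map_zero] at h2
    exact PowerSeries.X_dvd_iff.2 h2
  choose c hc using h1
  refine ⟨PowerSeries.mk c, ?_⟩
  ext1 n
  rw [hc, t, PowerSeries.coeff_C_mul, PowerSeries.coeff_mk]

theorem red_wS : red wS = PowerSeries.X ^ 2 := by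
  simp only [wS, map_sub, map_mul, map_pow, red_t, red_X, sub_zero]
  ring

theorem constantCoeff_wS : PowerSeries.constantCoeff wS = PowerSeries.X ^ 2 := by
  simp [wS, constantCoeff_t]

theorem wS_ne_zero : wS ≠ 0 := by
  intro h
  have h1 := constantCoeff_wS
  rw [h, map_zero] at h1
  exact pow_ne_zero 2 PowerSeries.X_ne_zero h1.symm

theorem gS_ne_zero : gS ≠ 0 := by
  intro h
  have h1 := congrArg PowerSeries.constantCoeff h
  simp [gS, constantCoeff_t, PowerSeries.X_ne_zero, map_ofNat] at h1

theorem not_wS_dvd_C {r : R} (hr : r ≠ 0) : ¬ wS ∣ PowerSeries.C r := by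
  obtain ⟨n, r', hr', rfl⟩ : ∃ n, ∃ r' : R, ¬ PowerSeries.X ∣ r' ∧ r = PowerSeries.X ^ n * r' := by
    obtain ⟨r', h1, h2⟩ :=
      (FiniteMultiplicity.of_prime_left PowerSeries.X_prime hr).exists_eq_pow_mul_and_not_dvd
    exact ⟨_, r', h2, h1⟩
  clear hr
  induction n with
  | zero =>
    rintro ⟨g, hg⟩
    rw [pow_zero, one_mul] at hg
    have h1 := congrArg PowerSeries.constantCoeff hg
    rw [map_mul, constantCoeff_wS, PowerSeries.constantCoeff_C, pow_two, mul_assoc] at h1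
    exact hr' ⟨_, h1⟩
  | succ n ih =>
    rintro ⟨g, hg⟩
    apply ih
    have h1 := congrArg red hg
    have h2 : PowerSeries.C (PowerSeries.X ^ (n + 1) * r') =
        t * PowerSeries.C (PowerSeries.X ^ n * r') := by
      rw [t, ← map_mul]; congr 1; ring
    rw [h2, map_mul, red_t, zero_mul, map_mul, red_wS] at h1
    obtain ⟨g', rfl⟩ := t_dvd_of_red_eq_zero
      ((mul_eq_zero.1 h1.symm).resolve_left (pow_ne_zero 2 PowerSeries.X_ne_zero))
    refine ⟨g', mul_left_cancel₀ t_ne_zero ?_⟩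
    rw [← h2, hg]; ring

theorem not_wS_dvd {r : R} (hr : r ≠ 0) (n : ℕ) :
    ¬ wS ∣ PowerSeries.C r * PowerSeries.X ^ n := by
  rintro ⟨g, hg⟩
  have h1 : ¬ PowerSeries.X ∣ wS := by
    rw [PowerSeries.X_dvd_iff, constantCoeff_wS]
    exact pow_ne_zero 2 PowerSeries.X_ne_zero
  obtain ⟨g', rfl⟩ := PowerSeries.X_prime.pow_dvd_of_dvd_mul_left n h1 (b := g)
    ⟨_, by rw [← hg, mul_comm]⟩
  refine not_wS_dvd_C hr ⟨g', mul_left_cancel₀ (pow_ne_zero n PowerSeries.X_ne_zero) ?_⟩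
  rw [mul_comm, hg]; ring

theorem exists_clear_phiX (U : K[X]) : ∃ r : R, r ≠ 0 ∧ ∃ n, ∃ g : S,
    ι (PowerSeries.C r) * x ^ n * evJ U = ι (phiX g) := by
  obtain ⟨r, hr, U', hU'⟩ := exists_integer_polynomial U
  refine ⟨r, hr, 2 * U'.natDegree, ∑ i ∈ Finset.range (U'.natDegree + 1),
    PowerSeries.C (U'.coeff i) * basicInvariant (2 * U'.natDegree) i, ?_⟩
  have h1 := congrArg evJ hU'
  rw [map_mul, evJ_C, ψ_algebraMap, evJ, coe_eval₂RingHom, eval₂_map,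
    eval₂_eq_sum_range (p := U')] at h1
  rw [mul_right_comm, evJ, coe_eval₂RingHom, h1, map_sum, map_sum, Finset.sum_mul]
  refine Finset.sum_congr rfl fun i hi => ?_
  rw [Finset.mem_range] at hi
  rw [map_mul, map_mul, ι_phiX_basicInvariant (by omega), phiX_C, RingHom.comp_apply, ψ_algebraMap,
    ← x]
  ring

theorem isCoprime_of_not_dvd {k : Type*} [Field k] {m p : k[X]} (hm : Irreducible m)
    (h : ¬ m ∣ p) : IsCoprime m p :=
  hm.coprime_iff_not_dvd.2 h

theorem dvd_Δ {m : K[X]} (hm : Irreducible m) {f g : S} {c : ℂ} (hc : c ≠ 0) {n : ℕ}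
    (hf : ι (phiX f) = x ^ n * evJ m) (h : PowerSeries.C (PowerSeries.C c) * f = g * wS) :
    m ∣ Δ := by
  by_contra hd
  obtain ⟨U, V, hUV⟩ := isCoprime_of_not_dvd hm hd
  obtain ⟨r, hr, i, u, hu⟩ := exists_clear_phiX U
  obtain ⟨r', hr', j, v, hv⟩ := exists_clear_phiX V
  have hc' : (PowerSeries.C c : R) ≠ 0 := by
    rwa [Ne, map_eq_zero_iff _ PowerSeries.C_injective]
  have hΔ := x_pow_mul_evJ_Δ
  have h1 := congrArg evJ hUV
  have h2 := congrArg (fun z => ι (phiX z)) h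
  simp only [map_add, map_mul, map_one, map_pow, phiX_C] at h1 h2 hΔ
  rw [hf] at h2
  refine not_wS_dvd (mul_ne_zero (mul_ne_zero hr hr') hc') (i + j + n + 6)
    ⟨PowerSeries.C r' * PowerSeries.X ^ (j + 6) * u * g +
      PowerSeries.C (PowerSeries.C c) * PowerSeries.C r * PowerSeries.X ^ (i + n) * v *
        t ^ 2 * gS ^ 2, ?_⟩
  apply phiX_injective
  apply ι_injective
  simp only [map_add, map_mul, map_pow, phiX_C, ι_phiX_X, phiX_t, ← hu, ← hv]
  generalize ι (PowerSeries.C (PowerSeries.C c)) = c' at *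
  generalize ι (PowerSeries.C r) = ρ at *
  generalize ι (PowerSeries.C r') = ρ' at *
  linear_combination (-ρ * ρ' * c' * x ^ (i + j + n + 6)) * h1 +
    ρ * ρ' * x ^ (i + j + 6) * evJ U * h2 + ρ * ρ' * c' * x ^ (i + j + n) * evJ V * hΔ

theorem exists_complex_of_pow_eq_one {N : ℕ} (hN : N ≠ 0) {ω : L} (h : ω ^ N = 1) :
    ∃ c : ℂ, ω = algebraMap ℂ L c := by
  have h1 := X_pow_sub_one_eq_prod (Nat.pos_of_ne_zero hN) (Complex.isPrimitiveRoot_exp N hN)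
  have h2 := congrArg (aeval ω) h1
  simp only [map_sub, map_pow, aeval_X, map_one, h, sub_self, map_prod, aeval_C] at h2
  obtain ⟨c, -, hc⟩ := Finset.prod_eq_zero_iff.1 h2.symm
  exact ⟨c, sub_eq_zero.1 hc⟩

theorem RootSystem.exists_smul_eq {F c f : S} {e N : ℕ} (h : RootSystem F c (f ^ 1) e N)
    (hN : N ≠ 0) (hc : c ≠ 0) (hf : f ≠ 0) (hU : wS * gS * (c * lucasU F (f ^ 1) N) = 0) :
    ∃ κ : ℂ, κ ≠ 0 ∧ ∃ g : S, PowerSeries.C (PowerSeries.C κ) * f = g * wS := by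
  have h0 : lucasU F (f ^ 1) N = 0 :=
    (mul_eq_zero.1 ((mul_eq_zero.1 hU).resolve_left
      (mul_ne_zero wS_ne_zero gS_ne_zero))).resolve_left hc
  have h1 := lucasU_eq h.r_add h.r_mul N
  rw [← map_lucasU, ← map_lucasU, h0, map_zero, map_zero, mul_zero] at h1
  have hdiscr := h.discr
  rw [show f ^ 1 = f from pow_one f] at hdiscr
  have hQ : h.r * h.r' = ι (phiX f) := h.r_mul.trans (by rw [pow_one])
  have hF := h.r_add
  have hr' : h.r' ≠ 0 := by
    intro h2
    rw [h2, mul_zero] at hQ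
    exact hf (phiX_injective (ι_injective (by rw [← hQ, map_zero, map_zero])))
  obtain ⟨ω, hω⟩ := exists_complex_of_pow_eq_one hN (ω := h.r / h.r') (by
    rw [div_pow, div_eq_one_iff_eq (pow_ne_zero N hr')]
    exact (sub_eq_zero.1 h1.symm))
  rw [div_eq_iff hr', exists_algebraMap_eq] at hω
  have h3 : PowerSeries.C (PowerSeries.C ((ω - 1) ^ 2)) * f =
      PowerSeries.C (PowerSeries.C ω) * c ^ 2 * wS := by
    apply phiX_injective
    apply ι_injective
    have h4 := congrArg (fun z => ι (phiX z)) hdiscr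
    simp only [map_sub, map_mul, map_pow, map_one, map_ofNat, phiX_C, ← hQ, ← hF] at h4 ⊢
    generalize ι (PowerSeries.C (PowerSeries.C ω)) = w at *
    rw [hω] at h4 ⊢
    linear_combination w * h4
  refine ⟨(ω - 1) ^ 2, ?_, _, h3⟩
  intro h4
  have h5 : ω = 1 := sub_eq_zero.1 (eq_zero_of_pow_eq_zero h4)
  rw [h5] at h3
  simp [hc, wS_ne_zero] at h3

theorem coeffwise_eq_zero_of_dvd (D : Derivation F₀ K K) {m P : K[X]} {l : ℕ}
    (hm : Irreducible m) (hlead : m.leadingCoeff ∈ F₀) (hd : m ∣ Δ) (h : P ^ 2 = 4 * m ^ l) :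
    D.coeffwise m = 0 ∧ D.coeffwise P = 0 := by
  have hP : P ≠ 0 := by
    rintro rfl
    have h1 : (4 : K[X]) * m ^ l ≠ 0 := mul_ne_zero (by norm_num) (pow_ne_zero _ hm.ne_zero)
    rw [← h] at h1
    simp at h1
  obtain ⟨q, hq⟩ := hd.mul_left (C τ ^ 2)
  have hDm : D.coeffwise m = 0 := by
    by_contra hne
    have h1 := coeffwise_Δ D
    rw [hq, Derivation.leibniz, smul_eq_mul, smul_eq_mul] at h1
    have h2 : m ∣ q * D.coeffwise m := ⟨-D.coeffwise q, by linear_combination h1⟩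
    rcases hm.prime.dvd_or_dvd h2 with h3 | h3
    · refine hm.not_isUnit (squarefree_C_mul_Δ m ?_)
      rw [hq]
      exact mul_dvd_mul_left m h3
    · exact not_le_of_gt (D.degree_coeffwise_lt hm.ne_zero (D.map_algebraMap ⟨_, hlead⟩))
        (degree_le_of_dvd h3 hne)
  refine ⟨hDm, ?_⟩
  have h1 := congrArg D.coeffwise h
  rw [show (4 : K[X]) * m ^ l = (4 : ℕ) • m ^ l by simp, map_nsmul, Derivation.leibniz_pow,
    Derivation.leibniz_pow, hDm] at h1
  simpa [hP] using h1

/-- The quotient `x / y`, as a power series. -/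
def xdivy : S := ξ - 1 - t ^ 3 * ξ ^ 2 * η

/-- The quotient `y / x`, as a power series. -/
def ydivx : S := η - 1 - t ^ 3 * η ^ 2 * ξ

theorem η_mul_xdivy : η * xdivy = ξ := by
  rw [xdivy]
  linear_combination -η_eq

theorem ξ_mul_ydivx : ξ * ydivx = η := by
  rw [ydivx]
  linear_combination -η_eq

theorem xdivy_mul_ydivx : xdivy * ydivx = 1 := by
  apply mul_left_cancel₀ (mul_ne_zero ξ_ne_zero η_ne_zero)
  linear_combination ξ * ydivx * η_mul_xdivy + ξ * ξ_mul_ydivx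

theorem ι_xdivy : ι xdivy = x / y := by
  rw [eq_div_iff y_ne_zero, y, x, mul_comm (ι t), ← mul_assoc, mul_comm (ι xdivy), ← map_mul,
    η_mul_xdivy, mul_comm]

theorem ι_ydivx : ι ydivx = y / x := by
  rw [eq_div_iff x_ne_zero, y, x, mul_comm (ι t), ← mul_assoc, mul_comm (ι ydivx), ← map_mul,
    ξ_mul_ydivx, mul_comm]

theorem constantCoeff_ydivx : PowerSeries.constantCoeff ydivx = -1 := by
  simp [ydivx, constantCoeff_η]

theorem ξ_cube_dvd {s : ℂ} {κ : R} {A B : S} :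
    ξ ^ 3 ∣ (t * xdivy * phiX (vertA s A) + phiX (vertB s κ B)) -
      xdivy ^ 2 * (t * ydivx * phiY (vertA s A) + phiY (vertB s κ B)) := by
  have hA : ξ ∣ phiX A - ydivx ^ 2 * phiY A := by
    rw [ξ, PowerSeries.X_dvd_iff]
    simp [constantCoeff_phiX, constantCoeff_phiY, constantCoeff_ydivx]
  have hB : ξ ∣ phiX B - phiY B := by
    rw [ξ, PowerSeries.X_dvd_iff]
    simp [constantCoeff_phiX, constantCoeff_phiY]
  obtain ⟨a, ha⟩ := hA
  obtain ⟨b, hb⟩ := hB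
  refine ⟨(1 - PowerSeries.C (PowerSeries.C s) ^ 3) * t ^ 4 * (xdivy * a -
    PowerSeries.C (PowerSeries.C s) * b) + (1 - ydivx) * (PowerSeries.C (PowerSeries.C s) ^ 3 -
      PowerSeries.C (PowerSeries.C s) ^ 2) * t ^ 4, ?_⟩
  simp only [vertA, vertB, map_add, map_sub, map_neg, map_mul, map_pow, map_one, phiX_C, phiX_t,
    phiX_X, phiY_C, phiY_t, phiY_X]
  have h1 := η_mul_xdivy
  have h2 := xdivy_mul_ydivx
  have h3 := ξ_mul_ydivx
  have h4 : xdivy = ξ - 1 - t ^ 3 * ξ ^ 2 * η := rfl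
  generalize PowerSeries.C (PowerSeries.C s) = σ at *
  generalize (PowerSeries.C κ : S) = k at *
  generalize phiX A = A₁ at *
  generalize phiY A = A₂ at *
  generalize phiX B = B₁ at *
  generalize phiY B = B₂ at *
  generalize ydivx = v' at *
  generalize xdivy = v at *
  rw [← h3] at h4 ⊢
  generalize (ξ : S) = z at *
  linear_combination (-t * (σ - σ ^ 2) * v - (1 - σ ^ 3) * t ^ 4 * z ^ 2 * v' ^ 2 * A₂ * v +
    (1 - σ ^ 3) * t ^ 4 * z ^ 2 * (σ * B₂ + k) * (v * v' + 1) -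
    σ ^ 3 * t ^ 4 * z ^ 3 * v' * (v * v' + 1) - σ ^ 2 * t * z * v - σ ^ 2 * t ^ 4 * z ^ 3) * h2 +
    (1 - σ ^ 3) * t ^ 4 * z ^ 2 * (v * ha - σ * hb) + σ ^ 2 * t * (v - 1) * h4

theorem natDegree_le_of_vertRoots {s : ℂ} {N : ℕ} {κ : R} {A B : S}
    (h : RootSystem (vertF (vertA s A) (vertB s κ B)) (vertA s A)
      (vertf (vertA s A) (vertB s κ B) ^ 1) 2 N)
    (hr : h.r = ι t * x / y * ι (phiX (vertA s A)) + ι (phiX (vertB s κ B)))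
    (hq : h.q = ι t * y / x * ι (phiY (vertA s A)) + ι (phiY (vertB s κ B)))
    {T : K[X]} (hT0 : T ≠ 0)
    (hT : ι (phiX (wS * gS * (vertA s A * lucasU (vertF (vertA s A) (vertB s κ B))
      (vertf (vertA s A) (vertB s κ B) ^ 1) N))) = x ^ (2 * N + 3) * evJ T) :
    T.natDegree ≤ N := by
  obtain ⟨W, hW⟩ := (ξ_cube_dvd (s := s) (κ := κ) (A := A) (B := B)).trans
    (sub_dvd_pow_sub_pow _ _ N)
  have hr1 : h.r = ι (t * xdivy * phiX (vertA s A) + phiX (vertB s κ B)) := by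
    rw [hr, map_add, map_mul, map_mul, ι_xdivy, mul_div_assoc]
  have hq1 : h.q = ι (t * ydivx * phiY (vertA s A) + phiY (vertB s κ B)) := by
    rw [hq, map_add, map_mul, map_mul, ι_ydivx, mul_div_assoc]
  have hr' : h.r' ^ N =
      ι ((xdivy ^ 2 * (t * ydivx * phiY (vertA s A) + phiY (vertB s κ B))) ^ N) := by
    rw [map_pow, map_mul, ← hq1, map_pow, ι_xdivy, mul_pow, ← pow_mul, div_pow, div_mul_eq_mul_div,
      eq_div_iff (pow_ne_zero _ y_ne_zero), h.r'_pow, mul_comm]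
  have hx := x_ne_zero
  have hy := y_ne_zero
  rw [h.phiX_T, hr', hr1, ← map_pow, ← map_sub, hW] at hT
  have hz : ι (t ^ 2 * xdivy * (1 - t ^ 3 * ξ * η ^ 2) * (xdivy - 1) *
      (t ^ 3 * ξ ^ 2 * η - 1) * W) =
      ι ξ ^ (2 * N) * evJ (C (τ ^ (2 * N + 3)) * T) := by
    apply mul_left_cancel₀ (pow_ne_zero 3 ι_ξ_ne_zero)
    have h1 : ι ξ ^ 3 * (ι ξ ^ (2 * N) * evJ (C (τ ^ (2 * N + 3)) * T)) =
        x ^ (2 * N + 3) * evJ T := by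
      rw [map_mul, evJ_C, map_pow, ψ_τ, x]; ring
    have h2 : x * y ^ 2 = ι (t ^ 3 * ξ * η ^ 2) := by
      simp only [map_mul, map_pow, x, y]; ring
    have h3 : x ^ 2 * y = ι (t ^ 3 * ξ ^ 2 * η) := by
      simp only [map_mul, map_pow, x, y]; ring
    rw [h1, ← hT]
    simp only [map_mul, map_sub, map_one, map_pow, ι_xdivy] at h2 h3 ⊢
    rw [← h2, ← h3]
    field_simp
  have hC : (C (τ ^ (2 * N + 3)) : K[X]) ≠ 0 := C_ne_zero.2 (pow_ne_zero _ τ_ne_zero)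
  have := two_mul_natDegree_le (mul_ne_zero hC hT0) hz
  rw [natDegree_mul hC hT0, natDegree_C] at this
  omega

theorem vertf_expand {k : Type*} [CommRing k] (X T a₀ a₂ a₃ a₄ a₅ b₀ b₁ b₂ b₃ b₄ b₅ : k) {a b : k}
    (ha : a = a₀ + a₂ * X ^ 2 + a₃ * X ^ 3 + a₄ * X ^ 4 + X ^ 5 * a₅)
    (hb : b = b₀ + b₁ * X + b₂ * X ^ 2 + b₃ * X ^ 3 + b₄ * X ^ 4 + X ^ 5 * b₅) :
    ∃ g, T ^ 2 * X ^ 3 * a ^ 2 + a * b * (X - T) + b ^ 2 =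
      (b₀ ^ 2 - T * (a₀ * b₀)) + (a₀ * b₀ - T * (a₀ * b₁) + 2 * b₀ * b₁) * X +
      (a₀ * b₁ - T * (a₀ * b₂ + a₂ * b₀) + (2 * b₀ * b₂ + b₁ ^ 2)) * X ^ 2 +
      (a₀ * b₂ + a₂ * b₀ - T * (a₀ * b₃ + a₂ * b₁ + a₃ * b₀) + (2 * b₀ * b₃ + 2 * b₁ * b₂) +
        T ^ 2 * a₀ ^ 2) * X ^ 3 +
      (a₀ * b₃ + a₂ * b₁ + a₃ * b₀ - T * (a₀ * b₄ + a₂ * b₂ + a₃ * b₁ + a₄ * b₀) +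
        (2 * b₀ * b₄ + 2 * b₁ * b₃ + b₂ ^ 2)) * X ^ 4 + X ^ 5 * g := by
  let u := a₂ + a₃ * X + a₄ * X ^ 2 + a₅ * X ^ 3
  let w := a₅ * b + (a - X ^ 5 * a₅) * b₅ + (a₂ * b₃ + a₃ * b₂ + a₄ * b₁ +
    X * (a₂ * b₄ + a₃ * b₃ + a₄ * b₂) + X ^ 2 * (a₃ * b₄ + a₄ * b₃) + X ^ 3 * a₄ * b₄)
  refine ⟨T ^ 2 * (2 * a₀ * u + X ^ 2 * u ^ 2) +
    (a₀ * b₄ + a₂ * b₂ + a₃ * b₁ + a₄ * b₀ + w * (X - T)) +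
    ((b + b - X ^ 5 * b₅) * b₅ + (2 * b₁ * b₄ + 2 * b₂ * b₃ + X * (2 * b₂ * b₄ + b₃ ^ 2) +
      X ^ 2 * (2 * b₃ * b₄) + X ^ 3 * b₄ ^ 2)), ?_⟩
  simp only [w, u, ha, hb]
  ring

theorem exists_expand (f : S) : ∃ f₁ f₂ : R, ∃ g : S,
    f = PowerSeries.C (PowerSeries.constantCoeff f) + PowerSeries.C f₁ * PowerSeries.X +
      PowerSeries.C f₂ * PowerSeries.X ^ 2 + PowerSeries.X ^ 3 * g := by
  have h : ∀ h : S, ∃ g, h = PowerSeries.X * g + PowerSeries.C (PowerSeries.constantCoeff h) :=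
    fun h => ⟨_, PowerSeries.eq_X_mul_shift_add_const h⟩
  obtain ⟨g, hg⟩ := h f
  obtain ⟨g', hg'⟩ := h g
  obtain ⟨k, hk⟩ := h g'
  refine ⟨PowerSeries.constantCoeff g, PowerSeries.constantCoeff g', k, ?_⟩
  linear_combination hg + PowerSeries.X * hg' + PowerSeries.X ^ 2 * hk

/-- A quadratic polynomial whose discriminant has a simple zero at `t = 0` is irreducible. -/
theorem irreducible_of_discr {m : K[X]} (hm : m.natDegree ≤ 2) (hm2 : m.coeff 2 ≠ 0) {w : R}
    (hw : PowerSeries.constantCoeff w ≠ 0)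
    (h : τ ^ 2 * (m.coeff 1 ^ 2 - 4 * m.coeff 2 * m.coeff 0) =
      algebraMap R K (PowerSeries.X * w)) : Irreducible m := by
  have hd : m.natDegree = 2 := le_antisymm hm (le_natDegree_of_ne_zero hm2)
  rw [irreducible_iff_roots_eq_zero_of_degree_le_three hd.ge (by omega),
    Multiset.eq_zero_iff_forall_notMem]
  intro z hz
  have h1 : m.eval z = 0 := (mem_roots'.1 hz).2
  rw [eval_eq_sum_range' (Nat.lt_succ_of_le hm)] at h1
  simp only [Finset.sum_range_succ, Finset.sum_range_zero] at h1
  have h2 : (τ * (2 * m.coeff 2 * z + m.coeff 1)) ^ 2 = algebraMap R K (PowerSeries.X * w) := by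
    rw [← h]
    linear_combination 4 * τ ^ 2 * m.coeff 2 * h1
  obtain ⟨u, hu⟩ := IsIntegrallyClosed.exists_algebraMap_eq_of_isIntegral_pow (R := R) (K := K)
    two_pos (by rw [h2]; exact isIntegral_algebraMap)
  rw [← hu, ← map_pow, (IsFractionRing.injective R K).eq_iff] at h2
  obtain ⟨u', rfl⟩ := PowerSeries.X_prime.dvd_of_dvd_pow (Dvd.intro _ h2.symm)
  have h3 : PowerSeries.X * u' ^ 2 = w :=
    mul_left_cancel₀ PowerSeries.X_ne_zero (by rw [← h2]; ring)
  simp [← h3] at hw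

theorem vert_coeffs {s c : ℂ} (hc : c * (1 - s) = s ^ 2) {B₀ : R} {A B : S}
    (hB₀ : PowerSeries.constantCoeff B₀ = 1) (hA : PowerSeries.constantCoeff A = B₀)
    (hB : PowerSeries.constantCoeff B = B₀) {m : K[X]} (hm : m.natDegree ≤ 2)
    (h : ι (phiX (vertf (vertA s A) (vertB s (PowerSeries.C c * B₀) B))) = x ^ 4 * evJ m) :
    τ ^ 2 * m.coeff 2 = algebraMap ℂ K (s ^ 3) ∧
      m.coeff 1 = algebraMap ℂ K (-2 * (1 - s ^ 3) * c) * τ * algebraMap R K B₀ ∧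
      ∃ e : R, PowerSeries.constantCoeff e = s ^ 2 * (1 - s) ^ 2 ∧
        m.coeff 0 = τ * algebraMap R K e := by
  obtain ⟨A₁, A₂, A₃, hA'⟩ := exists_expand A
  obtain ⟨B₁, B₂, B₃, hB'⟩ := exists_expand B
  rw [hA] at hA'
  rw [hB] at hB'
  set z : R := PowerSeries.C s with hz
  set T : R := PowerSeries.X with hT
  have hcz : PowerSeries.C c * (1 - z) = z ^ 2 := by
    rw [hz, ← map_one PowerSeries.C, ← map_sub, ← map_mul, hc, map_pow]
  have ha : vertA s A = PowerSeries.C (z - z ^ 2) +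
      PowerSeries.C ((1 - z ^ 3) * T * B₀) * PowerSeries.X ^ 2 +
      PowerSeries.C ((1 - z ^ 3) * T * A₁) * PowerSeries.X ^ 3 +
      PowerSeries.C ((1 - z ^ 3) * T * A₂) * PowerSeries.X ^ 4 +
      PowerSeries.X ^ 5 * (PowerSeries.C ((1 - z ^ 3) * T) * A₃) := by
    rw [vertA, hA', t, ← hz, ← hT]
    simp only [map_sub, map_mul, map_pow, map_one]
    ring
  have hb : vertB s (PowerSeries.C c * B₀) B = PowerSeries.C (-z ^ 2 * T) +
      PowerSeries.C (z ^ 2) * PowerSeries.X +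
      PowerSeries.C (-(1 - z ^ 3) * T ^ 2 * (z + PowerSeries.C c) * B₀) * PowerSeries.X ^ 2 +
      PowerSeries.C (-(1 - z ^ 3) * T ^ 2 * z * B₁ + z ^ 3 * T) * PowerSeries.X ^ 3 +
      PowerSeries.C (-(1 - z ^ 3) * T ^ 2 * z * B₂) * PowerSeries.X ^ 4 +
      PowerSeries.X ^ 5 * (PowerSeries.C (-(1 - z ^ 3) * T ^ 2 * z) * B₃) := by
    rw [vertB, hB', t, ← hz, ← hT]
    simp only [map_sub, map_mul, map_pow, map_one, map_add, map_neg]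
    ring
  obtain ⟨g, hg⟩ := vertf_expand PowerSeries.X t _ _ _ _ _ _ _ _ _ _ _ ha hb
  rw [← vertf, t, ← hT] at hg
  simp only [← map_add, ← map_sub, ← map_mul, ← map_pow,
    ← map_ofNat (PowerSeries.C (R := R)) 2] at hg
  obtain ⟨h0, h2, h4⟩ := coeff_eq_of_evJ hm h hg
  have hτ := τ_ne_zero
  have hs3 : algebraMap R K (z ^ 3) = algebraMap ℂ K (s ^ 3) := by
    rw [IsScalarTower.algebraMap_apply ℂ R K, hz, ← map_pow]
    rfl
  have hτT : algebraMap R K T = τ := rfl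
  have h0' : algebraMap R K (T ^ 2 * z ^ 3) = τ ^ 4 * m.coeff 2 := by
    rw [← h0]; congr 1; ring
  rw [map_mul, hs3, map_pow, hτT] at h0'
  have e2 : τ ^ 2 * m.coeff 2 = algebraMap ℂ K (s ^ 3) := by
    apply mul_left_cancel₀ (pow_ne_zero 2 hτ)
    linear_combination -h0'
  refine ⟨e2, ?_, (z - z ^ 2) * (-(1 - z ^ 3) * T * z * B₁ + z ^ 3) + (1 - z ^ 3) * B₀ * z ^ 2 +
    (1 - z ^ 3) * A₁ * (-z ^ 2 * T) - ((z - z ^ 2) * (-(1 - z ^ 3) * T ^ 2 * z * B₂) +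
      (1 - z ^ 3) * T * B₀ * (-(1 - z ^ 3) * T ^ 2 * (z + PowerSeries.C c) * B₀) +
      (1 - z ^ 3) * T * A₁ * z ^ 2 + (1 - z ^ 3) * T * A₂ * (-z ^ 2 * T)) +
    (2 * -z ^ 2 * (-(1 - z ^ 3) * T ^ 2 * z * B₂) +
      2 * z ^ 2 * (-(1 - z ^ 3) * T * z * B₁ + z ^ 3) +
      T ^ 3 * ((1 - z ^ 3) * (z + PowerSeries.C c) * B₀) ^ 2) - 2 * z ^ 3, ?_, ?_⟩
  · have h2' : algebraMap R K (z ^ 3 + T ^ 3 * (2 * (1 - z ^ 3) * PowerSeries.C c) * B₀) =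
        τ ^ 2 * (m.coeff 2 - m.coeff 1) := by
      rw [← h2]; congr 1
      linear_combination T ^ 3 * B₀ * (1 - z ^ 3) * (z + 2) * hcz
    have h5 : algebraMap R K (2 * (1 - z ^ 3) * PowerSeries.C c) =
        algebraMap ℂ K (2 * (1 - s ^ 3) * c) := by
      rw [IsScalarTower.algebraMap_apply ℂ R K, hz, ← map_pow, ← map_one (PowerSeries.C (R := ℂ)),
        ← map_ofNat (PowerSeries.C (R := ℂ)) 2, ← map_sub, ← map_mul, ← map_mul]
      rfl
    rw [map_add, map_mul, map_mul, h5, map_pow _ T, hτT, hs3] at h2'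
    apply mul_left_cancel₀ (pow_ne_zero 2 hτ)
    have h6 : algebraMap ℂ K (-2 * (1 - s ^ 3) * c) = -algebraMap ℂ K (2 * (1 - s ^ 3) * c) := by
      rw [← map_neg]; congr 1; ring
    rw [h6]
    linear_combination e2 + h2'
  · have hT0 : PowerSeries.constantCoeff T = 0 := PowerSeries.constantCoeff_X
    have hz0 : PowerSeries.constantCoeff z = s := PowerSeries.constantCoeff_C s
    simp only [map_sub, map_add, map_mul, map_pow, map_neg, map_one, map_ofNat, hT0, hz0, hB₀]
    ring
  · have h5 : m.coeff 0 = algebraMap R K (_ - 2 * T * z ^ 3) :=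
      (eq_sub_of_add_eq' h4.symm).trans (by
        rw [map_sub]; congr 1
        rw [map_mul, hs3, map_mul, hτT, map_ofNat]
        linear_combination 2 * τ * e2)
    rw [h5, ← hτT, ← map_mul]
    congr 1
    ring

theorem vertf_ne_zero {s : ℂ} (hs0 : s ≠ 0) (κ : R) (A B : S) :
    vertf (vertA s A) (vertB s κ B) ≠ 0 := by
  intro h
  have h1 := congrArg PowerSeries.constantCoeff h
  have h2 : (PowerSeries.C s : R) ^ 3 * PowerSeries.X ^ 2 = 0 := by
    rw [map_zero] at h1
    rw [← h1]
    simp [vertf, vertA, vertB, constantCoeff_t]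
    ring
  rw [mul_eq_zero] at h2
  rcases h2 with h2 | h2
  · have h3 := (map_eq_zero_iff _ PowerSeries.C_injective).1
      (pow_eq_zero_iff (by norm_num) |>.1 h2)
    exact hs0 (by simpa using h3)
  · exact pow_ne_zero 2 PowerSeries.X_ne_zero h2

theorem vertA_ne_zero {s : ℂ} (hs0 : s ≠ 0) (hs1 : s ≠ 1) (A : S) : vertA s A ≠ 0 := by
  intro h
  have h1 := congrArg (fun z => PowerSeries.constantCoeff (PowerSeries.constantCoeff z)) h
  simp only [vertA, map_add, map_sub, map_mul, map_pow, PowerSeries.constantCoeff_X,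
    PowerSeries.constantCoeff_C, map_zero] at h1
  have h2 : s * (1 - s) = 0 := by linear_combination h1
  rcases mul_eq_zero.1 h2 with h3 | h3
  · exact hs0 h3
  · exact hs1 (sub_eq_zero.1 h3).symm

theorem vert_mem {s c : ℂ} {N : ℕ} (hN : N ≠ 0) (hs : s ^ N = 1) (hs3 : s ^ 3 ≠ 1)
    (hc : c * (1 - s) = s ^ 2) {B₀ : R} {A B : S}
    (hB₀ : PowerSeries.constantCoeff B₀ = 1) (hA : PowerSeries.constantCoeff A = B₀)
    (hB : PowerSeries.constantCoeff B = B₀)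
    (h : ι (phiY (vertA s A)) * ι t * x ^ 3 * y ^ 2 +
        ι (phiY (vertB s (PowerSeries.C c * B₀) B)) * x ^ 2 =
      algebraMap ℂ L s * (ι t * x * y * ι (phiX (vertA s A)) +
        y ^ 2 * ι (phiX (vertB s (PowerSeries.C c * B₀) B))))
    (h' : ι (phiX (vertA s A)) * ι t * y ^ 3 * x ^ 2 +
        ι (phiX (vertB s (PowerSeries.C c * B₀) B)) * y ^ 2 =
      algebraMap ℂ L s * (ι t * y * x * ι (phiY (vertA s A)) +
        x ^ 2 * ι (phiY (vertB s (PowerSeries.C c * B₀) B)))) :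
    ι (phiX A) ∈ Ealg ∧ ι (phiX B) ∈ Ealg ∧ ι (PowerSeries.C B₀) ∈ Ealg := by
  have hs0 : s ≠ 0 := by
    rintro rfl
    rw [zero_pow hN] at hs
    exact zero_ne_one hs
  have hs1 : s ≠ 1 := by
    rintro rfl
    exact hs3 (one_pow 3)
  have hc0 : c ≠ 0 := by
    rintro rfl
    rw [zero_mul] at hc
    exact pow_ne_zero 2 hs0 hc.symm
  have hx := x_ne_zero
  have hy := y_ne_zero
  have hτ := τ_ne_zero
  have hinv := vertf_invariant h h'
  set rs := vertRoots hs h h' with hrs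
  obtain ⟨m, P, T, hm, hP, -, hm', hP', hT', hpell⟩ := rs.exists_polynomials hinv rfl
  replace hm : m.natDegree ≤ 2 := hm
  rw [one_mul] at hpell
  obtain ⟨hm2, hm1, e, he, hm0⟩ := vert_coeffs hc hB₀ hA hB hm hm'
  have hm2' : m.coeff 2 ≠ 0 := by
    intro h0
    rw [h0, mul_zero, eq_comm, map_eq_zero_iff _ (algebraMap ℂ K).injective] at hm2
    exact pow_ne_zero 3 hs0 hm2
  have hd : m.natDegree = 2 := le_antisymm hm (le_natDegree_of_ne_zero hm2')
  have hirr : Irreducible m := by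
    refine irreducible_of_discr hm hm2' (w := PowerSeries.X ^ 3 *
      (PowerSeries.C (-2 * (1 - s ^ 3) * c) * B₀) ^ 2 - 4 * PowerSeries.C (s ^ 3) * e) ?_ ?_
    · simp only [map_sub, map_mul, map_pow, map_ofNat, PowerSeries.constantCoeff_X, he,
        PowerSeries.constantCoeff_C]
      rw [zero_pow (by norm_num), zero_mul, zero_sub, neg_ne_zero]
      have : 1 - s ≠ 0 := sub_ne_zero.2 hs1.symm
      exact mul_ne_zero (mul_ne_zero (by norm_num) (pow_ne_zero 3 hs0))
        (mul_ne_zero (pow_ne_zero 2 hs0) (pow_ne_zero 2 this))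
    · have hC : ∀ a : ℂ, algebraMap R K (PowerSeries.C a) = algebraMap ℂ K a := fun a =>
        (IsScalarTower.algebraMap_apply ℂ R K a).symm
      have hX : algebraMap R K PowerSeries.X = τ := rfl
      rw [hm1, hm0]
      simp only [map_sub, map_mul (algebraMap R K), map_pow (algebraMap R K),
        map_ofNat (algebraMap R K), hC, hX]
      linear_combination (-4 * τ * algebraMap R K e) * hm2
  have hlead : m.leadingCoeff ∈ F₀ := by
    have h1 : m.coeff 2 = algebraMap ℂ K (s ^ 3) / τ ^ 2 := by
      rw [← hm2]; field_simp
    rw [leadingCoeff, hd, h1]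
    exact div_mem (F₀.algebraMap_mem _)
      (pow_mem (IntermediateField.mem_adjoin_simple_self ℂ τ) 2)
  have hmP : ∀ D : Derivation F₀ K K, D.coeffwise m = 0 ∧ D.coeffwise P = 0 := fun D => by
    by_cases hT0 : T = 0
    · rw [hT0, map_zero, mul_zero] at hT'
      have hU := phiX_injective (ι_injective (hT'.trans (by rw [map_zero, map_zero])))
      obtain ⟨κ, hκ, g, hg⟩ := rs.exists_smul_eq hN (vertA_ne_zero hs0 hs1 A)
        (vertf_ne_zero hs0 _ A B) hU
      refine coeffwise_eq_zero_of_dvd D hirr hlead (dvd_Δ hirr hκ hm' hg) (l := N) ?_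
      rw [hT0] at hpell
      have : Δ * (P ^ 2 - 4 * m ^ N) = 0 := by rw [← hpell]; ring
      exact sub_eq_zero.1 ((mul_eq_zero.1 this).resolve_left Δ_ne_zero)
    · have hTd := natDegree_le_of_vertRoots rs rfl rfl hT0 hT'
      refine coeffwise_eq_zero_of_pell D hpell hirr hlead hT0 ?_ ?_
      · rw [hd]; omega
      · rw [hd]; omega
  have hfm : ι (phiX (vertf (vertA s A) (vertB s (PowerSeries.C c * B₀) B) ^ 1)) ∈ Ealg := by
    rw [pow_one, hm']
    exact mul_mem (pow_mem x_mem _) (evJ_mem fun D => (hmP D).1)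
  have hVm := mul_mem (pow_mem x_mem (2 * N)) (evJ_mem fun D => (hmP D).2)
  rw [← hP'] at hVm
  obtain ⟨hr, hr'⟩ := rs.mem_Ealg hN hVm hfm
  have hσ : 1 - algebraMap ℂ L s ^ 3 ≠ 0 := by
    rw [sub_ne_zero, ← map_pow, ← map_one (algebraMap ℂ L), Ne, (algebraMap ℂ L).injective.eq_iff]
    exact hs3.symm
  have hσ0 : algebraMap ℂ L s ≠ 0 := by
    rwa [Ne, map_eq_zero_iff _ (algebraMap ℂ L).injective]
  have hB₀m : ι (PowerSeries.C B₀) ∈ Ealg := by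
    have h1 := isAlgebraic_coeff (fun D => (hmP D).1) 1
    have h2 : algebraMap ℂ L (-2 * (1 - s ^ 3) * c) ≠ 0 := by
      rw [Ne, map_eq_zero_iff _ (algebraMap ℂ L).injective]
      exact mul_ne_zero (mul_ne_zero (by norm_num) (sub_ne_zero.2 hs3.symm)) hc0
    have h3 := ψ_mem_Ealg h1
    rw [hm1, map_mul, map_mul, ψ_τ, ψ_algebraMap, ψ_algebraMap_complex] at h3
    have ht := ι_t_ne_zero
    have h4 := div_mem h3 (mul_mem (algebraMap_complex_mem (-2 * (1 - s ^ 3) * c)) ι_t_mem)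
    rwa [mul_div_cancel_left₀ _ (mul_ne_zero h2 ht)] at h4
  have ht0 := ι_t_ne_zero
  set α := ι (phiX (vertA s A)) with hα
  set β := ι (phiX (vertB s (PowerSeries.C c * B₀) B)) with hβ
  have hr1 : rs.r = ι t * x / y * α + β := rfl
  have hr1' : rs.r' = ι t * x ^ 2 * y * α + β := rfl
  rw [hr1] at hr
  rw [hr1'] at hr'
  have hxy := xy_sq_ne_one
  have hxym : 1 / (x * y) - y ∈ Ealg :=
    sub_mem (div_mem (one_mem _) (mul_mem x_mem y_mem)) y_mem
  have hαm : α ∈ Ealg := by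
    have h1 : α = ((ι t * x / y * α + β) - (ι t * x ^ 2 * y * α + β)) /
        (ι t * x ^ 2 * (1 / (x * y) - y)) := by
      rw [eq_div_iff (mul_ne_zero (mul_ne_zero ht0 (pow_ne_zero 2 hx)) hxy)]
      field_simp
      ring
    rw [h1]
    exact div_mem (sub_mem hr hr') (mul_mem (mul_mem ι_t_mem (pow_mem x_mem 2)) hxym)
  have hβm : β ∈ Ealg := by
    have h1 : β = (ι t * x ^ 2 * y * α + β) - ι t * x ^ 2 * y * α := by ring
    rw [h1]
    exact sub_mem hr' (mul_mem (mul_mem (mul_mem ι_t_mem (pow_mem x_mem 2)) y_mem) hαm)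
  have hσm := algebraMap_complex_mem s
  have hcm := algebraMap_complex_mem c
  have hσm' := sub_mem (one_mem Ealg) (pow_mem hσm 3)
  have hC : ∀ a : ℂ, ι (PowerSeries.C (PowerSeries.C a)) = algebraMap ℂ L a := fun a =>
    (exists_algebraMap_eq a).symm
  simp only [vertA, vertB, map_add, map_sub, map_mul, map_pow, map_neg, map_one, phiX_C, hC, phiX_t,
    ι_phiX_X] at hα hβ
  set σ := algebraMap ℂ L s
  refine ⟨?_, ?_, hB₀m⟩
  · have h1 : ι (phiX A) = (α - (σ - σ ^ 2)) / ((1 - σ ^ 3) * ι t * x ^ 2) := by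
      rw [hα]; field_simp; ring
    rw [h1]
    exact div_mem (sub_mem hαm (sub_mem hσm (pow_mem hσm 2)))
      (mul_mem (mul_mem hσm' ι_t_mem) (pow_mem x_mem 2))
  · have h1 : ι (phiX B) = ((σ ^ 3 * ι t * x ^ 3 + σ ^ 2 * (x - ι t) - β) /
        ((1 - σ ^ 3) * ι t ^ 2 * x ^ 2) - algebraMap ℂ L c * ι (PowerSeries.C B₀)) / σ := by
      rw [hβ]; field_simp; ring
    rw [h1]
    exact div_mem (sub_mem (div_mem (sub_mem (add_mem (mul_mem (mul_mem (pow_mem hσm 3) ι_t_mem)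
      (pow_mem x_mem 3)) (mul_mem (pow_mem hσm 2) (sub_mem x_mem ι_t_mem))) hβm)
      (mul_mem (mul_mem hσm' (pow_mem ι_t_mem 2)) (pow_mem x_mem 2))) (mul_mem hcm hB₀m)) hσm

section Relations

theorem spec_C {phi : M3 →ₐ[ℂ] S} (s : ℂ) : ι (phi (MvPowerSeries.C s)) = algebraMap ℂ L s := by
  rw [show (MvPowerSeries.C s : M3) = algebraMap ℂ M3 s from rfl, phi.commutes]
  exact (IsScalarTower.algebraMap_apply ℂ S L s).symm

theorem kernel_spec : t * ξ * (t * η) - t * ((t * ξ) ^ 2 * (t * η) ^ 2 + t * ξ + t * η) = 0 := by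
  linear_combination -t ^ 2 * η_eq

theorem kernel_spec' :
    t * η * (t * ξ) - t * ((t * η) ^ 2 * (t * ξ) ^ 2 + t * η + t * ξ) = 0 := by
  linear_combination -t ^ 2 * η_eq

variable {s : ℂ} {A B : S} {G : M3}

theorem cell_mem_of_functional {N : ℕ} (hN : N ≠ 0) (hs : s ^ N = 1) (hs3 : s ^ 3 ≠ 1)
    (h : ∀ T X Y : M3, T = MvPowerSeries.X 0 → X = MvPowerSeries.X 1 → Y = MvPowerSeries.X 2 →
      (X * Y - T * (X ^ 2 * Y ^ 2 + X + Y)) * G = X * Y - T * X * incX A - T * Y * incY B +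
      MvPowerSeries.C s * T * X * Y * incX B + MvPowerSeries.C s⁻¹ * T * X * Y ^ 2 * incY A) :
    ι (phiX A) ∈ Ealg ∧ ι (phiX B) ∈ Ealg := by
  have h0 := h _ _ _ rfl rfl rfl
  have h1 := congrArg ι (congrArg specXY h0)
  have h2 := congrArg ι (congrArg specYX h0)
  simp only [map_mul, map_sub, map_add, map_pow, specXY_X0, specXY_X1, specXY_X2, specXY_incX,
    specXY_incY, specYX_X0, specYX_X1, specYX_X2, specYX_incX, specYX_incY, spec_C] at h1 h2
  have hk := congrArg ι kernel_spec
  have hk' := congrArg ι kernel_spec'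
  simp only [map_mul, map_sub, map_add, map_pow, map_zero] at hk hk'
  have hs0 : s ≠ 0 := by rintro rfl; rw [zero_pow hN] at hs; exact zero_ne_one hs
  have hi : algebraMap ℂ L s * algebraMap ℂ L s⁻¹ = 1 := by
    rw [← map_mul, mul_inv_cancel₀ hs0, map_one]
  have hx : ι t * ι ξ = x := rfl
  have hy : ι t * ι η = y := rfl
  have hCs : ι (PowerSeries.C (PowerSeries.C s)) = algebraMap ℂ L s :=
    (exists_algebraMap_eq s).symm
  simp only [hx, hy] at h1 h2 hk hk'
  rw [hk, zero_mul] at h1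
  rw [hk', zero_mul] at h2
  refine cell_mem hN hs hs3 ?_ ?_ <;>
  simp only [cellA, cellB, map_mul, map_sub, map_add, map_pow, map_neg, map_one, phiX_t, phiX_C,
    phiY_t, phiY_C, hCs, ι_phiX_X, ι_phiY_X]
  · linear_combination (1 - algebraMap ℂ L s ^ 3) * (-algebraMap ℂ L s * h1 -
      ι t * x * y ^ 2 * ι (phiY A) * hi)
  · linear_combination (1 - algebraMap ℂ L s ^ 3) * (-algebraMap ℂ L s * h2 -
      ι t * y * x ^ 2 * ι (phiX A) * hi)

theorem vert_mem_of_functional {N : ℕ} (hN : N ≠ 0) (hs : s ^ N = 1) (hs3 : s ^ 3 ≠ 1) {B₀ : R}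
    (hB₀ : PowerSeries.constantCoeff B₀ = 1) (hA : PowerSeries.constantCoeff A = B₀)
    (hB : PowerSeries.constantCoeff B = B₀)
    (h : ∀ T X Y : M3, T = MvPowerSeries.X 0 → X = MvPowerSeries.X 1 → Y = MvPowerSeries.X 2 →
      (X * Y - T * (X ^ 2 * Y ^ 2 + X + Y)) * G = X * Y - T * X * incX A - T * Y * incY B +
      MvPowerSeries.C s * T * Y * (incX B - incX (PowerSeries.C B₀)) +
      MvPowerSeries.C s⁻¹ * T * X * Y ^ 3 * incY A) :
    ι (phiX A) ∈ Ealg ∧ ι (phiX B) ∈ Ealg ∧ ι (PowerSeries.C B₀) ∈ Ealg := by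
  have h0 := h _ _ _ rfl rfl rfl
  have h1 := congrArg ι (congrArg specXY h0)
  have h2 := congrArg ι (congrArg specYX h0)
  simp only [map_mul, map_sub, map_add, map_pow, specXY_X0, specXY_X1, specXY_X2, specXY_incX,
    specXY_incY, specYX_X0, specYX_X1, specYX_X2, specYX_incX, specYX_incY, spec_C, phiX_C,
    phiY_C] at h1 h2
  have hk := congrArg ι kernel_spec
  have hk' := congrArg ι kernel_spec'
  simp only [map_mul, map_sub, map_add, map_pow, map_zero] at hk hk'
  have hs0 : s ≠ 0 := by rintro rfl; rw [zero_pow hN] at hs; exact zero_ne_one hs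
  have hs1 : 1 - s ≠ 0 := sub_ne_zero.2 (by rintro rfl; exact hs3 (one_pow 3))
  have hi : algebraMap ℂ L s * algebraMap ℂ L s⁻¹ = 1 := by
    rw [← map_mul, mul_inv_cancel₀ hs0, map_one]
  have hc : s ^ 2 / (1 - s) * (1 - s) = s ^ 2 := div_mul_cancel₀ _ hs1
  have hcL := congrArg (algebraMap ℂ L) hc
  simp only [map_mul, map_sub, map_pow, map_one] at hcL
  have hx : ι t * ι ξ = x := rfl
  have hy : ι t * ι η = y := rfl
  have hC : ∀ c, ι (PowerSeries.C (PowerSeries.C c)) = algebraMap ℂ L c := fun c =>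
    (exists_algebraMap_eq c).symm
  simp only [hx, hy] at h1 h2 hk hk'
  have h1' := h1
  have h2' := h2
  rw [hk, zero_mul] at h1'
  rw [hk', zero_mul] at h2'
  refine vert_mem hN hs hs3 hc hB₀ hA hB ?_ ?_ <;>
  simp only [vertA, vertB, map_mul, map_sub, map_add, map_pow, map_neg, map_one, phiX_t, phiX_C,
    phiY_t, phiY_C, hC, ι_phiX_X, ι_phiY_X]
  · linear_combination (1 - algebraMap ℂ L s ^ 3) * (-algebraMap ℂ L s * ι t * x ^ 2 * y * h1' -
      ι t ^ 2 * x ^ 3 * y ^ 4 * ι (phiY A) * hi - ι t ^ 2 * x ^ 2 * y ^ 2 * ι (PowerSeries.C B₀) *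
      hcL) + (algebraMap ℂ L s ^ 2 * x - algebraMap ℂ L s ^ 3 * y) * hk
  · linear_combination (1 - algebraMap ℂ L s ^ 3) * (-algebraMap ℂ L s * ι t * y ^ 2 * x * h2' -
      ι t ^ 2 * y ^ 3 * x ^ 4 * ι (phiX A) * hi - ι t ^ 2 * y ^ 2 * x ^ 2 * ι (PowerSeries.C B₀) *
      hcL) + (algebraMap ℂ L s ^ 2 * y - algebraMap ℂ L s ^ 3 * x) * hk'

end Relations

section Algebraicity

open scoped IntermediateField.algebraAdjoinAdjoin in
theorem exists_eval₂_eq_zero {z : L} (hz : z ∈ Ealg) :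
    ∃ p : (MvPolynomial (Fin 2) ℂ)[X], p ≠ 0 ∧
      p.eval₂ (MvPolynomial.aeval (R := ℂ) ![ι t, x] : _ →ₐ[ℂ] L).toRingHom z = 0 := by
  rw [mem_Ealg, ← IsFractionRing.isAlgebraic_iff (Algebra.adjoin ℂ {ι t, x}) E L] at hz
  obtain ⟨q, hq, hqz⟩ := hz
  have hr : Set.range ![ι t, x] = {ι t, x} := by simp [Set.pair_comm]
  let f : MvPolynomial (Fin 2) ℂ →ₐ[ℂ] Algebra.adjoin ℂ {ι t, x} :=
    (MvPolynomial.aeval ![ι t, x]).codRestrict _ fun p => by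
      rw [← hr, Algebra.adjoin_range_eq_range_aeval]
      exact ⟨p, rfl⟩
  have hf : Function.Surjective f.toRingHom := by
    rintro ⟨a, ha⟩
    have ha' := ha
    rw [← hr, Algebra.adjoin_range_eq_range_aeval] at ha'
    obtain ⟨p, hp⟩ := ha'
    exact ⟨p, Subtype.ext hp⟩
  obtain ⟨p, rfl⟩ := Polynomial.map_surjective f.toRingHom hf q
  refine ⟨p, by rintro rfl; simp at hq, ?_⟩
  rw [aeval_def, eval₂_map] at hqz
  exact hqz

theorem isAlgebraic_inc (j : Fin 3) (hj : 0 ≠ j) {A : S} (hA : ι (phiX A) ∈ Ealg) :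
    IsAlgebraic (MvPolynomial (Fin 3) ℂ) (inc j hj A) := by
  obtain ⟨p, hp, h⟩ := exists_eval₂_eq_zero hA
  have hphi : ∀ r : ℂ, phiX (algebraMap ℂ S r) = algebraMap ℂ S r := fun r => by
    rw [show algebraMap ℂ S r = PowerSeries.C (algebraMap ℂ R r) from
      PowerSeries.algebraMap_apply, phiX_C]
  let e : S →ₐ[ℂ] S := { phiX with commutes' := hphi }
  have h1 : p.eval₂ (MvPolynomial.aeval (R := ℂ) ![t, PowerSeries.X] : _ →ₐ[ℂ] S).toRingHom A
      = 0 := by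
    apply phiX_injective
    apply ι_injective
    rw [map_zero, map_zero, ← RingHom.comp_apply, hom_eval₂]
    refine Eq.trans ?_ h
    have : ((IsScalarTower.toAlgHom ℂ S L).comp e).comp
        (MvPolynomial.aeval (R := ℂ) ![t, PowerSeries.X]) = MvPolynomial.aeval ![ι t, x] := by
      refine MvPolynomial.algHom_ext fun i => ?_
      rw [AlgHom.comp_apply, MvPolynomial.aeval_X, MvPolynomial.aeval_X]
      fin_cases i
      · exact congrArg ι phiX_t
      · exact ι_phiX_X
    exact congrArg (fun f : MvPolynomial (Fin 2) ℂ →ₐ[ℂ] L =>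
      p.eval₂ f.toRingHom (ι (phiX A))) this
  have h2 := congrArg (inc j hj).toRingHom h1
  rw [map_zero, hom_eval₂] at h2
  have hinj : Function.Injective ![0, j] := by
    rw [Matrix.vecCons, Fin.cons_injective_iff]
    simpa [Function.injective_of_subsingleton] using hj
  refine ⟨p.map (MvPolynomial.rename ![0, j] : _ →ₐ[ℂ] MvPolynomial (Fin 3) ℂ).toRingHom, ?_, ?_⟩
  · exact (Polynomial.map_ne_zero_iff (MvPolynomial.rename_injective _ hinj)).2 hp
  · rw [aeval_def, eval₂_map]
    refine Eq.trans ?_ h2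
    have : ((MvPolynomial.coeToMvPowerSeries.algHom ℂ : MvPolynomial (Fin 3) ℂ →ₐ[ℂ] M3)).comp
        (MvPolynomial.rename ![0, j]) =
        (inc j hj).comp (MvPolynomial.aeval (R := ℂ) ![t, PowerSeries.X]) := by
      refine MvPolynomial.algHom_ext fun i => ?_
      rw [AlgHom.comp_apply, AlgHom.comp_apply, MvPolynomial.aeval_X, MvPolynomial.rename_X]
      fin_cases i
      · simp [inc_t]
      · simp [inc_X]
    exact congrArg (fun f : MvPolynomial (Fin 2) ℂ →ₐ[ℂ] M3 =>
      p.eval₂ f.toRingHom (inc j hj A)) this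

theorem exists_aeval_eq_zero {G : M3} (hG : IsAlgebraic (MvPolynomial (Fin 3) ℂ) G) :
    ∃ P : MvPolynomial (Fin 4) ℂ, P ≠ 0 ∧ MvPolynomial.aeval
      ![(MvPowerSeries.X 0 : M3), MvPowerSeries.X 1, MvPowerSeries.X 2, G] P = 0 := by
  obtain ⟨p, hp, h⟩ := hG
  let e : Option (Fin 3) → Fin 4 := fun i => i.elim 3 Fin.castSucc
  have he : Function.Injective e := by decide
  refine ⟨MvPolynomial.rename e ((MvPolynomial.optionEquivLeft ℂ (Fin 3)).symm p), ?_, ?_⟩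
  · rw [Ne, ← map_zero (MvPolynomial.rename e), (MvPolynomial.rename_injective e he).eq_iff,
      EmbeddingLike.map_eq_zero_iff]
    exact hp
  · rw [MvPolynomial.aeval_rename, ← h]
    have : MvPolynomial.aeval (![(MvPowerSeries.X 0 : M3), MvPowerSeries.X 1, MvPowerSeries.X 2, G]
        ∘ e) = ((Polynomial.aeval (R := MvPolynomial (Fin 3) ℂ) G).restrictScalars ℂ).comp
          (MvPolynomial.optionEquivLeft ℂ (Fin 3)).toAlgHom := by
      refine MvPolynomial.algHom_ext fun i => ?_
      rcases i with _ | i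
      · simp [e]
      · fin_cases i <;> simp [e, MvPowerSeries.algebraMap_apply']
    rw [this]
    simp

theorem isAlgebraic_X (i : Fin 3) :
    IsAlgebraic (MvPolynomial (Fin 3) ℂ) (MvPowerSeries.X i : M3) := by
  rw [show (MvPowerSeries.X i : M3) = algebraMap (MvPolynomial (Fin 3) ℂ) M3 (MvPolynomial.X i) from
    (MvPolynomial.coe_X i).symm]
  exact isAlgebraic_algebraMap _

theorem isAlgebraic_C (s : ℂ) :
    IsAlgebraic (MvPolynomial (Fin 3) ℂ) (MvPowerSeries.C s : M3) := by
  rw [show (MvPowerSeries.C s : M3) = algebraMap (MvPolynomial (Fin 3) ℂ) M3 (MvPolynomial.C s) from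
    (MvPolynomial.coe_C s).symm]
  exact isAlgebraic_algebraMap _

theorem isAlgebraic_of_kernel_mul {G H : M3} (hH : IsAlgebraic (MvPolynomial (Fin 3) ℂ) H)
    (h : (MvPowerSeries.X 1 * MvPowerSeries.X 2 - MvPowerSeries.X 0 * (MvPowerSeries.X 1 ^ 2 *
      MvPowerSeries.X 2 ^ 2 + MvPowerSeries.X 1 + MvPowerSeries.X 2)) * G = H) :
    IsAlgebraic (MvPolynomial (Fin 3) ℂ) G := by
  let κ : MvPolynomial (Fin 3) ℂ := MvPolynomial.X 1 * MvPolynomial.X 2 - MvPolynomial.X 0 *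
    (MvPolynomial.X 1 ^ 2 * MvPolynomial.X 2 ^ 2 + MvPolynomial.X 1 + MvPolynomial.X 2)
  have hκ : κ ≠ 0 := fun h0 => by
    have := congrArg (MvPolynomial.eval ![0, 1, 1]) h0
    simp [κ] at this
  have hκM : (κ : M3) = MvPowerSeries.X 1 * MvPowerSeries.X 2 - MvPowerSeries.X 0 *
      (MvPowerSeries.X 1 ^ 2 * MvPowerSeries.X 2 ^ 2 + MvPowerSeries.X 1 + MvPowerSeries.X 2) := by
    rw [← MvPolynomial.coeToMvPowerSeries.ringHom_apply]
    simp only [κ, map_sub, map_mul, map_add, map_pow,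
      MvPolynomial.coeToMvPowerSeries.ringHom_apply, MvPolynomial.coe_X]
  rw [← hκM] at h
  rw [← h] at hH
  refine IsAlgebraic.of_mul (mem_nonZeroDivisors_of_ne_zero ?_) ?_ hH
  · exact (MvPolynomial.coe_eq_zero_iff).not.2 hκ
  · exact isAlgebraic_algebraMap (A := M3) κ

variable {N : ℕ} {s : ℂ}

theorem isAlgebraic_cell (hN : N ≠ 0) (hs : s ^ N = 1) (hs3 : s ^ 3 ≠ 1) :
    IsAlgebraic (MvPolynomial (Fin 3) ℂ) (gen3 (wt cellStep s)) := by
  have hs0 : s ≠ 0 := by rintro rfl; rw [zero_pow hN] at hs; exact zero_ne_one hs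
  have h := cell_functional (wt_zero cellStep s) (wt_cell_succ hs0)
  obtain ⟨hA, hB⟩ := cell_mem_of_functional hN hs hs3 h
  have h0 := isAlgebraic_X 0
  have h1 := isAlgebraic_X 1
  have h2 := isAlgebraic_X 2
  have hAx := isAlgebraic_inc 1 zero_ne_one_fin hA
  have hAy := isAlgebraic_inc 2 zero_ne_two_fin hA
  have hBx := isAlgebraic_inc 1 zero_ne_one_fin hB
  have hBy := isAlgebraic_inc 2 zero_ne_two_fin hB
  exact isAlgebraic_of_kernel_mul (((((h1.mul h2).sub ((h0.mul h1).mul hAx)).sub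
    ((h0.mul h2).mul hBy)).add (((((isAlgebraic_C s).mul h0).mul h1).mul h2).mul hBx)).add
    (((((isAlgebraic_C s⁻¹).mul h0).mul h1).mul (h2.pow 2)).mul hAy)) (h _ _ _ rfl rfl rfl)

theorem isAlgebraic_vert (hN : N ≠ 0) (hs : s ^ N = 1) (hs3 : s ^ 3 ≠ 1) :
    IsAlgebraic (MvPolynomial (Fin 3) ℂ) (gen3 (wt vertStep s)) := by
  have hs0 : s ≠ 0 := by rintro rfl; rw [zero_pow hN] at hs; exact zero_ne_one hs
  have h := vert_functional (wt_zero vertStep s) (wt_vert_succ hs0)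
  obtain ⟨hA, hB, hC⟩ := vert_mem_of_functional hN hs hs3
    (by simp [wt_zero]) (by simp [gen2]) (by simp [gen2]) h
  rw [← phiX_C] at hC
  have h0 := isAlgebraic_X 0
  have h1 := isAlgebraic_X 1
  have h2 := isAlgebraic_X 2
  have hAx := isAlgebraic_inc 1 zero_ne_one_fin hA
  have hAy := isAlgebraic_inc 2 zero_ne_two_fin hA
  have hBx := isAlgebraic_inc 1 zero_ne_one_fin hB
  have hBy := isAlgebraic_inc 2 zero_ne_two_fin hB
  have hCx := isAlgebraic_inc 1 zero_ne_one_fin hC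
  exact isAlgebraic_of_kernel_mul (((((h1.mul h2).sub ((h0.mul h1).mul hAx)).sub
    ((h0.mul h2).mul hBy)).add ((((isAlgebraic_C s).mul h0).mul h2).mul (hBx.sub hCx))).add
    (((((isAlgebraic_C s⁻¹).mul h0).mul h1).mul (h2.pow 3)).mul hAy)) (h _ _ _ rfl rfl rfl)

end Algebraicity

end Kreweras

/-- Corollary 6: for `s` a root of unity with `s³ ≠ 1`, `G(t,s,x,y)` and
`G̃(t,s,x,y)` are algebraic over `ℂ(t,x,y)`. -/
theorem G_algebraic (N : ℕ) (hN : 0 < N) (s : ℂ) (hsN : s ^ N = 1) (hs3 : s ^ 3 ≠ 1) :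
    (∃ P : MvPolynomial (Fin 4) ℂ, P ≠ 0 ∧
      MvPolynomial.aeval
        ![(MvPowerSeries.X 0 : MvPowerSeries (Fin 3) ℂ), MvPowerSeries.X 1,
          MvPowerSeries.X 2, cellGC s] P = 0) ∧
    (∃ P : MvPolynomial (Fin 4) ℂ, P ≠ 0 ∧
      MvPolynomial.aeval
        ![(MvPowerSeries.X 0 : MvPowerSeries (Fin 3) ℂ), MvPowerSeries.X 1,
          MvPowerSeries.X 2, vertGC s] P = 0) := by
  exact ⟨Kreweras.exists_aeval_eq_zero (Kreweras.isAlgebraic_cell hN.ne' hsN hs3),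
    Kreweras.exists_aeval_eq_zero (Kreweras.isAlgebraic_vert hN.ne' hsN hs3)⟩
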